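/- arXiv:1508.02235 — 9 statements merged into one kernel-verified Lean document; each statement's English description precedes it below -/
import Mathlib

section
/- Let f : [0,∞) → [0,∞) be bounded, Borel measurable and right regular at zero. Then there exists a minimal solution of the initial value problem (IVP) (f, 0): a function α₁ : [0,∞) → [0,∞) such that α₁(t) = ∫₀ᵗ f(α₁(s)) ds for all t ≥ 0, and such that every function z : [0,∞) → [0,∞) with z(t) = ∫₀ᵗ f(z(s)) ds for all t ≥ 0 satisfies α₁(t) ≤ z(t) for all t ≥ 0. -/
open MeasureTheory

lemma aux_ii (f : ℝ → ℝ) (hf0 : ∀ t, 0 ≤ f t) (M : ℝ) (hM : ∀ t, f t ≤ M) (w : ℝ → ℝ) (a b : ℝ)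
    (hw : AEStronglyMeasurable (fun s => f (w s)) (volume.restrict (Set.uIoc a b))) :
    IntervalIntegrable (fun s => f (w s)) volume a b := by
  rw [intervalIntegrable_iff]
  have : IsFiniteMeasure (volume.restrict (Set.uIoc a b)) := by
    unfold Set.uIoc; infer_instance
  refine Integrable.of_bound (C := M) hw (Filter.Eventually.of_forall fun s => ?_)
  rw [Real.norm_of_nonneg (hf0 _)]; exact hM _

lemma aux_mono (f : ℝ → ℝ) (hf0 : ∀ t, 0 ≤ f t) (M : ℝ) (hM : ∀ t, f t ≤ M)
    (hf : Measurable f) (z : ℝ → ℝ)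
    (hz : ∀ t, 0 ≤ t → z t = ∫ s in (0:ℝ)..t, f (z s)) : MonotoneOn z (Set.Ici 0) := by
  have key : ∀ s t, 0 ≤ s → s ≤ t → IntervalIntegrable (fun s => f (z s)) volume 0 t →
      IntervalIntegrable (fun s => f (z s)) volume 0 s ∧ z s ≤ z t := by
    intro s t hs hst h
    have h1 : IntervalIntegrable (fun s => f (z s)) volume 0 s := h.mono_set (by
      rw [Set.uIcc_of_le hs, Set.uIcc_of_le (hs.trans hst)]; exact Set.Icc_subset_Icc_right hst)
    refine ⟨h1, ?_⟩
    rw [hz s hs, hz t (hs.trans hst)]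
    apply intervalIntegral.integral_mono_interval le_rfl hs hst _ h
    exact Filter.Eventually.of_forall fun x => hf0 _
  let I : Set ℝ := {t | 0 ≤ t ∧ IntervalIntegrable (fun s => f (z s)) volume 0 t}
  let B : Set ℝ := {t | 0 ≤ t ∧ ¬ IntervalIntegrable (fun s => f (z s)) volume 0 t}
  have hI : MonotoneOn z I := fun s hs t ht hst => (key s t hs.1 hst ht.2).2
  have hB : MonotoneOn z B := fun s hs t ht hst => by
    rw [hz s hs.1, hz t ht.1, intervalIntegral.integral_undef hs.2,
      intervalIntegral.integral_undef ht.2]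
  have mI : MeasurableSet I := Set.OrdConnected.measurableSet ⟨fun a ha b hb x hx =>
    ⟨ha.1.trans hx.1, (key x b (ha.1.trans hx.1) hx.2 hb.2).1⟩⟩
  have mB : MeasurableSet B := Set.OrdConnected.measurableSet ⟨fun a ha b hb x hx =>
    ⟨ha.1.trans hx.1, fun h => ha.2 (key a x ha.1 hx.1 h).1⟩⟩
  have hU : I ∪ B = Set.Ici 0 := by
    ext t; simp only [Set.mem_union, Set.mem_Ici, I, B, Set.mem_ofPred_eq]; tauto
  have hz' : AEMeasurable z (volume.restrict (Set.Ici (0:ℝ))) := by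
    rw [← hU, aemeasurable_union_iff]
    exact ⟨aemeasurable_restrict_of_monotoneOn mI hI, aemeasurable_restrict_of_monotoneOn mB hB⟩
  intro s hs t ht hst
  refine (key s t hs hst (aux_ii f hf0 M hM z 0 t ?_)).2
  refine (hf.comp_aemeasurable (hz'.mono_measure ?_)).aestronglyMeasurable
  apply Measure.restrict_mono _ le_rfl
  rw [Set.uIoc_of_le ht]; intro x hx; exact hx.1.le

lemma aux_time (f : ℝ → ℝ) (hf0 : ∀ t, 0 ≤ f t) (M : ℝ) (hM : ∀ t, f t ≤ M)
    (hf : Measurable f) (w : ℝ → ℝ) (hw : Monotone w)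
    (hz : ∀ t, 0 ≤ t → w t = ∫ s in (0:ℝ)..t, f (w s)) (t : ℝ) (ht : 0 ≤ t)
    (hpos : ∀ s, 0 ≤ s → s < t → 0 < f (w s)) :
    ∫⁻ x in Set.Ico 0 (w t), (ENNReal.ofReal (f x))⁻¹ = ENNReal.ofReal t := by
  have hwm := hw.measurable
  have hii : ∀ a b, IntervalIntegrable (fun s => f (w s)) volume a b := fun a b =>
    aux_ii f hf0 M hM w a b (hf.comp hwm).aestronglyMeasurable
  have w0 : w 0 = 0 := by rw [hz 0 le_rfl]; simp
  have hcont : ContinuousOn w (Set.Icc 0 t) :=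
    (intervalIntegral.continuous_primitive hii 0).continuousOn.congr fun x hx => hz x hx.1
  have hL : ∀ a, 0 ≤ a → a ≤ t →
      ∫⁻ s in Set.Ico a t, ENNReal.ofReal (f (w s)) = ENNReal.ofReal (w t - w a) := by
    intro a ha hat
    rw [hz t ht, hz a ha, intervalIntegral.integral_interval_sub_left (hii _ _) (hii _ _),
      intervalIntegral.integral_of_le hat, ofReal_integral_eq_lintegral_ofReal
      ((intervalIntegrable_iff_integrableOn_Ioc_of_le hat).1 (hii a t))
      (Filter.Eventually.of_forall fun x => hf0 _)]
    exact setLIntegral_congr Ico_ae_eq_Ioc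
  let ν : Measure ℝ := (volume.restrict (Set.Ico 0 t)).withDensity
    (fun s => ENNReal.ofReal (f (w s)))
  have hmap : volume.restrict (Set.Ico 0 (w t)) = Measure.map w ν := by
    apply Measure.ext_of_Ici
    intro b
    rw [Measure.map_apply hwm measurableSet_Ici, withDensity_apply _ (hwm measurableSet_Ici),
      Measure.restrict_apply measurableSet_Ici, Measure.restrict_restrict (hwm measurableSet_Ici)]
    by_cases hb : b ≤ 0
    · have e1 : Set.Ici b ∩ Set.Ico 0 (w t) = Set.Ico 0 (w t) :=
        Set.inter_eq_right.2 fun x hx => hb.trans hx.1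
      have e2 : w ⁻¹' Set.Ici b ∩ Set.Ico 0 t = Set.Ico 0 t :=
        Set.inter_eq_right.2 fun x hx => hb.trans (w0 ▸ hw hx.1)
      rw [e1, e2, hL 0 le_rfl ht, Real.volume_Ico, w0]
    push Not at hb
    by_cases hbc : b ≤ w t
    · have hne : (Set.Icc 0 t ∩ w ⁻¹' Set.Ici b).Nonempty := ⟨t, ⟨ht, le_rfl⟩, hbc⟩
      have hcl : IsCompact (Set.Icc 0 t ∩ w ⁻¹' Set.Ici b) :=
        isCompact_Icc.of_isClosed_subset
          (hcont.preimage_isClosed_of_isClosed isClosed_Icc isClosed_Ici) Set.inter_subset_left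
      obtain ⟨a, ⟨⟨ha0, hat⟩, hab⟩, hal⟩ := hcl.exists_isLeast hne
      obtain ⟨s', hs', hsb⟩ := intermediate_value_Icc ht hcont (show b ∈ Set.Icc (w 0) (w t) from
        ⟨w0.le.trans hb.le, hbc⟩)
      have hwa : w a = b := le_antisymm (hsb ▸ hw (hal ⟨hs', hsb.ge⟩)) hab
      have e1 : Set.Ici b ∩ Set.Ico 0 (w t) = Set.Ico b (w t) := by
        ext x; simp only [Set.mem_inter_iff, Set.mem_Ici, Set.mem_Ico]
        constructor
        · rintro ⟨h1, h2, h3⟩; exact ⟨h1, h3⟩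
        · rintro ⟨h1, h2⟩; exact ⟨h1, hb.le.trans h1, h2⟩
      have e2 : w ⁻¹' Set.Ici b ∩ Set.Ico 0 t = Set.Ico a t := by
        ext x; simp only [Set.mem_inter_iff, Set.mem_preimage, Set.mem_Ici, Set.mem_Ico]
        constructor
        · rintro ⟨h1, h2, h3⟩; exact ⟨hal ⟨⟨h2, h3.le⟩, h1⟩, h3⟩
        · rintro ⟨h1, h2⟩; exact ⟨hwa ▸ hw h1, ha0.trans h1, h2⟩
      rw [e1, e2, hL a ha0 hat, Real.volume_Ico, hwa]
    · push Not at hbc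
      have e1 : Set.Ici b ∩ Set.Ico 0 (w t) = ∅ := by
        ext x; simp only [Set.mem_inter_iff, Set.mem_Ici, Set.mem_Ico, Set.mem_empty_iff_false,
          iff_false]
        rintro ⟨h1, h2, h3⟩; linarith
      have e2 : w ⁻¹' Set.Ici b ∩ Set.Ico 0 t = ∅ := by
        ext x; simp only [Set.mem_inter_iff, Set.mem_preimage, Set.mem_Ici, Set.mem_Ico,
          Set.mem_empty_iff_false, iff_false]
        rintro ⟨h1, h2, h3⟩; linarith [hw h3.le]
      rw [e1, e2]; simp
  have hm1 : Measurable fun x => (ENNReal.ofReal (f x))⁻¹ := hf.ennreal_ofReal.inv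
  have hm2 : Measurable fun s => ENNReal.ofReal (f (w s)) := (hf.comp hwm).ennreal_ofReal
  rw [hmap, lintegral_map hm1 hwm]
  have hm3 : Measurable fun s => (ENNReal.ofReal (f (w s)))⁻¹ := hm1.comp hwm
  change ∫⁻ a, (ENNReal.ofReal (f (w a)))⁻¹ ∂((volume.restrict (Set.Ico 0 t)).withDensity
    (fun s => ENNReal.ofReal (f (w s)))) = _
  rw [lintegral_withDensity_eq_lintegral_mul _ hm2 hm3]
  rw [setLIntegral_congr_fun (g := fun _ => 1) measurableSet_Ico]
  · simp
  · intro s hs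
    simp only [Pi.mul_apply]
    exact ENNReal.mul_inv_cancel (by simpa using hpos s hs.1 hs.2) ENNReal.ofReal_ne_top

open Classical in
/-- reciprocal of `f`, infinite from the first zero of `f` on -/
noncomputable def auxG (f : ℝ → ℝ) (x : ℝ) : ENNReal :=
  if ∃ y, 0 ≤ y ∧ y ≤ x ∧ f y = 0 then ⊤ else (ENNReal.ofReal (f x))⁻¹

/-- time needed to reach `x` -/
noncomputable def auxH (f : ℝ → ℝ) (x : ℝ) : ENNReal := ∫⁻ s in Set.Ico 0 x, auxG f s

/-- the minimal solution -/
noncomputable def auxA (f : ℝ → ℝ) (t : ℝ) : ℝ := sSup {x | 0 ≤ x ∧ auxH f x ≤ ENNReal.ofReal t}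

lemma auxG_meas (f : ℝ → ℝ) (hf : Measurable f) : Measurable (auxG f) := by
  unfold auxG
  refine Measurable.ite ?_ measurable_const hf.ennreal_ofReal.inv
  apply Set.OrdConnected.measurableSet
  refine ⟨fun a ha b hb x hx => ?_⟩
  obtain ⟨y, h1, h2, h3⟩ := ha
  exact ⟨y, h1, h2.trans hx.1, h3⟩

lemma auxH_add (f : ℝ → ℝ) (a b : ℝ) (ha : 0 ≤ a) (hab : a ≤ b) :
    auxH f b = auxH f a + ∫⁻ s in Set.Ico a b, auxG f s := by
  unfold auxH
  rw [← lintegral_union measurableSet_Ico, Set.Ico_union_Ico_eq_Ico ha hab]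
  rw [Set.disjoint_left]
  intro x hx hx'
  exact absurd hx.2 (not_lt.2 hx'.1)

lemma auxH_mono (f : ℝ → ℝ) : Monotone (auxH f) := fun _ _ h =>
  lintegral_mono_set (Set.Ico_subset_Ico_right h)

lemma auxH_zero (f : ℝ → ℝ) : auxH f 0 = 0 := by simp [auxH]

lemma auxH_lower (f : ℝ → ℝ) (M : ℝ) (hM : ∀ t, f t ≤ M)
    (a b : ℝ) (ha : 0 ≤ a) (hab : a ≤ b) :
    auxH f a + (ENNReal.ofReal M)⁻¹ * ENNReal.ofReal (b - a) ≤ auxH f b := by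
  rw [auxH_add f a b ha hab]
  gcongr
  rw [← Real.volume_Ico, ← setLIntegral_const]
  apply lintegral_mono
  intro x
  unfold auxG
  split_ifs
  · exact le_top
  · exact ENNReal.inv_le_inv.2 (ENNReal.ofReal_le_ofReal (hM x))

lemma auxS_bdd (f : ℝ → ℝ) (M : ℝ) (hM0 : 0 < M) (hM : ∀ t, f t ≤ M) (t : ℝ) :
    BddAbove {x | 0 ≤ x ∧ auxH f x ≤ ENNReal.ofReal t} := by
  refine ⟨M * max t 0, fun x hx => ?_⟩
  have h := (auxH_lower f M hM 0 x le_rfl hx.1).trans hx.2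
  rw [auxH_zero, zero_add, sub_zero, mul_comm, ← div_eq_mul_inv,
    ← ENNReal.ofReal_div_of_pos hM0] at h
  have h2 := ENNReal.toReal_mono ENNReal.ofReal_ne_top h
  rw [ENNReal.toReal_ofReal (div_nonneg hx.1 hM0.le), ENNReal.toReal_ofReal', div_le_iff₀ hM0] at h2
  linarith

lemma auxA_nonneg (f : ℝ → ℝ) (t : ℝ) : 0 ≤ auxA f t := Real.sSup_nonneg fun _ h => h.1

lemma auxH_A (f : ℝ → ℝ) (M : ℝ) (hM0 : 0 < M) (hM : ∀ t, f t ≤ M) (t : ℝ) :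
    auxH f (auxA f t) ≤ ENNReal.ofReal t := by
  obtain ⟨u, hu, hlim, hmem⟩ := exists_seq_tendsto_sSup
    (S := {x | 0 ≤ x ∧ auxH f x ≤ ENNReal.ofReal t}) ⟨0, le_rfl, by simp [auxH_zero]⟩
    (auxS_bdd f M hM0 hM t)
  have hsub : Set.Ico 0 (auxA f t) ⊆ ⋃ n, Set.Ico 0 (u n) := by
    intro x hx
    obtain ⟨n, hn⟩ := (hlim.eventually (lt_mem_nhds hx.2)).exists
    exact Set.mem_iUnion.2 ⟨n, hx.1, hn⟩
  have hd : Directed (fun x1 x2 => x1 ⊆ x2) fun n => Set.Ico 0 (u n) :=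
    Monotone.directed_le fun i j h => Set.Ico_subset_Ico_right (hu h)
  calc auxH f (auxA f t) ≤ ∫⁻ s in ⋃ n, Set.Ico 0 (u n), auxG f s := lintegral_mono_set hsub
    _ = ⨆ n, ∫⁻ s in Set.Ico 0 (u n), auxG f s := setLIntegral_iUnion_of_directed _ hd
    _ ≤ _ := iSup_le fun n => (hmem n).2

lemma auxA_iff (f : ℝ → ℝ) (M : ℝ) (hM0 : 0 < M) (hM : ∀ t, f t ≤ M) (s b : ℝ) (hb : 0 ≤ b) :
    b ≤ auxA f s ↔ auxH f b ≤ ENNReal.ofReal s :=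
  ⟨fun h => (auxH_mono f h).trans (auxH_A f M hM0 hM s),
    fun h => le_csSup (auxS_bdd f M hM0 hM s) ⟨hb, h⟩⟩

lemma auxA_mono (f : ℝ → ℝ) (M : ℝ) (hM0 : 0 < M) (hM : ∀ t, f t ≤ M) : Monotone (auxA f) := by
  intro s t h
  rw [auxA_iff f M hM0 hM t _ (auxA_nonneg f s)]
  exact (auxH_A f M hM0 hM s).trans (ENNReal.ofReal_le_ofReal h)

lemma auxA_pos (f : ℝ → ℝ) (hf0 : ∀ t, 0 ≤ f t) (M : ℝ) (hM0 : 0 < M) (hM : ∀ t, f t ≤ M)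
    (t x : ℝ) (hx : 0 ≤ x) (hxt : x < auxA f t) : 0 < f x := by
  by_contra hc
  have h0 : f x = 0 := le_antisymm (not_lt.1 hc) (hf0 x)
  have h1 := auxH_A f M hM0 hM t
  rw [auxH_add f x _ hx hxt.le] at h1
  rw [setLIntegral_congr_fun (g := fun _ => ⊤) measurableSet_Ico, setLIntegral_const,
    Real.volume_Ico, ENNReal.top_mul] at h1
  · simp at h1
  · simpa using hxt
  · intro y hy
    simp only [auxG]
    rw [if_pos ⟨x, hx, hy.1, h0⟩]

lemma auxG_eq (f : ℝ → ℝ) (x : ℝ) (h : ∀ y, 0 ≤ y → y ≤ x → 0 < f y) :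
    auxG f x = (ENNReal.ofReal (f x))⁻¹ := by
  unfold auxG
  rw [if_neg]
  rintro ⟨y, h1, h2, h3⟩
  exact (h y h1 h2).ne' h3

lemma auxA_stop (f : ℝ → ℝ) (hf0 : ∀ t, 0 ≤ f t) (M : ℝ) (hM0 : 0 < M) (hM : ∀ t, f t ≤ M)
    (hf_reg : ∀ t, 0 ≤ t → 0 < f t →
      ∃ ε > (0:ℝ), ∃ δ > (0:ℝ), ∀ s, t < s → s < t + δ → ε < f s)
    (t : ℝ) (h : auxH f (auxA f t) < ENNReal.ofReal t) : f (auxA f t) = 0 := by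
  by_contra hc
  have hpos : 0 < f (auxA f t) := lt_of_le_of_ne (hf0 _) (Ne.symm hc)
  have hc0 := auxA_nonneg f t
  obtain ⟨ε, hε, δ, hδ, hr⟩ := hf_reg _ hc0 hpos
  set c := auxA f t with hcdef
  have hp : ∀ y, 0 ≤ y → y < c + δ → 0 < f y := by
    intro y hy hyc
    rcases lt_trichotomy y c with h1 | h1 | h1
    · exact auxA_pos f hf0 M hM0 hM t y hy h1
    · exact h1 ▸ hpos
    · exact hε.trans (hr y h1 hyc)
  have hfin : auxH f c ≠ ⊤ := (h.trans_le le_top).ne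
  set r := (auxH f c).toReal
  have hr0 : 0 ≤ r := ENNReal.toReal_nonneg
  have hHr : auxH f c = ENNReal.ofReal r := (ENNReal.ofReal_toReal hfin).symm
  have hrt : r < t := by
    rw [hHr] at h; exact (ENNReal.ofReal_lt_ofReal_iff_of_nonneg hr0).1 h
  set e := min ε (f c)
  have he : 0 < e := lt_min hε hpos
  set η := min δ ((t - r) * e)
  have hη : 0 < η := lt_min hδ (mul_pos (by linarith) he)
  have hle : c + η ≤ c := by
    rw [hcdef, auxA_iff f M hM0 hM t _ (by linarith), ← hcdef, auxH_add f c _ hc0 (by linarith)]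
    calc auxH f c + ∫⁻ s in Set.Ico c (c + η), auxG f s
        ≤ auxH f c + ∫⁻ s in Set.Ico c (c + η), (ENNReal.ofReal e)⁻¹ := by
          gcongr 1
          apply setLIntegral_mono measurable_const
          intro x hx
          have hxd : x < c + δ := hx.2.trans_le (by linarith [min_le_left δ ((t - r) * e)])
          rw [auxG_eq f x fun y hy hyx => hp y hy (hyx.trans_lt hxd)]
          apply ENNReal.inv_le_inv.2 (ENNReal.ofReal_le_ofReal _)
          rcases hx.1.eq_or_lt with h1 | h1
          · rw [← h1]; exact min_le_right _ _
          · exact (min_le_left _ _).trans (hr x h1 hxd).le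
      _ = ENNReal.ofReal (r + η / e) := by
          rw [setLIntegral_const, Real.volume_Ico, hHr, add_sub_cancel_left, mul_comm,
            ← div_eq_mul_inv, ← ENNReal.ofReal_div_of_pos he,
            ENNReal.ofReal_add hr0 (by positivity)]
      _ ≤ _ := by
          apply ENNReal.ofReal_le_ofReal
          have : η / e ≤ t - r := by rw [div_le_iff₀ he]; exact min_le_right _ _
          linarith
  linarith

lemma auxA_int (f : ℝ → ℝ) (hf0 : ∀ t, 0 ≤ f t) (M : ℝ) (hM0 : 0 < M) (hM : ∀ t, f t ≤ M)
    (hf : Measurable f) (t : ℝ) (ht : 0 ≤ t) (h : auxH f (auxA f t) = ENNReal.ofReal t) :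
    auxA f t = ∫ s in (0:ℝ)..t, f (auxA f s) := by
  have hc0 := auxA_nonneg f t
  have hmono := auxA_mono f M hM0 hM
  have hAm := hmono.measurable
  have hGm := auxG_meas f hf
  let ν : Measure ℝ := (volume.restrict (Set.Ico 0 (auxA f t))).withDensity (auxG f)
  have hmap : Measure.map (auxA f) (volume.restrict (Set.Ico 0 t)) = ν := by
    have : IsFiniteMeasure (Measure.map (auxA f) (volume.restrict (Set.Ico 0 t))) :=
      Measure.isFiniteMeasure_map _ _
    apply Measure.ext_of_Ici
    intro b
    rw [Measure.map_apply hAm measurableSet_Ici, withDensity_apply _ measurableSet_Ici,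
      Measure.restrict_apply (hAm measurableSet_Ici), Measure.restrict_restrict measurableSet_Ici]
    by_cases hb : b ≤ 0
    · have e1 : Set.Ici b ∩ Set.Ico 0 (auxA f t) = Set.Ico 0 (auxA f t) :=
        Set.inter_eq_right.2 fun x hx => hb.trans hx.1
      have e2 : auxA f ⁻¹' Set.Ici b ∩ Set.Ico 0 t = Set.Ico 0 t :=
        Set.inter_eq_right.2 fun x hx => hb.trans (auxA_nonneg f x)
      rw [e1, e2, Real.volume_Ico, sub_zero, ← h]; rfl
    push Not at hb
    by_cases hbc : b ≤ auxA f t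
    · have hHb := (auxA_iff f M hM0 hM t b hb.le).1 hbc
      have hfin : auxH f b ≠ ⊤ := (hHb.trans_lt ENNReal.ofReal_lt_top).ne
      have hHr : auxH f b = ENNReal.ofReal (auxH f b).toReal := (ENNReal.ofReal_toReal hfin).symm
      set r := (auxH f b).toReal
      have hr0 : 0 ≤ r := ENNReal.toReal_nonneg
      have e1 : Set.Ici b ∩ Set.Ico 0 (auxA f t) = Set.Ico b (auxA f t) := by
        ext x; simp only [Set.mem_inter_iff, Set.mem_Ici, Set.mem_Ico]
        constructor
        · rintro ⟨h1, h2, h3⟩; exact ⟨h1, h3⟩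
        · rintro ⟨h1, h2⟩; exact ⟨h1, hb.le.trans h1, h2⟩
      have e2 : auxA f ⁻¹' Set.Ici b ∩ Set.Ico 0 t = Set.Ico r t := by
        ext x; simp only [Set.mem_inter_iff, Set.mem_preimage, Set.mem_Ici, Set.mem_Ico]
        rw [auxA_iff f M hM0 hM x b hb.le, hHr]
        constructor
        · rintro ⟨h1, h2, h3⟩; exact ⟨(ENNReal.ofReal_le_ofReal_iff h2).1 h1, h3⟩
        · rintro ⟨h1, h2⟩; exact ⟨ENNReal.ofReal_le_ofReal h1, hr0.trans h1, h2⟩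
      have h3 := auxH_add f b _ hb.le hbc
      rw [e1, e2, Real.volume_Ico, ENNReal.ofReal_sub _ hr0, ← h, ← hHr, h3]
      exact ENNReal.add_sub_cancel_left hfin
    · push Not at hbc
      have e1 : Set.Ici b ∩ Set.Ico 0 (auxA f t) = ∅ := by
        ext x; simp only [Set.mem_inter_iff, Set.mem_Ici, Set.mem_Ico, Set.mem_empty_iff_false,
          iff_false]
        rintro ⟨h1, h2, h3⟩; linarith
      have e2 : auxA f ⁻¹' Set.Ici b ∩ Set.Ico 0 t = ∅ := by
        ext x; simp only [Set.mem_inter_iff, Set.mem_preimage, Set.mem_Ici, Set.mem_Ico,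
          Set.mem_empty_iff_false, iff_false]
        rintro ⟨h1, h2, h3⟩; linarith [hmono h3.le]
      rw [e1, e2]; simp
  have hm1 : Measurable fun x => ENNReal.ofReal (f x) := hf.ennreal_ofReal
  have key : ∫⁻ s in Set.Ico 0 t, ENNReal.ofReal (f (auxA f s)) = ENNReal.ofReal (auxA f t) := by
    rw [← lintegral_map hm1 hAm, hmap]
    change ∫⁻ a, ENNReal.ofReal (f a) ∂((volume.restrict (Set.Ico 0 (auxA f t))).withDensity
      (auxG f)) = _
    rw [lintegral_withDensity_eq_lintegral_mul _ hGm hm1]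
    rw [setLIntegral_congr_fun (g := fun _ => 1) measurableSet_Ico]
    · simp
    · intro x hx
      have hp : ∀ y, 0 ≤ y → y ≤ x → 0 < f y := fun y hy hyx =>
        auxA_pos f hf0 M hM0 hM t y hy (hyx.trans_lt hx.2)
      simp only [Pi.mul_apply]
      rw [auxG_eq f x hp]
      exact ENNReal.inv_mul_cancel (by simpa using hp x hx.1 le_rfl) ENNReal.ofReal_ne_top
  rw [intervalIntegral.integral_of_le ht, integral_eq_lintegral_of_nonneg_ae
    (Filter.Eventually.of_forall fun x => hf0 _) (hf.comp hAm).aestronglyMeasurable,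
    ← setLIntegral_congr Ico_ae_eq_Ioc, key, ENNReal.toReal_ofReal hc0]

/-- existence of a minimal solution of the IVP (f, 0) for a bounded,
Borel measurable function `f : [0,∞) → [0,∞)` that is right regular at zero. -/
theorem stmt_0 (f : ℝ → ℝ) (hf_nonneg : ∀ t, 0 ≤ f t)
    (hf_bdd : ∃ M : ℝ, ∀ t, f t ≤ M) (hf_meas : Measurable f)
    (hf_reg : ∀ t, 0 ≤ t → 0 < f t →
      ∃ ε > (0:ℝ), ∃ δ > (0:ℝ), ∀ s, t < s → s < t + δ → ε < f s) :
    ∃ α₁ : ℝ → ℝ, (∀ t, 0 ≤ α₁ t) ∧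
      (∀ t, 0 ≤ t → α₁ t = ∫ s in (0:ℝ)..t, f (α₁ s)) ∧
      (∀ z : ℝ → ℝ, (∀ t, 0 ≤ z t) →
        (∀ t, 0 ≤ t → z t = ∫ s in (0:ℝ)..t, f (z s)) →
        ∀ t, 0 ≤ t → α₁ t ≤ z t) := by
  obtain ⟨M, hM, hM0⟩ : ∃ M : ℝ, (∀ t, f t ≤ M) ∧ 0 < M := by
    obtain ⟨M, hM⟩ := hf_bdd
    exact ⟨max M 1, fun t => (hM t).trans (le_max_left _ _), lt_max_of_lt_right one_pos⟩
  have hmono := auxA_mono f M hM0 hM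
  have hii : ∀ a b, IntervalIntegrable (fun s => f (auxA f s)) volume a b := fun a b =>
    aux_ii f hf_nonneg M hM _ a b (hf_meas.comp hmono.measurable).aestronglyMeasurable
  refine ⟨auxA f, auxA_nonneg f, ?_, ?_⟩
  · intro t ht
    have hHt := auxH_A f M hM0 hM t
    have hfin : auxH f (auxA f t) ≠ ⊤ := (hHt.trans_lt ENNReal.ofReal_lt_top).ne
    have hHr : auxH f (auxA f t) = ENNReal.ofReal (auxH f (auxA f t)).toReal :=
      (ENNReal.ofReal_toReal hfin).symm
    set r := (auxH f (auxA f t)).toReal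
    have hr0 : 0 ≤ r := ENNReal.toReal_nonneg
    have hrt : r ≤ t := by rw [hHr] at hHt; exact (ENNReal.ofReal_le_ofReal_iff ht).1 hHt
    have hge : auxA f t ≤ auxA f r := (auxA_iff f M hM0 hM r _ (auxA_nonneg f t)).2 hHr.le
    have hAr : auxA f r = auxA f t := le_antisymm (hmono hrt) hge
    have h1 := auxA_int f hf_nonneg M hM0 hM hf_meas r hr0 (by rw [hAr, hHr])
    have h2 : ∫ s in r..t, f (auxA f s) = 0 := by
      rcases hrt.eq_or_lt with h | h
      · rw [h]; simp
      · have hz := auxA_stop f hf_nonneg M hM0 hM hf_reg t (by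
          rw [hHr]; exact (ENNReal.ofReal_lt_ofReal_iff_of_nonneg hr0).2 h)
        rw [intervalIntegral.integral_congr (g := fun _ => 0)]
        · simp
        · intro s hs
          rw [Set.uIcc_of_le hrt] at hs
          have : auxA f s = auxA f t := le_antisymm (hmono hs.2) (hge.trans (hmono hs.1))
          simp only [this, hz]
    rw [← intervalIntegral.integral_add_adjacent_intervals (hii 0 r) (hii r t), h2, ← h1, hAr,
      add_zero]
  · intro z hz0 hz t ht
    have hzm := aux_mono f hf_nonneg M hM hf_meas z hz
    set w : ℝ → ℝ := fun t => z (max t 0) with hwdef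
    have hw : Monotone w := fun a b hab =>
      hzm (le_max_right a 0) (le_max_right b 0) (max_le_max_right 0 hab)
    have hwz : ∀ s, 0 ≤ s → w s = z s := fun s hs => by simp [hwdef, max_eq_left hs]
    have hweq : ∀ t, 0 ≤ t → w t = ∫ s in (0:ℝ)..t, f (w s) := by
      intro t ht
      rw [hwz t ht, hz t ht]
      apply intervalIntegral.integral_congr
      intro s hs
      rw [Set.uIcc_of_le ht] at hs
      simp only [hwz s hs.1]
    by_contra hlt
    push Not at hlt
    rw [← hwz t ht] at hlt
    have hp : ∀ y, 0 ≤ y → y < auxA f t → 0 < f y := fun y hy h =>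
      auxA_pos f hf_nonneg M hM0 hM t y hy h
    have hT := aux_time f hf_nonneg M hM hf_meas w hw hweq t ht
      fun s hs hst => hp _ (hz0 _) ((hw hst.le).trans_lt hlt)
    have hHw : auxH f (w t) = ENNReal.ofReal t := by
      rw [← hT]
      apply setLIntegral_congr_fun measurableSet_Ico
      intro x hx
      exact auxG_eq f x fun y hy hyx => hp y hy (hyx.trans_lt (hx.2.trans hlt))
    have h3 := (auxH_lower f M hM (w t) _ (hz0 _) hlt.le).trans (auxH_A f M hM0 hM t)
    rw [hHw] at h3
    have h4 : (ENNReal.ofReal M)⁻¹ * ENNReal.ofReal (auxA f t - w t) ≤ 0 := by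
      apply (ENNReal.add_le_add_iff_left (a := ENNReal.ofReal t) ENNReal.ofReal_ne_top).1
      simpa using h3
    have h5 := nonpos_iff_eq_zero.1 h4
    rw [mul_eq_zero] at h5
    rcases h5 with h5 | h5
    · simp at h5
    · rw [ENNReal.ofReal_eq_zero] at h5; linarith
end

section
/- Let f : [0,∞) → [0,∞) be bounded, Borel measurable and right regular at zero. Then there exists a maximal solution of the initial value problem (IVP) (f, 0): a function α₂ : [0,∞) → [0,∞) such that α₂(t) = ∫₀ᵗ f(α₂(s)) ds for all t ≥ 0, and such that every function z : [0,∞) → [0,∞) with z(t) = ∫₀ᵗ f(z(s)) ds for all t ≥ 0 satisfies z(t) ≤ α₂(t) for all t ≥ 0. -/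
open MeasureTheory

open Set Filter Topology

noncomputable def gInv (f : ℝ → ℝ) (y : ℝ) : ENNReal := (ENNReal.ofReal (f y))⁻¹

noncomputable def muf (f : ℝ → ℝ) : Measure ℝ := volume.withDensity (gInv f)

noncomputable def hitT (f : ℝ → ℝ) (x : ℝ) : ENNReal := muf f (Ioo 0 x)

noncomputable def maxSol (f : ℝ → ℝ) (t : ℝ) : ℝ :=
  sSup {x | 0 ≤ x ∧ hitT f x ≤ ENNReal.ofReal t}

lemma gInv_meas {f : ℝ → ℝ} (hf : Measurable f) : Measurable (gInv f) :=
  hf.ennreal_ofReal.inv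

lemma hitT_mono (f : ℝ → ℝ) : Monotone (hitT f) := fun _ _ h =>
  measure_mono (Ioo_subset_Ioo_right h)

lemma hitT_eq (f : ℝ → ℝ) (x : ℝ) : hitT f x = ∫⁻ y in Ioo 0 x, gInv f y := by
  rw [hitT, muf, withDensity_apply _ measurableSet_Ioo]

lemma hitT_lower {f : ℝ → ℝ} {M : ℝ} (hM : 0 < M) (hb : ∀ t, f t ≤ M) {x t : ℝ}
    (ht : 0 ≤ t) (h : hitT f x ≤ ENNReal.ofReal t) : x ≤ M * t := by
  have h1 : ENNReal.ofReal (x / M) ≤ hitT f x := by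
    rw [hitT_eq]
    calc ENNReal.ofReal (x / M) = ∫⁻ y in Ioo 0 x, (ENNReal.ofReal M)⁻¹ := by
          rw [setLIntegral_const, Real.volume_Ioo, sub_zero, mul_comm,
            ENNReal.ofReal_div_of_pos hM, div_eq_mul_inv]
      _ ≤ _ := lintegral_mono fun y =>
          ENNReal.inv_le_inv.2 (ENNReal.ofReal_le_ofReal (hb y))
  have h2 := (ENNReal.ofReal_le_ofReal_iff ht).1 (h1.trans h)
  rw [div_le_iff₀ hM] at h2
  linarith

lemma le_maxSol_iff {f : ℝ → ℝ} {M : ℝ} (hM : 0 < M) (hb : ∀ t, f t ≤ M) {x t : ℝ}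
    (ht : 0 ≤ t) (hx : 0 ≤ x) : x ≤ maxSol f t ↔ hitT f x ≤ ENNReal.ofReal t := by
  have hne : ({x | 0 ≤ x ∧ hitT f x ≤ ENNReal.ofReal t} : Set ℝ).Nonempty :=
    ⟨0, le_rfl, by simp [hitT]⟩
  have hbd : BddAbove ({x | 0 ≤ x ∧ hitT f x ≤ ENNReal.ofReal t} : Set ℝ) :=
    ⟨M * t, fun y hy => hitT_lower hM hb ht hy.2⟩
  constructor
  · intro h
    refine (hitT_mono f h).trans ?_
    obtain ⟨u, hu, -, hlim, hmem⟩ := (isLUB_csSup hne hbd).exists_seq_monotone_tendsto hne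
    have hU : Ioo 0 (maxSol f t) ⊆ ⋃ n, Ioo 0 (u n) := by
      intro y hy
      obtain ⟨n, hn⟩ := (hlim.eventually (lt_mem_nhds hy.2)).exists
      exact mem_iUnion.2 ⟨n, hy.1, hn⟩
    have hm : Monotone fun n => Ioo 0 (u n) := fun a b hab => Ioo_subset_Ioo_right (hu hab)
    calc hitT f (maxSol f t) ≤ muf f (⋃ n, Ioo 0 (u n)) := measure_mono hU
      _ = ⨆ n, muf f (Ioo 0 (u n)) := hm.measure_iUnion
      _ ≤ _ := iSup_le fun n => (hmem n).2
  · intro h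
    exact le_csSup hbd ⟨hx, h⟩

lemma maxSol_nonneg (f : ℝ → ℝ) (t : ℝ) : 0 ≤ maxSol f t :=
  Real.sSup_nonneg fun _ h => h.1

lemma maxSol_mono {f : ℝ → ℝ} {M : ℝ} (hM : 0 < M) (hb : ∀ t, f t ≤ M) :
    Monotone (maxSol f) := by
  intro a b hab
  have e : maxSol f b = maxSol f (max b 0) := by
    unfold maxSol
    congr! 4
    rcases le_total b 0 with h | h <;> simp [h, ENNReal.ofReal_of_nonpos]
  rw [e]
  refine csSup_le ⟨0, le_rfl, by simp [hitT]⟩ fun x hx => ?_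
  rw [le_maxSol_iff hM hb (le_max_right _ _) hx.1]
  exact hx.2.trans (ENNReal.ofReal_le_ofReal (hab.trans (le_max_left _ _)))

lemma hitT_lt_top_aux {f : ℝ → ℝ} {M : ℝ} (hM : 0 < M) (hb : ∀ t, f t ≤ M)
    (hf_reg : ∀ t, 0 ≤ t → 0 < f t →
      ∃ ε > (0:ℝ), ∃ δ > (0:ℝ), ∀ s, t < s → s < t + δ → ε < f s) {t : ℝ} (ht : 0 ≤ t)
    (hlt : hitT f (maxSol f t) < ENNReal.ofReal t) : f (maxSol f t) ≤ 0 := by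
  by_contra! hpos
  set a := maxSol f t with ha
  have ha0 : 0 ≤ a := maxSol_nonneg f t
  obtain ⟨ε, hε, δ, hδ, H⟩ := hf_reg a ha0 hpos
  set d := t - (hitT f a).toReal with hd
  have hfin : hitT f a ≠ ⊤ := hlt.ne_top
  have hd0 : 0 < d := by
    have := (ENNReal.lt_ofReal_iff_toReal_lt hfin).1 hlt
    linarith
  set η := min (δ / 2) (ε * d) with hη
  have hη0 : 0 < η := by positivity
  have hηδ : η < δ := (min_le_left _ _).trans_lt (by linarith)
  have key : hitT f (a + η) ≤ ENNReal.ofReal t := by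
    have hsub : Ioo 0 (a + η) ⊆ Ioo 0 a ∪ Ico a (a + η) := by
      intro y hy
      rcases lt_or_ge y a with h | h
      · exact Or.inl ⟨hy.1, h⟩
      · exact Or.inr ⟨h, hy.2⟩
    have h2 : muf f (Ico a (a + η)) ≤ ENNReal.ofReal d := by
      rw [muf, withDensity_apply _ measurableSet_Ico,
        setLIntegral_congr (Ico_ae_eq_Ioc.trans Ioo_ae_eq_Ioc.symm : Ico a (a + η) =ᵐ[volume] Ioo a (a + η))]
      calc ∫⁻ y in Ioo a (a + η), gInv f y
          ≤ ∫⁻ y in Ioo a (a + η), (ENNReal.ofReal ε)⁻¹ := by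
            refine setLIntegral_mono measurable_const fun y hy => ?_
            exact ENNReal.inv_le_inv.2 (ENNReal.ofReal_le_ofReal
              (H y hy.1 (by linarith [hy.2])).le)
        _ = ENNReal.ofReal (η / ε) := by
          rw [setLIntegral_const, Real.volume_Ioo, mul_comm,
            ENNReal.ofReal_div_of_pos hε, div_eq_mul_inv]
          congr 2
          ring
        _ ≤ _ := by
          apply ENNReal.ofReal_le_ofReal
          rw [div_le_iff₀ hε, mul_comm]
          exact min_le_right _ _
    calc hitT f (a + η) ≤ muf f (Ioo 0 a) + muf f (Ico a (a + η)) :=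
          (measure_mono hsub).trans (measure_union_le _ _)
      _ ≤ ENNReal.ofReal (hitT f a).toReal + ENNReal.ofReal d := by
          rw [ENNReal.ofReal_toReal hfin]
          exact add_le_add le_rfl h2
      _ = ENNReal.ofReal t := by
          rw [← ENNReal.ofReal_add ENNReal.toReal_nonneg hd0.le]
          congr 1
          ring
  have := (le_maxSol_iff hM hb ht (by positivity)).2 key
  linarith

lemma map_maxSol {f : ℝ → ℝ} {M : ℝ} (hM : 0 < M) (hb : ∀ t, f t ≤ M) {t : ℝ} (ht : 0 ≤ t) :
    Measure.map (maxSol f) (volume.restrict (Icc 0 t)) =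
      (muf f).restrict (Ioo 0 (maxSol f t)) +
      (ENNReal.ofReal t - hitT f (maxSol f t)) • Measure.dirac (maxSol f t) := by
  have hmono := maxSol_mono hM hb
  set a := maxSol f t with ha
  have ha0 : 0 ≤ a := maxSol_nonneg f t
  have hTa : hitT f a ≤ ENNReal.ofReal t := (le_maxSol_iff hM hb ht ha0).1 le_rfl
  refine Measure.ext_of_Ici _ _ fun x => ?_
  rw [Measure.map_apply hmono.measurable measurableSet_Ici,
    Measure.restrict_apply (hmono.measurable measurableSet_Ici), Measure.add_apply,
    Measure.smul_apply, Measure.dirac_apply' _ measurableSet_Ici,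
    Measure.restrict_apply measurableSet_Ici, smul_eq_mul]
  rcases le_or_gt x 0 with hx | hx
  · have e1 : maxSol f ⁻¹' Ici x ∩ Icc 0 t = Icc 0 t :=
      inter_eq_right.2 fun s _ => hx.trans (maxSol_nonneg f s)
    have e2 : Ici x ∩ Ioo 0 a = Ioo 0 a :=
      inter_eq_right.2 fun s hs => hx.trans hs.1.le
    rw [e1, e2, indicator_of_mem (show a ∈ Ici x from hx.trans ha0)]
    simp only [Pi.one_apply, mul_one, Real.volume_Icc, sub_zero]
    exact (add_tsub_cancel_of_le hTa).symm
  rcases le_or_gt x a with hxa | hxa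
  · have hTx := hitT_mono f hxa
    have hfin : hitT f x ≠ ⊤ := ((hTx.trans hTa).trans_lt ENNReal.ofReal_lt_top).ne
    have e1 : maxSol f ⁻¹' Ici x ∩ Icc 0 t = Icc (hitT f x).toReal t := by
      ext s
      simp only [mem_inter_iff, mem_preimage, mem_Ici, mem_Icc]
      constructor
      · rintro ⟨h1, h2, h3⟩
        rw [le_maxSol_iff hM hb h2 hx.le] at h1
        exact ⟨ENNReal.toReal_le_of_le_ofReal h2 h1, h3⟩
      · rintro ⟨h1, h2⟩
        have h0 : 0 ≤ s := ENNReal.toReal_nonneg.trans h1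
        refine ⟨?_, h0, h2⟩
        rw [le_maxSol_iff hM hb h0 hx.le]
        exact (ENNReal.le_ofReal_iff_toReal_le hfin h0).2 h1
    have e3 := measure_inter_add_sdiff (μ := muf f) (Ioo 0 a) (measurableSet_Ici (a := x))
    have e4 : Ioo 0 a \ Ici x = Ioo 0 x := by
      ext s
      simp only [Set.mem_sdiff, mem_Ioo, mem_Ici, not_le]
      constructor
      · rintro ⟨⟨h1, h2⟩, h3⟩; exact ⟨h1, h3⟩
      · rintro ⟨h1, h2⟩; exact ⟨⟨h1, h2.trans_le hxa⟩, h2⟩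
    rw [e4, inter_comm] at e3
    change _ + hitT f x = hitT f a at e3
    rw [e1, indicator_of_mem (show a ∈ Ici x from hxa)]
    simp only [Pi.one_apply, mul_one, Real.volume_Icc]
    rw [ENNReal.ofReal_sub _ ENNReal.toReal_nonneg, ENNReal.ofReal_toReal hfin]
    refine ENNReal.sub_eq_of_eq_add hfin ?_
    · rw [add_right_comm, e3, add_tsub_cancel_of_le hTa]
  · have e1 : maxSol f ⁻¹' Ici x ∩ Icc 0 t = ∅ := by
      ext s
      simp only [mem_inter_iff, mem_preimage, mem_Ici, mem_Icc, mem_empty_iff_false, iff_false]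
      rintro ⟨h1, h2, h3⟩
      exact absurd (h1.trans (hmono h3)) (not_le.2 hxa)
    have e2 : Ici x ∩ Ioo 0 a = ∅ := by
      ext s
      simp only [mem_inter_iff, mem_Ici, mem_Ioo, mem_empty_iff_false, iff_false]
      rintro ⟨h1, h2, h3⟩
      linarith
    rw [e1, e2, indicator_of_notMem (show a ∉ Ici x from not_le.2 hxa)]
    simp

lemma maxSol_sol {f : ℝ → ℝ} {M : ℝ} (hM : 0 < M) (hb : ∀ t, f t ≤ M)
    (hf_nonneg : ∀ t, 0 ≤ f t) (hf : Measurable f)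
    (hf_reg : ∀ t, 0 ≤ t → 0 < f t →
      ∃ ε > (0:ℝ), ∃ δ > (0:ℝ), ∀ s, t < s → s < t + δ → ε < f s) {t : ℝ} (ht : 0 ≤ t) :
    maxSol f t = ∫ s in (0:ℝ)..t, f (maxSol f s) := by
  have hmono := maxSol_mono hM hb
  have hmeas := hmono.measurable
  have key : ∫⁻ s in Icc 0 t, ENNReal.ofReal (f (maxSol f s)) = ENNReal.ofReal (maxSol f t) := by
    rw [← lintegral_map (f := fun y => ENNReal.ofReal (f y)) hf.ennreal_ofReal hmeas,
      map_maxSol hM hb ht, lintegral_add_measure, lintegral_smul_measure, lintegral_dirac]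
    have hTa := (le_maxSol_iff hM hb ht (maxSol_nonneg f t)).1 le_rfl
    have h2 : (ENNReal.ofReal t - hitT f (maxSol f t)) • ENNReal.ofReal (f (maxSol f t)) = 0 := by
      rcases hTa.eq_or_lt with h | h
      · simp [h]
      · rw [ENNReal.ofReal_of_nonpos (hitT_lt_top_aux hM hb hf_reg ht h)]
        simp
    rw [h2, add_zero, muf, restrict_withDensity measurableSet_Ioo,
      lintegral_withDensity_eq_lintegral_mul _ (gInv_meas hf) hf.ennreal_ofReal]
    have hfin : ∫⁻ y in Ioo 0 (maxSol f t), gInv f y ≠ ⊤ := by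
      rw [← hitT_eq]
      exact (hTa.trans_lt ENNReal.ofReal_lt_top).ne
    have hae := ae_lt_top (gInv_meas hf) hfin
    have : ∀ᵐ y ∂volume.restrict (Ioo 0 (maxSol f t)),
        (gInv f * fun y => ENNReal.ofReal (f y)) y = 1 := by
      filter_upwards [hae] with y hy
      refine ENNReal.inv_mul_cancel ?_ ENNReal.ofReal_ne_top
      intro h0
      simp [gInv, h0] at hy
    rw [lintegral_congr_ae this]
    simp
  rw [intervalIntegral.integral_of_le ht, ← integral_Icc_eq_integral_Ioc,
    integral_eq_lintegral_of_nonneg_ae (Eventually.of_forall fun s => hf_nonneg _)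
      (hf.comp hmeas).aestronglyMeasurable, key, ENNReal.toReal_ofReal (maxSol_nonneg f t)]

lemma sol_integrable {f : ℝ → ℝ} {M : ℝ} (hb : ∀ t, f t ≤ M)
    (hf_nonneg : ∀ t, 0 ≤ f t) (hf : Measurable f) {z : ℝ → ℝ}
    (hz : ∀ t, 0 ≤ t → z t = ∫ s in (0:ℝ)..t, f (z s)) {t : ℝ} (ht : 0 ≤ t) :
    IntervalIntegrable (fun s => f (z s)) volume 0 t := by
  set J : Set ℝ := {t | 0 ≤ t ∧ IntervalIntegrable (fun s => f (z s)) volume 0 t} with hJ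
  have hJo : J.OrdConnected := by
    refine ⟨fun a ha b hb' c hc => ⟨ha.1.trans hc.1, hb'.2.mono_set ?_⟩⟩
    rw [uIcc_of_le (ha.1.trans hc.1), uIcc_of_le hb'.1]
    exact Icc_subset_Icc_right hc.2
  have hJm : MeasurableSet J := hJo.measurableSet
  have hmonoJ : MonotoneOn z J := by
    intro a ha b hb' hab
    rw [hz a ha.1, hz b hb'.1]
    exact intervalIntegral.integral_mono_interval le_rfl ha.1 hab
      (Eventually.of_forall fun s => hf_nonneg _) hb'.2
  have h1 : AEMeasurable z (volume.restrict J) := aemeasurable_restrict_of_monotoneOn hJm hmonoJ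
  have h2 : AEMeasurable z (volume.restrict (Ici 0 \ J)) := by
    refine (aemeasurable_const (b := (0:ℝ))).congr ?_
    refine (ae_restrict_iff' (measurableSet_Ici.diff hJm)).2 (Eventually.of_forall fun s hs => ?_)
    rw [hz s hs.1]
    exact (intervalIntegral.integral_undef fun h => hs.2 ⟨hs.1, h⟩).symm
  have h3 : AEMeasurable z (volume.restrict (Ioc 0 t)) := by
    refine (aemeasurable_union_iff.2 ⟨h1, h2⟩).mono_set ?_
    intro s hs
    by_cases h : s ∈ J
    · exact Or.inl h
    · exact Or.inr ⟨hs.1.le, h⟩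
  rw [intervalIntegrable_iff_integrableOn_Ioc_of_le ht]
  refine Integrable.of_bound (hf.comp_aemeasurable h3).aestronglyMeasurable M ?_
  refine Eventually.of_forall fun s => ?_
  rw [Real.norm_of_nonneg (hf_nonneg _)]
  exact hb _

lemma sol_le {f : ℝ → ℝ} {M : ℝ} (hM : 0 < M) (hb : ∀ t, f t ≤ M)
    (hf_nonneg : ∀ t, 0 ≤ f t) (hf : Measurable f) {z : ℝ → ℝ} (hz0 : ∀ t, 0 ≤ z t)
    (hz : ∀ t, 0 ≤ t → z t = ∫ s in (0:ℝ)..t, f (z s)) {t : ℝ} (ht : 0 ≤ t) :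
    z t ≤ maxSol f t := by
  have hint := fun {t : ℝ} (ht : 0 ≤ t) => sol_integrable hb hf_nonneg hf hz ht
  rw [le_maxSol_iff hM hb ht (hz0 t)]
  have hdiff : ∀ a b, 0 ≤ a → a ≤ b → z b - z a = ∫ s in a..b, f (z s) := by
    intro a b ha hab
    rw [hz a ha, hz b (ha.trans hab)]
    exact intervalIntegral.integral_interval_sub_left (hint (ha.trans hab)) (hint ha)
  have hmono : ∀ a b, 0 ≤ a → a ≤ b → z a ≤ z b := by
    intro a b ha hab
    have := hdiff a b ha hab
    have h2 : 0 ≤ ∫ s in a..b, f (z s) :=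
      intervalIntegral.integral_nonneg hab fun s _ => hf_nonneg _
    linarith
  have hlip : ∀ a b, 0 ≤ a → a ≤ b → z b - z a ≤ M * (b - a) := by
    intro a b ha hab
    rw [hdiff a b ha hab]
    have h := intervalIntegral.norm_integral_le_of_norm_le_const (a := a) (b := b) (C := M)
      (f := fun s => f (z s)) fun s _ => by
        rw [Real.norm_of_nonneg (hf_nonneg _)]; exact hb _
    rw [abs_of_nonneg (by linarith)] at h
    exact (le_abs_self _).trans h
  set w : ℝ → ℝ := fun s => z (max s 0) with hw
  have hwm : Monotone w := fun a b hab => hmono _ _ (le_max_right _ _) (max_le_max_right 0 hab)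
  have hwmeas := hwm.measurable
  have hzc : ContinuousOn z (Icc 0 t) := by
    have : LipschitzOnWith M.toNNReal z (Icc 0 t) := by
      refine LipschitzOnWith.of_le_add_mul _ fun a ha b hb' => ?_
      rw [Real.coe_toNNReal _ hM.le, Real.dist_eq]
      rcases le_total a b with h | h
      · have := hmono a b ha.1 h
        have : 0 ≤ M * |a - b| := by positivity
        linarith
      · have := hlip b a hb'.1 h
        rw [abs_of_nonneg (by linarith)]
        linarith
    exact this.continuousOn
  have hz00 : z 0 = 0 := by rw [hz 0 le_rfl]; simp
  set φ : ℝ → ENNReal := fun s => ENNReal.ofReal (f (w s)) with hφ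
  have hφm : Measurable φ := (hf.comp hwmeas).ennreal_ofReal
  have hφint : ∀ a b, 0 ≤ a → a ≤ b → ∫⁻ s in Icc a b, φ s = ENNReal.ofReal (z b - z a) := by
    intro a b ha hab
    rw [hdiff a b ha hab, intervalIntegral.integral_of_le hab, ← integral_Icc_eq_integral_Ioc]
    have e : ∫ s in Icc a b, f (z s) = ∫ s in Icc a b, f (w s) := by
      refine setIntegral_congr_fun measurableSet_Icc fun s hs => ?_
      simp [hw, max_eq_left (ha.trans hs.1)]
    rw [e, ofReal_integral_eq_lintegral_ofReal]
    · refine Measure.integrableOn_of_bounded (M := M) (by simp)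
        (hf.comp hwmeas).aestronglyMeasurable (Eventually.of_forall fun s => ?_)
      rw [Real.norm_of_nonneg (hf_nonneg _)]
      exact hb _
    · exact Eventually.of_forall fun s => hf_nonneg _
  have hmap : Measure.map w ((volume.restrict (Icc 0 t)).withDensity φ) =
      volume.restrict (Icc 0 (z t)) := by
    have hfinm : IsFiniteMeasure ((volume.restrict (Icc 0 t)).withDensity φ) := by
      refine isFiniteMeasure_withDensity ?_
      rw [hφint 0 t le_rfl ht]
      exact ENNReal.ofReal_ne_top
    refine Measure.ext_of_Ici _ _ fun x => ?_
    rw [Measure.map_apply hwmeas measurableSet_Ici,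
      withDensity_apply _ (hwmeas measurableSet_Ici),
      Measure.restrict_restrict (hwmeas measurableSet_Ici),
      Measure.restrict_apply measurableSet_Ici]
    rcases le_or_gt x 0 with hx | hx
    · have e1 : w ⁻¹' Ici x ∩ Icc 0 t = Icc 0 t :=
        inter_eq_right.2 fun s _ => hx.trans (hz0 _)
      have e2 : Ici x ∩ Icc 0 (z t) = Icc 0 (z t) :=
        inter_eq_right.2 fun s hs => hx.trans hs.1
      rw [e1, e2, hφint 0 t le_rfl ht, hz00, Real.volume_Icc]
    rcases le_or_gt x (z t) with hxa | hxa
    · -- first hitting time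
      have hcl : IsCompact (Icc 0 t ∩ z ⁻¹' Ici x) :=
        isCompact_Icc.of_isClosed_subset
          (hzc.preimage_isClosed_of_isClosed isClosed_Icc isClosed_Ici) inter_subset_left
      obtain ⟨τ, hτ, hmin⟩ := hcl.exists_isLeast ⟨t, ⟨ht, le_rfl⟩, hxa⟩
      have hτx : z τ = x := by
        obtain ⟨σ, hσ, hσx⟩ := intermediate_value_Icc ht hzc (show x ∈ Icc (z 0) (z t) from
          ⟨by rw [hz00]; exact hx.le, hxa⟩)
        have h1 : τ ≤ σ := hmin ⟨hσ, hσx.ge⟩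
        have h2 := hmono τ σ hτ.1.1 h1
        exact le_antisymm (h2.trans hσx.le) hτ.2
      have e1 : w ⁻¹' Ici x ∩ Icc 0 t = Icc τ t := by
        ext s
        simp only [mem_inter_iff, mem_preimage, mem_Ici, mem_Icc, hw]
        constructor
        · rintro ⟨h1, h2, h3⟩
          rw [max_eq_left h2] at h1
          exact ⟨hmin ⟨⟨h2, h3⟩, h1⟩, h3⟩
        · rintro ⟨h1, h2⟩
          have h0 := hτ.1.1.trans h1
          rw [max_eq_left h0]
          exact ⟨hτx.ge.trans (hmono _ _ hτ.1.1 h1), h0, h2⟩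
      have e2 : Ici x ∩ Icc 0 (z t) = Icc x (z t) := by
        ext s
        simp only [mem_inter_iff, mem_Ici, mem_Icc]
        constructor
        · rintro ⟨h1, h2, h3⟩; exact ⟨h1, h3⟩
        · rintro ⟨h1, h2⟩; exact ⟨h1, hx.le.trans h1, h2⟩
      rw [e1, e2, hφint τ t hτ.1.1 hτ.1.2, hτx, Real.volume_Icc]
    · have e1 : w ⁻¹' Ici x ∩ Icc 0 t = ∅ := by
        ext s
        simp only [mem_inter_iff, mem_preimage, mem_Ici, mem_Icc, mem_empty_iff_false, iff_false, hw]
        rintro ⟨h1, h2, h3⟩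
        rw [max_eq_left h2] at h1
        exact absurd (h1.trans (hmono _ _ h2 h3)) (not_le.2 hxa)
      have e2 : Ici x ∩ Icc 0 (z t) = ∅ := by
        ext s
        simp only [mem_inter_iff, mem_Ici, mem_Icc, mem_empty_iff_false, iff_false]
        rintro ⟨h1, h2, h3⟩
        linarith
      rw [e1, e2]
      simp
  calc hitT f (z t) = ∫⁻ y in Ioo 0 (z t), gInv f y := hitT_eq _ _
    _ ≤ ∫⁻ y in Icc 0 (z t), gInv f y := lintegral_mono_set Ioo_subset_Icc_self
    _ = ∫⁻ s in Icc 0 t, (φ * fun s => gInv f (w s)) s := by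
      rw [← hmap, lintegral_map (gInv_meas hf) hwmeas,
        lintegral_withDensity_eq_lintegral_mul _ hφm
          (show Measurable fun s => gInv f (w s) from (gInv_meas hf).comp hwmeas)]
    _ ≤ ∫⁻ s in Icc 0 t, 1 := lintegral_mono fun s => ENNReal.mul_inv_le_one _
    _ = ENNReal.ofReal t := by simp

/-- existence of a maximal solution of the IVP (f, 0) for a bounded,
Borel measurable function `f : [0,∞) → [0,∞)` that is right regular at zero. -/
theorem stmt_1 (f : ℝ → ℝ) (hf_nonneg : ∀ t, 0 ≤ f t)
    (hf_bdd : ∃ M : ℝ, ∀ t, f t ≤ M) (hf_meas : Measurable f)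
    (hf_reg : ∀ t, 0 ≤ t → 0 < f t →
      ∃ ε > (0:ℝ), ∃ δ > (0:ℝ), ∀ s, t < s → s < t + δ → ε < f s) :
    ∃ α₂ : ℝ → ℝ, (∀ t, 0 ≤ α₂ t) ∧
      (∀ t, 0 ≤ t → α₂ t = ∫ s in (0:ℝ)..t, f (α₂ s)) ∧
      (∀ z : ℝ → ℝ, (∀ t, 0 ≤ z t) →
        (∀ t, 0 ≤ t → z t = ∫ s in (0:ℝ)..t, f (z s)) →
        ∀ t, 0 ≤ t → z t ≤ α₂ t) := by
  obtain ⟨M, hM⟩ := hf_bdd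
  have hb : ∀ t, f t ≤ max M 1 := fun t => (hM t).trans (le_max_left _ _)
  have hM0 : 0 < max M 1 := lt_max_of_lt_right one_pos
  exact ⟨maxSol f, maxSol_nonneg f,
    fun t ht => maxSol_sol hM0 hb hf_nonneg hf_meas hf_reg ht,
    fun z hz0 hz t ht => sol_le hM0 hb hf_nonneg hf_meas hz0 hz ht⟩
end

section
/- Let f : [0,∞) → [0,∞) be bounded, Borel measurable and right regular at zero, and set τ := inf{t ≥ 0 : f(t) = 0} and η := inf{t ≥ 0 : ∫₀ᵗ 1/f(s) ds = ∞} (both with values in [0,∞], inf ∅ = ∞). Then η ≤ τ holds if and only if the IVP (f, 0) has exactly one solution, i.e. any two functions y₁, y₂ : [0,∞) → [0,∞) with yᵢ(t) = ∫₀ᵗ f(yᵢ(s)) ds for all t ≥ 0 (i = 1,2) are equal. -/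
open MeasureTheory ENNReal

noncomputable def muF (f : ℝ → ℝ) : Measure ℝ :=
  (volume : Measure ℝ).withDensity (fun s => (ENNReal.ofReal (f s))⁻¹)

lemma muF_Ioc (f : ℝ → ℝ) (a b : ℝ) :
    muF f (Set.Ioc a b) = ∫⁻ s in Set.Ioc a b, (ENNReal.ofReal (f s))⁻¹ :=
  withDensity_apply _ measurableSet_Ioc

instance muF_nsc (f : ℝ → ℝ) : NullSingletonClass (muF f) :=
  ⟨fun x => withDensity_absolutelyContinuous _ _ (by simp)⟩

lemma muF_lower (f : ℝ → ℝ) (M : ℝ) (hM : 0 < M) (hb : ∀ t, f t ≤ M) (p q : ℝ) :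
    ENNReal.ofReal ((q - p) / M) ≤ muF f (Set.Ioc p q) := by
  rw [muF_Ioc]
  calc ENNReal.ofReal ((q - p) / M) = ∫⁻ s in Set.Ioc p q, (ENNReal.ofReal M)⁻¹ := by
        rw [setLIntegral_const, Real.volume_Ioc, ENNReal.ofReal_div_of_pos hM, div_eq_mul_inv,
          mul_comm]
    _ ≤ _ := by
        apply lintegral_mono
        intro s
        exact ENNReal.inv_le_inv.2 (ENNReal.ofReal_le_ofReal (hb s))

lemma muF_add (f : ℝ → ℝ) {a b c : ℝ} (h1 : a ≤ b) (h2 : b ≤ c) :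
    muF f (Set.Ioc a c) = muF f (Set.Ioc a b) + muF f (Set.Ioc b c) := by
  rw [← Set.Ioc_union_Ioc_eq_Ioc h1 h2, measure_union _ measurableSet_Ioc]
  exact Set.Ioc_disjoint_Ioc_of_le le_rfl

lemma muF_mono (f : ℝ → ℝ) {a b c : ℝ} (h : b ≤ c) :
    muF f (Set.Ioc a b) ≤ muF f (Set.Ioc a c) :=
  measure_mono (Set.Ioc_subset_Ioc_right h)

lemma muF_strict (f : ℝ → ℝ) (M : ℝ) (hM : 0 < M) (hb : ∀ t, f t ≤ M) {p q : ℝ}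
    (hp : 0 ≤ p) (hpq : p < q) (hfin : muF f (Set.Ioc 0 p) ≠ ∞) :
    muF f (Set.Ioc 0 p) < muF f (Set.Ioc 0 q) := by
  rw [muF_add f hp hpq.le]
  apply ENNReal.lt_add_right hfin
  have h := muF_lower f M hM hb p q
  have : 0 < ENNReal.ofReal ((q - p) / M) := by
    rw [ENNReal.ofReal_pos]; exact div_pos (by linarith) hM
  exact (this.trans_le h).ne'

lemma muF_left (f : ℝ → ℝ) (b : ℝ) (K : ℝ≥0∞)
    (h : ∀ u < b, muF f (Set.Ioc 0 u) ≤ K) : muF f (Set.Ioc 0 b) ≤ K := by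
  obtain ⟨u, hu, hlt, hlim⟩ := exists_seq_strictMono_tendsto b
  rw [← measure_congr (Ioo_ae_eq_Ioc (μ := muF f) (a := (0:ℝ)) (b := b))]
  have : Set.Ioo 0 b ⊆ ⋃ n, Set.Ioc 0 (u n) := by
    intro x hx
    obtain ⟨n, hn⟩ := (hlim.eventually (lt_mem_nhds hx.2)).exists
    exact Set.mem_iUnion.2 ⟨n, hx.1, hn.le⟩
  refine (measure_mono this).trans ?_
  rw [Monotone.measure_iUnion]
  · exact iSup_le fun n => h _ (hlt n)
  · intro m n hmn
    exact Set.Ioc_subset_Ioc_right (hu.monotone hmn)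

lemma muF_right (f : ℝ → ℝ) {p q : ℝ} (hp : 0 ≤ p) (hpq : p < q)
    (hfin : muF f (Set.Ioc 0 q) ≠ ∞) (K : ℝ≥0∞)
    (hK : muF f (Set.Ioc 0 p) < K) : ∃ u, p < u ∧ u < q ∧ muF f (Set.Ioc 0 u) < K := by
  have hpf : muF f (Set.Ioc 0 p) ≠ ∞ := hK.ne_top
  have h1 : ∫⁻ s in Set.Ioc 0 q, (ENNReal.ofReal (f s))⁻¹ ≠ ∞ := by rwa [← muF_Ioc]
  obtain ⟨δ, hδ, H⟩ := exists_pos_setLIntegral_lt_of_measure_lt h1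
    (ε := K - muF f (Set.Ioc 0 p)) (tsub_pos_of_lt hK).ne'
  obtain ⟨r, hr0, hr⟩ : ∃ r : ℝ, 0 < r ∧ ENNReal.ofReal r < δ := by
    obtain ⟨r, hr0, hr⟩ := ENNReal.lt_iff_exists_nnreal_btwn.1 hδ
    exact ⟨r, by exact_mod_cast hr0, by simpa using hr⟩
  refine ⟨p + min r ((q-p)/2), by have := lt_min hr0 (by linarith : 0 < (q-p)/2); linarith,
    by have := min_le_right r ((q-p)/2); linarith, ?_⟩
  set u := p + min r ((q-p)/2) with hu
  have hpu : p < u := by have := lt_min hr0 (by linarith : 0 < (q-p)/2); linarith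
  have huq : u < q := by have := min_le_right r ((q-p)/2); linarith
  have hur : u - p ≤ r := by have := min_le_left r ((q-p)/2); linarith
  have := H (Set.Ioc p u) (by
    refine lt_of_le_of_lt (Measure.restrict_apply_le _ _) ?_
    rw [Real.volume_Ioc]
    exact (ENNReal.ofReal_le_ofReal hur).trans_lt hr)
  rw [Measure.restrict_restrict measurableSet_Ioc,
    Set.inter_eq_self_of_subset_left (Set.Ioc_subset_Ioc hp huq.le), ← muF_Ioc] at this
  rw [muF_add f hp hpu.le]
  calc _ < muF f (Set.Ioc 0 p) + (K - muF f (Set.Ioc 0 p)) := ENNReal.add_lt_add_left hpf this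
    _ = K := add_tsub_cancel_of_le hK.le

def setS (f : ℝ → ℝ) (c : ℝ≥0∞) (t : ℝ) : Set ℝ :=
  {u | 0 ≤ u ∧ ENNReal.ofReal u ≤ c ∧ muF f (Set.Ioc 0 u) ≤ ENNReal.ofReal t}

noncomputable def solY (f : ℝ → ℝ) (c : ℝ≥0∞) (t : ℝ) : ℝ := sSup (setS f c t)

section
variable {f : ℝ → ℝ} {M : ℝ} (hM : 0 < M) (hb : ∀ t, f t ≤ M) (c : ℝ≥0∞)

lemma setS_zero (t : ℝ) : (0:ℝ) ∈ setS f c t := by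
  simp [setS]

lemma setS_bdd (hM : 0 < M) (hb : ∀ t, f t ≤ M) (t : ℝ) : BddAbove (setS f c t) := by
  refine ⟨M * max t 0, ?_⟩
  rintro u ⟨h0, -, h⟩
  have h1 := (muF_lower f M hM hb 0 u).trans h
  rw [sub_zero] at h1
  have h2 : ENNReal.ofReal (u / M) ≤ ENNReal.ofReal (max t 0) :=
    h1.trans (ENNReal.ofReal_le_ofReal (le_max_left _ _))
  rw [ENNReal.ofReal_le_ofReal_iff (le_max_right _ _), div_le_iff₀ hM] at h2
  linarith

lemma solY_mem (hM : 0 < M) (hb : ∀ t, f t ≤ M) (t : ℝ) : solY f c t ∈ setS f c t := by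
  have hne : (setS f c t).Nonempty := ⟨0, setS_zero c t⟩
  refine ⟨le_csSup (setS_bdd c hM hb t) (setS_zero c t), ?_, ?_⟩
  · have hcl : IsClosed {u : ℝ | ENNReal.ofReal u ≤ c} :=
      isClosed_le ENNReal.continuous_ofReal continuous_const
    have h1 := csSup_mem_closure hne (setS_bdd c hM hb t)
    exact (closure_minimal (fun u hu => hu.2.1) hcl) h1
  · apply muF_left
    intro u hu
    obtain ⟨v, hv, huv⟩ := exists_lt_of_lt_csSup hne hu
    exact (muF_mono f huv.le).trans hv.2.2

lemma le_solY (hM : 0 < M) (hb : ∀ t, f t ≤ M) {t u : ℝ} (hu : 0 ≤ u)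
    (huc : ENNReal.ofReal u ≤ c) :
    u ≤ solY f c t ↔ muF f (Set.Ioc 0 u) ≤ ENNReal.ofReal t := by
  constructor
  · intro h
    exact (muF_mono f h).trans (solY_mem c hM hb t).2.2
  · intro h
    exact le_csSup (setS_bdd c hM hb t) ⟨hu, huc, h⟩

lemma solY_monotone (hM : 0 < M) (hb : ∀ t, f t ≤ M) : Monotone (solY f c) := by
  intro s t hst
  refine csSup_le_csSup (setS_bdd c hM hb t) ⟨0, setS_zero c s⟩ ?_
  rintro u ⟨h0, h1, h2⟩
  exact ⟨h0, h1, h2.trans (ENNReal.ofReal_le_ofReal hst)⟩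

lemma solY_map (hM : 0 < M) (hb : ∀ t, f t ≤ M) {T : ℝ} (hT : 0 ≤ T) {B : ℝ} (hB : 0 ≤ B)
    (hBG : muF f (Set.Ioc 0 (solY f c T)) = ENNReal.ofReal B) (hBT : B ≤ T) :
    Measure.map (solY f c) (volume.restrict (Set.Ioc 0 B)) =
      (muF f).restrict (Set.Ioc 0 (solY f c T)) := by
  have hmono := solY_monotone (f := f) c hM hb
  obtain ⟨hb0, hbc, -⟩ := solY_mem (f := f) c hM hb T
  set b := solY f c T with hbdef
  have hfin2 : IsFiniteMeasure ((muF f).restrict (Set.Ioc 0 b)) :=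
    ⟨by simp [hBG]⟩
  apply Measure.ext_of_Ici
  intro u
  rw [Measure.map_apply hmono.measurable measurableSet_Ici,
    Measure.restrict_apply (hmono.measurable measurableSet_Ici),
    Measure.restrict_apply measurableSet_Ici]
  rcases le_or_gt u 0 with hu | hu
  · rw [Set.inter_eq_self_of_subset_right, Set.inter_eq_self_of_subset_right, hBG]
    · simp
    · intro x hx; exact hu.trans hx.1.le
    · intro x hx; exact hu.trans (solY_mem c hM hb x).1
  rcases le_or_gt u b with hub | hub
  · have huc : ENNReal.ofReal u ≤ c := (ENNReal.ofReal_le_ofReal hub).trans hbc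
    have hGle : muF f (Set.Ioc 0 u) ≤ ENNReal.ofReal B := hBG ▸ muF_mono f hub
    have hGfin : muF f (Set.Ioc 0 u) ≠ ∞ := (hGle.trans_lt ENNReal.ofReal_lt_top).ne
    have hGpos : 0 < muF f (Set.Ioc 0 u) := by
      refine lt_of_lt_of_le ?_ (muF_lower f M hM hb 0 u)
      rw [ENNReal.ofReal_pos, sub_zero]; positivity
    obtain ⟨A, hA0, hA⟩ : ∃ A : ℝ, 0 < A ∧ muF f (Set.Ioc 0 u) = ENNReal.ofReal A :=
      ⟨_, ENNReal.toReal_pos hGpos.ne' hGfin, (ENNReal.ofReal_toReal hGfin).symm⟩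
    have e1 : solY f c ⁻¹' Set.Ici u ∩ Set.Ioc 0 B = Set.Icc A B := by
      ext s
      simp only [Set.mem_inter_iff, Set.mem_preimage, Set.mem_Ici, Set.mem_Ioc, Set.mem_Icc]
      constructor
      · rintro ⟨h1, h2, h3⟩
        rw [le_solY c hM hb hu.le huc, hA, ENNReal.ofReal_le_ofReal_iff h2.le] at h1
        exact ⟨h1, h3⟩
      · rintro ⟨h1, h2⟩
        have h3 := hA0.trans_le h1
        refine ⟨?_, h3, h2⟩
        rw [le_solY c hM hb hu.le huc, hA, ENNReal.ofReal_le_ofReal_iff h3.le]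
        exact h1
    have e2 : Set.Ici u ∩ Set.Ioc 0 b = Set.Icc u b := by
      ext s
      simp only [Set.mem_inter_iff, Set.mem_Ici, Set.mem_Ioc, Set.mem_Icc]
      constructor
      · rintro ⟨h1, h2, h3⟩; exact ⟨h1, h3⟩
      · rintro ⟨h1, h2⟩; exact ⟨h1, hu.trans_le h1, h2⟩
    rw [e1, e2, Real.volume_Icc, ← measure_congr (Ioc_ae_eq_Icc (μ := muF f))]
    have h3 := muF_add f hu.le hub
    rw [hBG, hA] at h3
    rw [ENNReal.ofReal_sub _ hA0.le, h3, ENNReal.add_sub_cancel_left ENNReal.ofReal_ne_top]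
  · have e1 : solY f c ⁻¹' Set.Ici u ∩ Set.Ioc 0 B = ∅ := by
      ext s
      simp only [Set.mem_inter_iff, Set.mem_preimage, Set.mem_Ici, Set.mem_Ioc,
        Set.mem_empty_iff_false, iff_false]
      rintro ⟨h1, h2, h3⟩
      have := hmono (h3.trans hBT)
      linarith
    have e2 : Set.Ici u ∩ Set.Ioc 0 b = ∅ := by
      ext s
      simp only [Set.mem_inter_iff, Set.mem_Ici, Set.mem_Ioc,
        Set.mem_empty_iff_false, iff_false]
      rintro ⟨h1, h2, h3⟩
      linarith
    rw [e1, e2]; simp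

lemma solY_sol (hM : 0 < M) (hb : ∀ t, f t ≤ M) (hf0 : ∀ t, 0 ≤ f t) (hfm : Measurable f)
    (hfin : ∀ u, 0 ≤ u → ENNReal.ofReal u < c → muF f (Set.Ioc 0 u) ≠ ∞)
    (hend : ∀ u, 0 ≤ u → ENNReal.ofReal u = c → muF f (Set.Ioc 0 u) ≠ ∞ → f u = 0)
    (T : ℝ) (hT : 0 ≤ T) : solY f c T = ∫ s in (0:ℝ)..T, f (solY f c s) := by
  have hmono := solY_monotone (f := f) c hM hb
  obtain ⟨hb0, hbc, hbG⟩ := solY_mem (f := f) c hM hb T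
  have hGfin : muF f (Set.Ioc 0 (solY f c T)) ≠ ∞ := (hbG.trans_lt ENNReal.ofReal_lt_top).ne
  obtain ⟨B, hB0, hB⟩ : ∃ B : ℝ, 0 ≤ B ∧ muF f (Set.Ioc 0 (solY f c T)) = ENNReal.ofReal B :=
      ⟨_, ENNReal.toReal_nonneg, (ENNReal.ofReal_toReal hGfin).symm⟩
  have hBT : B ≤ T := by rwa [hB, ENNReal.ofReal_le_ofReal_iff hT] at hbG
  have hmap := solY_map c hM hb hT hB0 hB hBT
  have hmeas : Measurable fun s => f (solY f c s) := hfm.comp hmono.measurable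
  rw [intervalIntegral.integral_of_le hT, integral_eq_lintegral_of_nonneg_ae
    (Filter.Eventually.of_forall fun s => hf0 _) hmeas.aestronglyMeasurable]
  suffices h : ∫⁻ s in Set.Ioc 0 T, ENNReal.ofReal (f (solY f c s)) =
      ENNReal.ofReal (solY f c T) by
    rw [h, ENNReal.toReal_ofReal hb0]
  rw [← Set.Ioc_union_Ioc_eq_Ioc hB0 hBT, lintegral_union measurableSet_Ioc
    (Set.Ioc_disjoint_Ioc_of_le le_rfl)]
  have h2 : ∫⁻ s in Set.Ioc B T, ENNReal.ofReal (f (solY f c s)) = 0 := by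
    rcases hBT.eq_or_lt with h | h
    · simp [h]
    have hf : f (solY f c T) = 0 := by
      rcases hbc.eq_or_lt with h1 | h1
      · exact hend _ hb0 h1 hGfin
      exfalso
      obtain ⟨q, hq1, hq2⟩ : ∃ q : ℝ, solY f c T < q ∧ ENNReal.ofReal q < c := by
        obtain ⟨r, hr0, hr⟩ := ENNReal.lt_iff_exists_nnreal_btwn.1 h1
        refine ⟨r, ?_, by simpa using hr⟩
        rw [← ENNReal.ofReal_coe_nnreal] at hr0
        exact (ENNReal.ofReal_lt_ofReal_iff_of_nonneg hb0).1 hr0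
      obtain ⟨u, hu1, hu2, hu3⟩ := muF_right f hb0 hq1 (hfin q (hb0.trans hq1.le) hq2)
        (ENNReal.ofReal T) (by
          rw [hB]; exact (ENNReal.ofReal_lt_ofReal_iff_of_nonneg hB0).2 h)
      have := (le_solY c hM hb (t := T) (hb0.trans hu1.le)
        ((ENNReal.ofReal_le_ofReal hu2.le).trans hq2.le)).2 hu3.le
      linarith
    rw [setLIntegral_congr_fun (g := fun _ => 0) measurableSet_Ioc]
    · simp
    · intro s hs
      have h3 : solY f c s = solY f c T := by
        apply le_antisymm (hmono hs.2)
        rw [le_solY c hM hb hb0 hbc, hB]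
        exact ENNReal.ofReal_le_ofReal hs.1.le
      simp [h3, hf]
  rw [h2, add_zero]
  have h4 : ∫⁻ s in Set.Ioc 0 B, ENNReal.ofReal (f (solY f c s)) =
      ∫⁻ u, ENNReal.ofReal (f u) ∂(Measure.map (solY f c) (volume.restrict (Set.Ioc 0 B))) :=
    (lintegral_map hfm.ennreal_ofReal hmono.measurable).symm
  have hgm : Measurable fun s => (ENNReal.ofReal (f s))⁻¹ := hfm.ennreal_ofReal.inv
  rw [h4, hmap, muF, setLIntegral_withDensity_eq_setLIntegral_mul _ hgm hfm.ennreal_ofReal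
    measurableSet_Ioc]
  rw [muF_Ioc] at hGfin
  have hae := ae_lt_top hgm hGfin
  calc _ = ∫⁻ u in Set.Ioc 0 (solY f c T), 1 := by
        apply lintegral_congr_ae
        filter_upwards [hae] with u hu
        rw [Pi.mul_apply]
        apply ENNReal.inv_mul_cancel _ ENNReal.ofReal_ne_top
        intro h
        simp [h] at hu
    _ = _ := by simp
end

/-- measurability part -/
lemma sol_measurable {f : ℝ → ℝ} (hf0 : ∀ t, 0 ≤ f t) {y : ℝ → ℝ}
    (hy : ∀ t, 0 ≤ t → y t = ∫ s in (0:ℝ)..t, f (y s)) :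
    AEMeasurable y (volume.restrict (Set.Ici 0)) := by
  let I : Set ℝ := {t | 0 ≤ t ∧ IntervalIntegrable (fun s => f (y s)) volume 0 t}
  have hsub : ∀ s t, 0 ≤ s → s ≤ t → t ∈ I → s ∈ I := by
    rintro s t hs hst ⟨ht, h⟩
    refine ⟨hs, h.mono_set ?_⟩
    rw [Set.uIcc_of_le hs, Set.uIcc_of_le ht]
    exact Set.Icc_subset_Icc_right hst
  have hoc : I.OrdConnected := ⟨fun s hs t ht x hx => hsub x t (hs.1.trans hx.1) hx.2 ht⟩
  have hIm : MeasurableSet I := hoc.measurableSet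
  have hmono : MonotoneOn y I := by
    intro s hs t ht hst
    rw [hy s hs.1, hy t ht.1]
    apply intervalIntegral.integral_mono_interval le_rfl hs.1 hst _ ht.2
    exact Filter.Eventually.of_forall fun x => hf0 _
  have hz : ∀ t ∈ Set.Ici (0:ℝ) \ I, y t = 0 := by
    rintro t ⟨ht, hn⟩
    rw [hy t ht]
    apply intervalIntegral.integral_undef
    intro h
    exact hn ⟨ht, h⟩
  have h1 : AEMeasurable y (volume.restrict I) := aemeasurable_restrict_of_monotoneOn hIm hmono
  have h2 : AEMeasurable y (volume.restrict (Set.Ici (0:ℝ) \ I)) := by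
    refine (aemeasurable_const (b := (0:ℝ))).congr ?_
    filter_upwards [ae_restrict_mem (measurableSet_Ici.diff hIm)] with t ht
    exact (hz t ht).symm
  have h3 := (aemeasurable_union_iff.2 ⟨h1, h2⟩)
  exact h3.mono_measure (Measure.restrict_mono (by
    intro t ht
    by_cases h : t ∈ I
    · exact Or.inl h
    · exact Or.inr ⟨ht, h⟩) le_rfl)

/-- Push-forward for solutions. -/
lemma sol_map {f : ℝ → ℝ} {M : ℝ} (hM : 0 < M) (hb : ∀ t, f t ≤ M) (hf0 : ∀ t, 0 ≤ f t)
    (hfm : Measurable f) {y : ℝ → ℝ}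
    (hy : ∀ t, 0 ≤ t → y t = ∫ s in (0:ℝ)..t, f (y s)) :
    MonotoneOn y (Set.Ici 0) ∧ ∀ T, 0 ≤ T → muF f (Set.Ioc 0 (y T)) ≤ ENNReal.ofReal T ∧
      ((∀ s ∈ Set.Ioc 0 T, f (y s) ≠ 0) → muF f (Set.Ioc 0 (y T)) = ENNReal.ofReal T) := by
  have hym := sol_measurable hf0 hy
  have hint : ∀ a b : ℝ, 0 ≤ a → 0 ≤ b →
      IntervalIntegrable (fun s => f (y s)) volume a b := by
    intro a b ha hb'
    rw [intervalIntegrable_iff]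
    have hsub : Set.uIoc a b ⊆ Set.Ici 0 := fun x hx => (le_min ha hb').trans hx.1.le
    haveI : IsFiniteMeasure (volume.restrict (Set.uIoc a b)) :=
      ⟨by simp [Set.uIoc]⟩
    refine Integrable.of_bound (C := M) ?_ ?_
    · exact ((hfm.comp_aemeasurable hym).mono_measure
        (Measure.restrict_mono hsub le_rfl)).aestronglyMeasurable
    · refine Filter.Eventually.of_forall fun s => ?_
      rw [Real.norm_of_nonneg (hf0 _)]; exact hb _
  have hmono : MonotoneOn y (Set.Ici 0) := by
    intro s hs t ht hst
    rw [hy s hs, hy t ht]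
    apply intervalIntegral.integral_mono_interval le_rfl hs hst _ (hint 0 t le_rfl ht)
    exact Filter.Eventually.of_forall fun x => hf0 _
  refine ⟨hmono, fun T hT => ?_⟩
  have hcont : ContinuousOn y (Set.Icc 0 T) := by
    have h := intervalIntegral.continuousOn_primitive_interval (f := fun s => f (y s))
      (μ := volume) (a := 0) (b := T) (by
        have := (intervalIntegrable_iff_integrableOn_Icc_of_le hT).1 (hint 0 T le_rfl hT)
        rwa [Set.uIcc_of_le hT])
    rw [Set.uIcc_of_le hT] at h
    exact h.congr fun t ht => hy t ht.1
  have y0 : y 0 = 0 := by rw [hy 0 le_rfl]; simp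
  have hT0 : 0 ≤ y T := by rw [← y0]; exact hmono (by simp) hT hT
  have hymT : AEMeasurable y (volume.restrict (Set.Ioc 0 T)) :=
    hym.mono_measure (Measure.restrict_mono (fun x hx => hx.1.le) le_rfl)
  have hFm : AEMeasurable (fun s => ENNReal.ofReal (f (y s))) (volume.restrict (Set.Ioc 0 T)) :=
    (hfm.comp_aemeasurable hymT).ennreal_ofReal
  have hlint : ∀ t, 0 ≤ t → ∫⁻ s in Set.Ioc 0 t, ENNReal.ofReal (f (y s)) =
      ENNReal.ofReal (y t) := by
    intro t ht
    rw [hy t ht, intervalIntegral.integral_of_le ht, ofReal_integral_eq_lintegral_ofReal]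
    · exact (intervalIntegrable_iff_integrableOn_Ioc_of_le ht).1 (hint 0 t le_rfl ht)
    · exact Filter.Eventually.of_forall fun s => hf0 _
  let ν := (volume.restrict (Set.Ioc 0 T)).withDensity (fun s => ENNReal.ofReal (f (y s)))
  have hac : ν ≪ volume.restrict (Set.Ioc 0 T) := withDensity_absolutelyContinuous _ _
  have hyν : AEMeasurable y ν := hymT.mono_ac hac
  have hνfin : IsFiniteMeasure ν := ⟨by
    rw [withDensity_apply _ MeasurableSet.univ, Measure.restrict_univ, hlint T hT]
    exact ENNReal.ofReal_lt_top⟩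
  have hmap : Measure.map y ν = volume.restrict (Set.Ioc 0 (y T)) := by
    apply Measure.ext_of_Iic
    intro u
    rw [Measure.map_apply_of_aemeasurable hyν measurableSet_Iic,
      Measure.restrict_apply measurableSet_Iic]
    have e2 : Set.Iic u ∩ Set.Ioc 0 (y T) = Set.Ioc 0 (min u (y T)) := by
      ext x
      simp only [Set.mem_inter_iff, Set.mem_Iic, Set.mem_Ioc, le_min_iff]
      tauto
    obtain ⟨r, hr0, hrT, hr, hry⟩ : ∃ r, 0 ≤ r ∧ r ≤ T ∧ (∀ x ∈ Set.Ioc 0 T, y x ≤ u ↔ x ≤ r) ∧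
        ENNReal.ofReal (y r) = ENNReal.ofReal (min u (y T)) := by
      rcases lt_or_ge u 0 with hu | hu
      · refine ⟨0, le_rfl, hT, ?_, ?_⟩
        · intro x hx
          have h1 : y 0 ≤ y x := hmono (by simp) hx.1.le hx.1.le
          constructor
          · intro h; linarith
          · intro h; linarith [hx.1]
        · rw [y0, ENNReal.ofReal_zero, ENNReal.ofReal_of_nonpos ((min_le_left _ _).trans hu.le)]
      · have hcl : IsCompact (Set.Icc 0 T ∩ y ⁻¹' Set.Iic u) :=
          isCompact_Icc.of_isClosed_subset
            (hcont.preimage_isClosed_of_isClosed isClosed_Icc isClosed_Iic) Set.inter_subset_left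
        obtain ⟨r, ⟨⟨hr0, hrT⟩, hru⟩, hmax⟩ :=
          hcl.exists_isGreatest ⟨0, ⟨le_rfl, hT⟩, by simpa [y0] using hu⟩
        refine ⟨r, hr0, hrT, ?_, ?_⟩
        · intro x hx
          constructor
          · intro h; exact hmax ⟨⟨hx.1.le, hx.2⟩, h⟩
          · intro h; exact (hmono hx.1.le hr0 h).trans hru
        · congr 1
          apply le_antisymm (le_min hru (hmono hr0 hT hrT))
          rcases le_total (y T) u with h | h
          · have : T ≤ r := hmax ⟨⟨hT, le_rfl⟩, h⟩
            exact (min_le_right _ _).trans (hmono hT hr0 this)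
          · obtain ⟨x, hx, hxu⟩ := intermediate_value_Icc hrT
              (hcont.mono (Set.Icc_subset_Icc_left hr0)) ⟨hru, h⟩
            have h5 : x ≤ r := hmax ⟨⟨hr0.trans hx.1, hx.2⟩, hxu.le⟩
            have h6 : x = r := le_antisymm h5 hx.1
            rw [← h6, hxu]; exact min_le_left _ _
    have e1 : ν (y ⁻¹' Set.Iic u) = ν (Set.Ioc 0 r) := by
      apply measure_congr
      have hmem : ∀ᵐ x ∂ν, x ∈ Set.Ioc 0 T := hac.ae_le (ae_restrict_mem measurableSet_Ioc)
      filter_upwards [hmem] with x hx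
      apply propext
      change y x ≤ u ↔ x ∈ Set.Ioc 0 r
      rw [hr x hx]
      exact ⟨fun h => ⟨hx.1, h⟩, fun h => h.2⟩
    rw [e1, e2, withDensity_apply _ measurableSet_Ioc,
      Measure.restrict_restrict measurableSet_Ioc,
      Set.inter_eq_self_of_subset_left (Set.Ioc_subset_Ioc_right hrT), hlint r hr0, hry]
    simp
  have hgm : Measurable fun s => (ENNReal.ofReal (f s))⁻¹ := hfm.ennreal_ofReal.inv
  have key : muF f (Set.Ioc 0 (y T)) = ∫⁻ s in Set.Ioc 0 T,
      ENNReal.ofReal (f (y s)) * (ENNReal.ofReal (f (y s)))⁻¹ := by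
    rw [muF_Ioc, ← hmap, lintegral_map' hgm.aemeasurable hyν]
    exact lintegral_withDensity_eq_lintegral_mul₀ hFm hFm.inv
  rw [key]
  constructor
  · calc _ ≤ ∫⁻ s in Set.Ioc 0 T, 1 := lintegral_mono fun s => ENNReal.mul_inv_le_one _
      _ = _ := by simp
  · intro h
    calc _ = ∫⁻ s in Set.Ioc 0 T, 1 := by
          apply setLIntegral_congr_fun measurableSet_Ioc
          intro s hs
          apply ENNReal.mul_inv_cancel _ ENNReal.ofReal_ne_top
          rw [Ne, ENNReal.ofReal_eq_zero, not_le]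
          exact lt_of_le_of_ne (hf0 _) (h s hs).symm
      _ = _ := by simp

/-- with `τ = inf{t ≥ 0 : f(t) = 0}` and
`η = inf{t ≥ 0 : ∫₀ᵗ 1/f(s) ds = ∞}` (values in `[0,∞]`, `inf ∅ = ∞`, `1/0 := ∞`),
one has `η ≤ τ` iff the IVP `(f,0)` has exactly one solution. -/
theorem stmt_3 (f : ℝ → ℝ) (hf_nonneg : ∀ t, 0 ≤ f t)
    (hf_bdd : ∃ M : ℝ, ∀ t, f t ≤ M) (hf_meas : Measurable f)
    (hf_reg : ∀ t, 0 ≤ t → 0 < f t →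
      ∃ ε > (0:ℝ), ∃ δ > (0:ℝ), ∀ s, t < s → s < t + δ → ε < f s)
    (τ η : ℝ≥0∞)
    (hτ : τ = sInf (ENNReal.ofReal '' {t : ℝ | 0 ≤ t ∧ f t = 0}))
    (hη : η = sInf (ENNReal.ofReal ''
      {t : ℝ | 0 ≤ t ∧ (∫⁻ s in Set.Ioc (0:ℝ) t, (ENNReal.ofReal (f s))⁻¹) = ∞})) :
    η ≤ τ ↔
      (∀ y₁ y₂ : ℝ → ℝ, (∀ t, 0 ≤ y₁ t) → (∀ t, 0 ≤ y₂ t) →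
        (∀ t, 0 ≤ t → y₁ t = ∫ s in (0:ℝ)..t, f (y₁ s)) →
        (∀ t, 0 ≤ t → y₂ t = ∫ s in (0:ℝ)..t, f (y₂ s)) →
        ∀ t, 0 ≤ t → y₁ t = y₂ t) := by
  obtain ⟨M₀, hM₀⟩ := hf_bdd
  obtain ⟨M, hM, hb⟩ : ∃ M : ℝ, 0 < M ∧ ∀ t, f t ≤ M :=
    ⟨max M₀ 1, lt_max_of_lt_right one_pos, fun t => (hM₀ t).trans (le_max_left _ _)⟩
  simp only [← muF_Ioc] at hη
  -- finite below eta
  have hfinη : ∀ u, 0 ≤ u → ENNReal.ofReal u < η → muF f (Set.Ioc 0 u) ≠ ∞ := by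
    intro u hu hlt h
    rw [hη] at hlt
    exact notMem_of_lt_csInf hlt (OrderBot.bddBelow _) ⟨u, ⟨hu, h⟩, rfl⟩
  have hposτ : ∀ u, 0 ≤ u → ENNReal.ofReal u < τ → f u ≠ 0 := by
    intro u hu hlt h
    rw [hτ] at hlt
    exact notMem_of_lt_csInf hlt (OrderBot.bddBelow _) ⟨u, ⟨hu, h⟩, rfl⟩
  have hinfη : ∀ u, η < ENNReal.ofReal u → muF f (Set.Ioc 0 u) = ∞ := by
    intro u hlt
    rw [hη, sInf_lt_iff] at hlt
    obtain ⟨_, ⟨v, ⟨hv0, hv⟩, rfl⟩, hvu⟩ := hlt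
    have : v ≤ u := (ENNReal.ofReal_lt_ofReal_iff'.1 hvu).1.le
    exact top_le_iff.1 (hv ▸ muF_mono f this)
  constructor
  · intro hle
    have main : ∀ y₁ y₂ : ℝ → ℝ, (∀ t, 0 ≤ y₁ t) → (∀ t, 0 ≤ y₂ t) →
        (∀ t, 0 ≤ t → y₁ t = ∫ s in (0:ℝ)..t, f (y₁ s)) →
        (∀ t, 0 ≤ t → y₂ t = ∫ s in (0:ℝ)..t, f (y₂ s)) →
        ∀ t, 0 ≤ t → y₂ t ≤ y₁ t := by
      intro y₁ y₂ h₁ h₂ e₁ e₂ t ht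
      by_contra hlt
      push Not at hlt
      obtain ⟨m₁, k₁⟩ := sol_map hM hb hf_nonneg hf_meas e₁
      obtain ⟨m₂, k₂⟩ := sol_map hM hb hf_nonneg hf_meas e₂
      have hy2 : ENNReal.ofReal (y₂ t) ≤ η := by
        by_contra h
        push Not at h
        have := hinfη _ h
        have h3 := (k₂ t ht).1
        rw [this] at h3
        exact ENNReal.ofReal_ne_top (top_le_iff.1 h3)
      have hy1 : ENNReal.ofReal (y₁ t) < τ :=
        ((ENNReal.ofReal_lt_ofReal_iff_of_nonneg (h₁ t)).2 hlt).trans_le (hy2.trans hle)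
      have g1 := (k₁ t ht).2 (by
        intro s hs
        apply hposτ _ (h₁ s)
        exact (ENNReal.ofReal_le_ofReal (m₁ hs.1.le ht hs.2)).trans_lt hy1)
      have g2 := muF_strict f M hM hb (h₁ t) hlt (by rw [g1]; exact ENNReal.ofReal_ne_top)
      rw [g1] at g2
      exact absurd (k₂ t ht).1 (not_le.2 g2)
    intro y₁ y₂ h₁ h₂ e₁ e₂ t ht
    exact le_antisymm (main y₂ y₁ h₂ h₁ e₂ e₁ t ht) (main y₁ y₂ h₁ h₂ e₁ e₂ t ht)
  · intro huniq
    by_contra hlt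
    push Not at hlt
    -- the infimum of the zero set is attained
    obtain ⟨a, ha0, haτ⟩ : ∃ a : ℝ, 0 ≤ a ∧ τ = ENNReal.ofReal a :=
      ⟨_, ENNReal.toReal_nonneg, (ENNReal.ofReal_toReal hlt.ne_top).symm⟩
    have hfa : f a = 0 := by
      by_contra hne
      obtain ⟨ε, hε, δ, hδ, H⟩ := hf_reg a ha0 (lt_of_le_of_ne (hf_nonneg a) (Ne.symm hne))
      have h1 : τ < ENNReal.ofReal (a + δ) := by
        rw [haτ]; exact (ENNReal.ofReal_lt_ofReal_iff_of_nonneg ha0).2 (by linarith)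
      have h2 := h1
      rw [hτ, sInf_lt_iff] at h2
      obtain ⟨_, ⟨v, ⟨hv0, hv⟩, rfl⟩, hvu⟩ := h2
      have hva : v < a + δ := (ENNReal.ofReal_lt_ofReal_iff'.1 hvu).1
      have hav : a ≤ v := by
        by_contra h
        push Not at h
        exact hposτ v hv0 (by
          rw [haτ]; exact (ENNReal.ofReal_lt_ofReal_iff_of_nonneg hv0).2 h) hv
      rcases hav.eq_or_lt with h | h
      · rw [h] at hne; exact hne hv
      · have := H v h hva
        linarith
    have hendη : ∀ u, 0 ≤ u → ENNReal.ofReal u = η → muF f (Set.Ioc 0 u) ≠ ∞ → f u = 0 := by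
      intro u hu hue hfin
      by_contra hne
      obtain ⟨ε, hε, δ, hδ, H⟩ := hf_reg u hu (lt_of_le_of_ne (hf_nonneg u) (Ne.symm hne))
      have h1 := hinfη (u + δ / 2) (by
        rw [← hue]; exact (ENNReal.ofReal_lt_ofReal_iff_of_nonneg hu).2 (by linarith))
      rw [muF_add f hu (by linarith : u ≤ u + δ / 2)] at h1
      have h2 : muF f (Set.Ioc u (u + δ / 2)) ≠ ∞ := by
        rw [muF_Ioc]
        have : ∫⁻ s in Set.Ioc u (u + δ / 2), (ENNReal.ofReal (f s))⁻¹ ≤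
            ∫⁻ s in Set.Ioc u (u + δ / 2), (ENNReal.ofReal ε)⁻¹ := by
          apply setLIntegral_mono measurable_const
          intro s hs
          exact ENNReal.inv_le_inv.2
            (ENNReal.ofReal_le_ofReal (H s hs.1 (by linarith [hs.2])).le)
        refine (this.trans_lt ?_).ne
        rw [setLIntegral_const, Real.volume_Ioc]
        exact ENNReal.mul_lt_top (ENNReal.inv_lt_top.2 (ENNReal.ofReal_pos.2 hε))
          ENNReal.ofReal_lt_top
      exact (ENNReal.add_ne_top.2 ⟨hfin, h2⟩) h1
    have s1 := solY_sol η hM hb hf_nonneg hf_meas hfinη hendη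
    have s2 := solY_sol (ENNReal.ofReal a) hM hb hf_nonneg hf_meas
      (fun u hu h => hfinη u hu (h.trans (haτ ▸ hlt)))
      (fun u hu h _ => by
        rcases ENNReal.ofReal_eq_ofReal_iff hu ha0 |>.1 h with rfl
        exact hfa)
    rw [haτ] at hlt
    obtain ⟨q, hq1, hq2⟩ : ∃ q : ℝ, a < q ∧ ENNReal.ofReal q < η := by
      obtain ⟨r, hr0, hr⟩ := ENNReal.lt_iff_exists_nnreal_btwn.1 hlt
      refine ⟨r, ?_, by simpa using hr⟩
      rw [← ENNReal.ofReal_coe_nnreal] at hr0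
      exact (ENNReal.ofReal_lt_ofReal_iff_of_nonneg ha0).1 hr0
    have hq0 : 0 ≤ q := ha0.trans hq1.le
    have hqf := hfinη q hq0 hq2
    have heq := huniq _ _ (fun t => (solY_mem η hM hb t).1)
      (fun t => (solY_mem (ENNReal.ofReal a) hM hb t).1) s1 s2
      (muF f (Set.Ioc 0 q)).toReal ENNReal.toReal_nonneg
    have l1 := (le_solY η hM hb (t := (muF f (Set.Ioc 0 q)).toReal) hq0 hq2.le).2
      (by rw [ENNReal.ofReal_toReal hqf])
    have l2 := (solY_mem (ENNReal.ofReal a) hM hb (muF f (Set.Ioc 0 q)).toReal).2.1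
    rw [ENNReal.ofReal_le_ofReal_iff ha0] at l2
    linarith
end

section
/- Let f : [0,∞) → [0,∞) be bounded, Borel measurable and right regular at zero, and set τ := inf{t ≥ 0 : f(t) = 0}. Assume that whenever τ < ∞ one has ∫_τ^{τ+ε} 1/f(s) ds = ∞ for every ε > 0. Then the IVP (f, 0) has exactly one solution, i.e. any two functions y₁, y₂ : [0,∞) → [0,∞) with yᵢ(t) = ∫₀ᵗ f(yᵢ(s)) ds for all t ≥ 0 (i = 1,2) are equal. -/
open MeasureTheory ENNReal

lemma sol_integrable_s4 (f : ℝ → ℝ) (hf_nonneg : ∀ t, 0 ≤ f t) (M : ℝ) (hM : ∀ t, f t ≤ M)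
    (y : ℝ → ℝ) (hy : ∀ t, 0 ≤ t → y t = ∫ s in (0:ℝ)..t, f (y s)) (t : ℝ) :
    IntegrableOn (fun s => f (y s)) (Set.Ioc 0 t) := by
  have key : ∀ A : Set ℝ, volume A ≠ ∞ →
      AEStronglyMeasurable (fun s => f (y s)) (volume.restrict A) →
      IntegrableOn (fun s => f (y s)) A := by
    intro A hA h
    haveI : IsFiniteMeasure (volume.restrict A) := ⟨by simpa [lt_top_iff_ne_top] using hA⟩
    refine Integrable.of_bound h M ?_
    refine Filter.Eventually.of_forall fun s => ?_
    rw [Real.norm_of_nonneg (hf_nonneg _)]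
    exact hM _
  by_contra hP
  set S : Set ℝ := {t | IntegrableOn (fun s => f (y s)) (Set.Ioc 0 t)} with hS
  have hbd : BddAbove S := by
    refine ⟨t, fun s hs => ?_⟩
    by_contra hlt
    push Not at hlt
    exact hP (IntegrableOn.mono_set hs (Set.Ioc_subset_Ioc_right hlt.le))
  have h0 : (0:ℝ) ∈ S := by simp [hS]
  set T := sSup S with hT
  have hlow : ∀ s < T, s ∈ S := by
    intro s hs
    obtain ⟨r, hr, hsr⟩ := exists_lt_of_lt_csSup ⟨0, h0⟩ hs
    exact IntegrableOn.mono_set hr (Set.Ioc_subset_Ioc_right hsr.le)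
  have hT0 : 0 ≤ T := le_csSup hbd h0
  have hhigh : ∀ s, T < s → y s = 0 := by
    intro s hs
    rw [hy s (hT0.trans hs.le), intervalIntegral.integral_of_le (hT0.trans hs.le)]
    apply integral_undef
    intro h
    exact absurd (le_csSup hbd (show s ∈ S from h)) (not_le.2 hs)
  apply hP
  apply key _ (by simp)
  have hA : AEStronglyMeasurable (fun s => f (y s))
      (volume.restrict (⋃ n : ℕ, Set.Ioc 0 (T - 1 / ((n:ℝ) + 1)))) := by
    rw [aestronglyMeasurable_iUnion_iff]
    intro n
    exact (hlow (T - 1 / ((n:ℝ) + 1)) (by have : 0 < 1 / ((n:ℝ) + 1) := by positivity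
                                          linarith)).aestronglyMeasurable
  have hB : AEStronglyMeasurable (fun s => f (y s)) (volume.restrict ({T} : Set ℝ)) := by
    rw [Measure.restrict_singleton]; simp
  have hC : AEStronglyMeasurable (fun s => f (y s)) (volume.restrict (Set.Ioi T)) := by
    refine (aestronglyMeasurable_const (b := f 0)).congr ?_
    filter_upwards [ae_restrict_mem measurableSet_Ioi] with s hs
    rw [hhigh s hs]
  refine ((aestronglyMeasurable_union_iff.2 ⟨aestronglyMeasurable_union_iff.2 ⟨hA, hB⟩, hC⟩)).mono_measure
    (Measure.restrict_mono ?_ le_rfl)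
  intro s hs
  rcases lt_trichotomy s T with h | h | h
  · left; left
    obtain ⟨n, hn⟩ := exists_nat_one_div_lt (sub_pos.2 h)
    exact Set.mem_iUnion.2 ⟨n, hs.1, by linarith⟩
  · left; right; exact h
  · right; exact h

lemma sol_push (f : ℝ → ℝ) (hf_nonneg : ∀ t, 0 ≤ f t) (hf_meas : Measurable f)
    (y : ℝ → ℝ) (hc : Continuous y) (hm : Monotone y)
    (hi : ∀ t, IntegrableOn (fun s => f (y s)) (Set.Ioc 0 t))
    (hy : ∀ t, 0 ≤ t → y t = ∫ s in (0:ℝ)..t, f (y s)) (t : ℝ) (ht : 0 ≤ t) :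
    ((volume.restrict (Set.Ioc 0 t)).withDensity (fun s => ENNReal.ofReal (f (y s)))).map y
      = volume.restrict (Set.Ioc 0 (y t)) := by
  have hy0 : y 0 = 0 := by rw [hy 0 le_rfl]; simp
  have hI : ∀ s, 0 ≤ s → ∫⁻ r in Set.Ioc 0 s, ENNReal.ofReal (f (y r)) = ENNReal.ofReal (y s) := by
    intro s hs
    rw [hy s hs, intervalIntegral.integral_of_le hs,
      ofReal_integral_eq_lintegral_ofReal (hi s) (Filter.Eventually.of_forall fun _ => hf_nonneg _)]
  symm
  apply Measure.ext_of_Iic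
  intro a
  have hpm : MeasurableSet (y ⁻¹' Set.Iic a) := hc.measurable measurableSet_Iic
  rw [Measure.map_apply hc.measurable measurableSet_Iic, withDensity_apply _ hpm,
    Measure.restrict_restrict hpm, Measure.restrict_apply measurableSet_Iic]
  have hyt : 0 ≤ y t := hy0 ▸ hm ht
  rcases lt_or_ge a 0 with ha | ha
  · have h1 : Set.Iic a ∩ Set.Ioc 0 (y t) = ∅ := by
      ext x; simp only [Set.mem_inter_iff, Set.mem_Iic, Set.mem_Ioc, Set.mem_empty_iff_false, iff_false]
      intro h; linarith [h.1, h.2.1]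
    have h2 : y ⁻¹' Set.Iic a ∩ Set.Ioc 0 t = ∅ := by
      ext x; simp only [Set.mem_inter_iff, Set.mem_preimage, Set.mem_Iic, Set.mem_Ioc, Set.mem_empty_iff_false, iff_false]
      intro h
      have := hm h.2.1.le
      linarith [h.1]
    simp [h1, h2]
  rcases le_or_gt (y t) a with hta | hta
  · have h1 : Set.Iic a ∩ Set.Ioc 0 (y t) = Set.Ioc 0 (y t) :=
      Set.inter_eq_right.2 fun x hx => hx.2.trans hta
    have h2 : y ⁻¹' Set.Iic a ∩ Set.Ioc 0 t = Set.Ioc 0 t :=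
      Set.inter_eq_right.2 fun x hx => (hm hx.2).trans hta
    rw [h1, h2, hI t ht]; simp
  · have hcomp : IsCompact (Set.Icc 0 t ∩ y ⁻¹' Set.Iic a) :=
      isCompact_Icc.inter_right (isClosed_Iic.preimage hc)
    obtain ⟨s, hs, hmax⟩ := hcomp.exists_isGreatest ⟨0, ⟨le_rfl, ht⟩, by simpa [hy0] using ha⟩
    obtain ⟨r, hr, hra⟩ := intermediate_value_Icc ht hc.continuousOn
      (show a ∈ Set.Icc (y 0) (y t) from ⟨by rw [hy0]; exact ha, hta.le⟩)
    have hrs : r ≤ s := hmax ⟨hr, hra.le⟩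
    have hsa : y s = a := le_antisymm hs.2 (hra ▸ hm hrs)
    have h1 : Set.Iic a ∩ Set.Ioc 0 (y t) = Set.Ioc 0 a := by
      ext x; simp only [Set.mem_inter_iff, Set.mem_Iic, Set.mem_Ioc]
      exact ⟨fun h => ⟨h.2.1, h.1⟩, fun h => ⟨h.2, h.1, h.2.trans hta.le⟩⟩
    have h2 : y ⁻¹' Set.Iic a ∩ Set.Ioc 0 t = Set.Ioc 0 s := by
      ext x; simp only [Set.mem_inter_iff, Set.mem_preimage, Set.mem_Iic, Set.mem_Ioc]
      exact ⟨fun h => ⟨h.2.1, hmax ⟨⟨h.2.1.le, h.2.2⟩, h.1⟩⟩,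
        fun h => ⟨hsa ▸ hm h.2, h.1, h.2.trans hs.1.2⟩⟩
    rw [h1, h2, hI s hs.1.1, hsa]; simp

lemma sol_H (f : ℝ → ℝ) (hf_nonneg : ∀ t, 0 ≤ f t) (M : ℝ) (hM : ∀ t, f t ≤ M)
    (hf_meas : Measurable f)
    (y : ℝ → ℝ) (hy : ∀ t, 0 ≤ t → y t = ∫ s in (0:ℝ)..t, f (y s)) (t : ℝ) (ht : 0 ≤ t) :
    (∫⁻ s in Set.Ioc 0 (y t), (ENNReal.ofReal (f s))⁻¹) ≤ ENNReal.ofReal t ∧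
    ((∀ x, 0 ≤ x → x ≤ y t → f x ≠ 0) →
      (∫⁻ s in Set.Ioc 0 (y t), (ENNReal.ofReal (f s))⁻¹) = ENNReal.ofReal t) := by
  have hi := sol_integrable_s4 f hf_nonneg M hM y hy
  set z : ℝ → ℝ := fun t => y (max t 0) with hz
  have hzy : ∀ s, 0 ≤ s → z s = y s := fun s hs => by simp [hz, max_eq_left hs]
  have hii : ∀ a b, 0 ≤ a → 0 ≤ b → IntervalIntegrable (fun s => f (y s)) volume a b := by
    intro a b ha hb
    rw [intervalIntegrable_iff]
    exact (hi (max a b)).mono_set (Set.Ioc_subset_Ioc_left (le_min ha hb))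
  have hdiff : ∀ a b, 0 ≤ a → a ≤ b → y b - y a = ∫ s in a..b, f (y s) := by
    intro a b ha hab
    rw [hy b (ha.trans hab), hy a ha,
      intervalIntegral.integral_interval_sub_left (hii _ _ le_rfl (ha.trans hab)) (hii _ _ le_rfl ha)]
  have hmy : ∀ a b, 0 ≤ a → a ≤ b → y a ≤ y b := by
    intro a b ha hab
    have := hdiff a b ha hab
    have h2 : 0 ≤ ∫ s in a..b, f (y s) := intervalIntegral.integral_nonneg hab fun _ _ => hf_nonneg _
    linarith
  have hm : Monotone z := fun a b hab => hmy _ _ (le_max_right _ _) (max_le_max_right _ hab)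
  have hcy : ContinuousOn y (Set.Ici 0) := by
    have : LipschitzOnWith (Real.toNNReal M) y (Set.Ici 0) := by
      apply LipschitzOnWith.of_le_add_mul
      intro a ha b hb
      have hM0 : 0 ≤ M := (hf_nonneg 0).trans (hM 0)
      rw [Real.coe_toNNReal _ hM0]
      rcases le_total a b with h | h
      · have := hmy a b ha h
        have : 0 ≤ M * dist a b := by positivity
        linarith
      · have h1 := hdiff b a hb h
        have h2 := intervalIntegral.norm_integral_le_of_norm_le_const (a := b) (b := a) (C := M)
          (f := fun s => f (y s)) (fun s _ => by rw [Real.norm_of_nonneg (hf_nonneg _)]; exact hM _)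
        have h3 := (le_abs_self _).trans h2
        rw [Real.dist_eq]
        linarith
    exact this.continuousOn
  have hc : Continuous z :=
    hcy.comp_continuous (continuous_id.max continuous_const) (fun x => Set.mem_Ici.2 (le_max_right x 0))
  have hiz : ∀ t, IntegrableOn (fun s => f (z s)) (Set.Ioc 0 t) := by
    intro t
    refine (hi t).congr_fun (fun s hs => ?_) measurableSet_Ioc
    simp only [hzy s hs.1.le]
  have hyz : ∀ t, 0 ≤ t → z t = ∫ s in (0:ℝ)..t, f (z s) := by
    intro t ht
    rw [hzy t ht, hy t ht]
    apply intervalIntegral.integral_congr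
    intro s hs
    rw [Set.uIcc_of_le ht] at hs
    simp only [hzy s hs.1]
  have hp := sol_push f hf_nonneg hf_meas z hc hm hiz hyz t ht
  have hg : Measurable fun s => (ENNReal.ofReal (f s))⁻¹ := hf_meas.ennreal_ofReal.inv
  have hfz : Measurable fun s => ENNReal.ofReal (f (z s)) :=
    (hf_meas.comp hc.measurable).ennreal_ofReal
  rw [← hzy t ht, ← hp, lintegral_map hg hc.measurable,
    lintegral_withDensity_eq_lintegral_mul _ hfz
      (g := fun a => (ENNReal.ofReal (f (z a)))⁻¹) (hg.comp hc.measurable)]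
  have hvol : ∫⁻ s in Set.Ioc 0 t, (1:ℝ≥0∞) = ENNReal.ofReal t := by simp
  constructor
  · rw [← hvol]
    apply lintegral_mono
    intro s
    exact ENNReal.mul_inv_le_one _
  · intro h
    rw [← hvol]
    apply setLIntegral_congr_fun measurableSet_Ioc
    intro s hs
    have hz0 : z 0 = 0 := by rw [hyz 0 le_rfl]; simp
    have h1 := h (z s) (hz0 ▸ hm hs.1.le) (hm hs.2)
    have h2 : 0 < f (z s) := lt_of_le_of_ne (hf_nonneg _) (Ne.symm h1)
    exact ENNReal.mul_inv_cancel (by simpa using h2) ENNReal.ofReal_ne_top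

lemma sol_not_lt (f : ℝ → ℝ) (hf_nonneg : ∀ t, 0 ≤ f t)
    (hf_bdd : ∃ M : ℝ, ∀ t, f t ≤ M) (hf_meas : Measurable f)
    (hdiv : ∀ τ : ℝ, IsGLB {t : ℝ | 0 ≤ t ∧ f t = 0} τ →
      ∀ ε > (0:ℝ), (∫⁻ s in Set.Ioc τ (τ + ε), (ENNReal.ofReal (f s))⁻¹) = ∞)
    (y₁ y₂ : ℝ → ℝ) (h0 : ∀ t, 0 ≤ y₁ t)
    (h1 : ∀ t, 0 ≤ t → y₁ t = ∫ s in (0:ℝ)..t, f (y₁ s))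
    (h2 : ∀ t, 0 ≤ t → y₂ t = ∫ s in (0:ℝ)..t, f (y₂ s))
    (t : ℝ) (ht : 0 ≤ t) : ¬ y₁ t < y₂ t := by
  intro hlt
  obtain ⟨M, hM⟩ := hf_bdd
  have H1 := (sol_H f hf_nonneg M hM hf_meas y₁ h1 t ht).2
  have H2 := (sol_H f hf_nonneg M hM hf_meas y₂ h2 t ht).1
  by_cases hz : ∀ x, 0 ≤ x → x ≤ y₁ t → f x ≠ 0
  · have H1 := H1 hz
    rw [← Set.Ioc_union_Ioc_eq_Ioc (h0 t) hlt.le, lintegral_union measurableSet_Ioc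
      (Set.Ioc_disjoint_Ioc_of_le le_rfl), H1] at H2
    have H3 : ∫⁻ s in Set.Ioc (y₁ t) (y₂ t), (ENNReal.ofReal (f s))⁻¹ = 0 := by
      by_contra hne
      exact absurd H2 (not_le.2 (ENNReal.lt_add_right ENNReal.ofReal_ne_top hne))
    have hpos : 0 < ∫⁻ s in Set.Ioc (y₁ t) (y₂ t), (ENNReal.ofReal (f s))⁻¹ := by
      rw [setLIntegral_pos_iff (f := fun s => (ENNReal.ofReal (f s))⁻¹) hf_meas.ennreal_ofReal.inv]
      have : (Function.support fun s => (ENNReal.ofReal (f s))⁻¹) = Set.univ := by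
        ext s; simp
      rw [this]
      simpa using hlt
    exact hpos.ne' H3
  · push Not at hz
    obtain ⟨x, hx0, hx1, hfx⟩ := hz
    have hbb : BddBelow {t : ℝ | 0 ≤ t ∧ f t = 0} := ⟨0, fun s hs => hs.1⟩
    have hne : {t : ℝ | 0 ≤ t ∧ f t = 0}.Nonempty := ⟨x, hx0, hfx⟩
    have hglb := isGLB_csInf hne hbb
    set τ := sInf {t : ℝ | 0 ≤ t ∧ f t = 0}
    have hτx : τ ≤ x := hglb.1 ⟨hx0, hfx⟩
    have hτ0 : 0 ≤ τ := hglb.2 fun s hs => hs.1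
    have hd := hdiv τ hglb (y₂ t - τ) (by linarith)
    have hle := lintegral_mono_set (μ := volume) (f := fun s => (ENNReal.ofReal (f s))⁻¹)
      (show Set.Ioc τ (τ + (y₂ t - τ)) ⊆ Set.Ioc 0 (y₂ t) from
        Set.Ioc_subset_Ioc hτ0 (by linarith))
    rw [hd] at hle
    exact absurd (hle.trans H2) (by simp)

/-- if `τ = inf{t ≥ 0 : f(t) = 0}` satisfies
`∫_τ^{τ+ε} 1/f(s) ds = ∞` for every `ε > 0` whenever `τ < ∞` (the finiteness of
`τ` being expressed by the existence of a real greatest lower bound of the zero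
set of `f` in `[0,∞)`), then the IVP `(f,0)` has exactly one solution. -/
theorem stmt_4 (f : ℝ → ℝ) (hf_nonneg : ∀ t, 0 ≤ f t)
    (hf_bdd : ∃ M : ℝ, ∀ t, f t ≤ M) (hf_meas : Measurable f)
    (hf_reg : ∀ t, 0 ≤ t → 0 < f t →
      ∃ ε > (0:ℝ), ∃ δ > (0:ℝ), ∀ s, t < s → s < t + δ → ε < f s)
    (hdiv : ∀ τ : ℝ, IsGLB {t : ℝ | 0 ≤ t ∧ f t = 0} τ →
      ∀ ε > (0:ℝ), (∫⁻ s in Set.Ioc τ (τ + ε), (ENNReal.ofReal (f s))⁻¹) = ∞) :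
    ∀ y₁ y₂ : ℝ → ℝ, (∀ t, 0 ≤ y₁ t) → (∀ t, 0 ≤ y₂ t) →
      (∀ t, 0 ≤ t → y₁ t = ∫ s in (0:ℝ)..t, f (y₁ s)) →
      (∀ t, 0 ≤ t → y₂ t = ∫ s in (0:ℝ)..t, f (y₂ s)) →
      ∀ t, 0 ≤ t → y₁ t = y₂ t := by
  intro y₁ y₂ hp1 hp2 h1 h2 t ht
  exact le_antisymm
    (not_lt.1 (sol_not_lt f hf_nonneg hf_bdd hf_meas hdiv y₂ y₁ hp2 h2 h1 t ht))
    (not_lt.1 (sol_not_lt f hf_nonneg hf_bdd hf_meas hdiv y₁ y₂ hp1 h1 h2 t ht))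
end

section
/- Let f : [0,∞) → [0,∞) be bounded, Borel measurable and right regular at zero, with sup norm ‖f‖_∞. Set η := inf{t ≥ 0 : ∫₀ᵗ 1/f(s) ds = ∞}, define I(t) := ∫₀ᵗ 1/f(s) ds for t < η, and set γ := sup{I(t) : t < η}. Then I is continuous and strictly increasing on [0,η), its inverse function g : [0,γ) → [0,η) is Lipschitz continuous with Lipschitz constant ‖f‖_∞, and g(t) = ∫₀ᵗ f(g(s)) ds for all t ∈ [0,γ). -/
open MeasureTheory ENNReal

/-- for `f : [0,∞) → [0,∞)` bounded (with sup norm `M`), Borel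
measurable and right regular at zero, with `η = inf{t ≥ 0 : ∫₀ᵗ 1/f = ∞}`,
`I(t) = ∫₀ᵗ 1/f(s) ds` and `γ = sup{I(t) : 0 ≤ t < η}`: the function `I` is
continuous and strictly increasing on `[0,η)`, it has an inverse
`g : [0,γ) → [0,η)` which is Lipschitz continuous with Lipschitz constant `M`,
and `g(t) = ∫₀ᵗ f(g(s)) ds` for all `t ∈ [0,γ)`. -/
theorem stmt_5 (f : ℝ → ℝ) (M : ℝ) (hf_nonneg : ∀ t, 0 ≤ f t)
    (hM : IsLUB (Set.range f) M) (hf_meas : Measurable f)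
    (hf_reg : ∀ t, 0 ≤ t → 0 < f t →
      ∃ ε > (0:ℝ), ∃ δ > (0:ℝ), ∀ s, t < s → s < t + δ → ε < f s)
    (I : ℝ → ℝ≥0∞)
    (hI : ∀ t, I t = ∫⁻ s in Set.Ioc (0:ℝ) t, (ENNReal.ofReal (f s))⁻¹)
    (η : ℝ≥0∞)
    (hη : η = sInf (ENNReal.ofReal ''
      {t : ℝ | 0 ≤ t ∧ (∫⁻ s in Set.Ioc (0:ℝ) t, (ENNReal.ofReal (f s))⁻¹) = ∞}))
    (γ : ℝ≥0∞)
    (hγ : γ = ⨆ t ∈ {t : ℝ | 0 ≤ t ∧ ENNReal.ofReal t < η}, I t) :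
    StrictMonoOn I {t : ℝ | 0 ≤ t ∧ ENNReal.ofReal t < η} ∧
    ContinuousOn I {t : ℝ | 0 ≤ t ∧ ENNReal.ofReal t < η} ∧
    ∃ g : ℝ → ℝ,
      (∀ t, 0 ≤ t → ENNReal.ofReal t < γ →
        0 ≤ g t ∧ ENNReal.ofReal (g t) < η ∧ I (g t) = ENNReal.ofReal t) ∧
      (∀ s, 0 ≤ s → ENNReal.ofReal s < η → g ((I s).toReal) = s) ∧
      (∀ t₁ t₂, 0 ≤ t₁ → ENNReal.ofReal t₁ < γ → 0 ≤ t₂ → ENNReal.ofReal t₂ < γ →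
        |g t₁ - g t₂| ≤ M * |t₁ - t₂|) ∧
      (∀ t, 0 ≤ t → ENNReal.ofReal t < γ → g t = ∫ s in (0:ℝ)..t, f (g s)) := by
  set F : ℝ → ℝ≥0∞ := fun s => (ENNReal.ofReal (f s))⁻¹ with hF
  have hFm : Measurable F := hf_meas.ennreal_ofReal.inv
  set S : Set ℝ := {t : ℝ | 0 ≤ t ∧ ENNReal.ofReal t < η} with hS
  have hfM : ∀ x, f x ≤ M := fun x => hM.1 ⟨x, rfl⟩
  have hM0 : 0 ≤ M := (hf_nonneg 0).trans (hfM 0)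
  have hIfin : ∀ t ∈ S, I t ≠ ∞ := by
    intro t ht h
    have : η ≤ ENNReal.ofReal t := by
      rw [hη]
      exact sInf_le ⟨t, ⟨ht.1, by rw [← hI]; exact h⟩, rfl⟩
    exact absurd ht.2 (not_lt.2 this)
  have hSup : ∀ x ∈ S, ∃ b ∈ S, x < b := by
    intro x hx
    obtain ⟨r, hr0, h1, h2⟩ := ENNReal.lt_iff_exists_real_btwn.1 hx.2
    exact ⟨r, ⟨hr0, h2⟩, (ENNReal.ofReal_lt_ofReal_iff_of_nonneg hx.1).1 h1⟩
  have hSdown : ∀ x ∈ S, ∀ y, 0 ≤ y → y ≤ x → y ∈ S := fun x hx y hy hyx =>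
    ⟨hy, (ENNReal.ofReal_le_ofReal hyx).trans_lt hx.2⟩
  have hI0 : I 0 = 0 := by rw [hI]; simp
  have hsplit : ∀ a b, 0 ≤ a → a ≤ b → I b = I a + ∫⁻ s in Set.Ioc a b, F s := by
    intro a b ha hab
    rw [hI, hI, ← Set.Ioc_union_Ioc_eq_Ioc ha hab,
      lintegral_union measurableSet_Ioc (Set.Ioc_disjoint_Ioc_of_le le_rfl)]
  have hlow : ∀ a b, (ENNReal.ofReal M)⁻¹ * ENNReal.ofReal (b - a) ≤ ∫⁻ s in Set.Ioc a b, F s := by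
    intro a b
    calc (ENNReal.ofReal M)⁻¹ * ENNReal.ofReal (b - a)
        = ∫⁻ s in Set.Ioc a b, (ENNReal.ofReal M)⁻¹ := by simp
      _ ≤ _ := lintegral_mono fun s => ENNReal.inv_le_inv.2 (ENNReal.ofReal_le_ofReal (hfM s))
  have hMpos : ∀ x ∈ S, 0 < M := by
    intro x hx
    by_contra h
    have hM' : M = 0 := le_antisymm (not_lt.1 h) hM0
    obtain ⟨b, hb, hxb⟩ := hSup x hx
    have h1 := hlow x b
    have h2 := hsplit x b hx.1 hxb.le
    rw [hM', ENNReal.ofReal_zero, ENNReal.inv_zero, ENNReal.top_mul (by simpa using hxb), top_le_iff] at h1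
    rw [h1] at h2
    exact hIfin b hb (by simpa using h2)
  have hmono : StrictMonoOn I S := by
    intro a ha b hb hab
    rw [hsplit a b ha.1 hab.le]
    refine ENNReal.lt_add_right (hIfin a ha) ?_
    refine (lt_of_lt_of_le ?_ (hlow a b)).ne'
    refine ENNReal.mul_pos ?_ ?_
    · simp
    · simpa using hab
  have hcontb : ∀ b ∈ S, ContinuousOn I (Set.Icc 0 b) := by
    intro b hb
    have hfin : ∫⁻ s in Set.Ioc 0 b, F s ≠ ∞ := by
      have := hIfin b hb
      rwa [hI] at this
    have hint : IntegrableOn (fun s => (F s).toReal) (Set.Icc 0 b) := by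
      rw [integrableOn_Icc_iff_integrableOn_Ioc]
      exact integrable_toReal_of_lintegral_ne_top hFm.aemeasurable hfin
    have hc := ENNReal.continuous_ofReal.comp_continuousOn (intervalIntegral.continuousOn_primitive hint)
    refine hc.congr ?_
    intro t ht
    have hft : ∫⁻ s in Set.Ioc 0 t, F s ≠ ∞ := by
      have := hIfin t (hSdown b hb t ht.1 ht.2)
      rwa [hI] at this
    change I t = ENNReal.ofReal (∫ s in Set.Ioc 0 t, (F s).toReal)
    rw [integral_toReal hFm.aemeasurable (ae_lt_top hFm hft), ENNReal.ofReal_toReal hft, hI]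
  have hcont : ContinuousOn I S := by
    intro x hx
    obtain ⟨b, hb, hxb⟩ := hSup x hx
    refine (hcontb b hb x ⟨hx.1, hxb.le⟩).mono_of_mem_nhdsWithin ?_
    filter_upwards [self_mem_nhdsWithin, mem_nhdsWithin_of_mem_nhds (Iio_mem_nhds hxb)] with y hy hy2
    exact ⟨hy.1, le_of_lt hy2⟩
  refine ⟨hmono, hcont, ?_⟩
  set g : ℝ → ℝ := fun t => Function.invFunOn I S (ENNReal.ofReal t) with hg
  have hex : ∀ t, 0 ≤ t → ENNReal.ofReal t < γ → ∃ s ∈ S, I s = ENNReal.ofReal t := by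
    intro t ht htγ
    rw [hγ] at htγ
    obtain ⟨s, hs⟩ := lt_iSup_iff.1 htγ
    obtain ⟨hsS, hs⟩ := lt_iSup_iff.1 hs
    obtain ⟨u, hu, hu2⟩ := intermediate_value_Icc hsS.1 (hcontb s hsS)
      (show ENNReal.ofReal t ∈ Set.Icc (I 0) (I s) from ⟨by rw [hI0]; exact zero_le, hs.le⟩)
    exact ⟨u, hSdown s hsS u hu.1 hu.2, hu2⟩
  have hgS : ∀ t, 0 ≤ t → ENNReal.ofReal t < γ → g t ∈ S := fun t ht h =>
    Function.invFunOn_mem (hex t ht h)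
  have hgI : ∀ t, 0 ≤ t → ENNReal.ofReal t < γ → I (g t) = ENNReal.ofReal t := fun t ht h =>
    Function.invFunOn_eq (hex t ht h)
  have hinv : ∀ s ∈ S, g ((I s).toReal) = s := by
    intro s hs
    have h : ∃ u ∈ S, I u = ENNReal.ofReal (I s).toReal :=
      ⟨s, hs, (ENNReal.ofReal_toReal (hIfin s hs)).symm⟩
    refine hmono.injOn (Function.invFunOn_mem h) hs ?_
    exact (Function.invFunOn_eq h).trans (ENNReal.ofReal_toReal (hIfin s hs))
  have hlip1 : ∀ t₁ t₂, 0 ≤ t₁ → ENNReal.ofReal t₁ < γ → 0 ≤ t₂ → ENNReal.ofReal t₂ < γ →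
      g t₁ ≤ g t₂ → |g t₁ - g t₂| ≤ M * |t₁ - t₂| := by
    intro t₁ t₂ h1 h1' h2 h2' hle
    have hMp := hMpos _ (hgS t₁ h1 h1')
    have e := hsplit (g t₁) (g t₂) (hgS t₁ h1 h1').1 hle
    have l := hlow (g t₁) (g t₂)
    have l2 : ENNReal.ofReal t₁ + (ENNReal.ofReal M)⁻¹ * ENNReal.ofReal (g t₂ - g t₁)
        ≤ ENNReal.ofReal t₂ := by
      rw [← hgI t₁ h1 h1', ← hgI t₂ h2 h2', e]
      gcongr
    have hnn : 0 ≤ M⁻¹ * (g t₂ - g t₁) := mul_nonneg (inv_nonneg.2 hM0) (sub_nonneg.2 hle)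
    rw [← ENNReal.ofReal_inv_of_pos hMp, ← ENNReal.ofReal_mul (inv_nonneg.2 hM0),
      ← ENNReal.ofReal_add h1 hnn, ENNReal.ofReal_le_ofReal_iff h2] at l2
    have l3 : M⁻¹ * (g t₂ - g t₁) ≤ t₂ - t₁ := by linarith
    rw [inv_mul_le_iff₀ hMp] at l3
    rw [abs_sub_comm, abs_of_nonneg (sub_nonneg.2 hle), abs_sub_comm]
    exact l3.trans (mul_le_mul_of_nonneg_left (le_abs_self _) hM0)
  have hlip : ∀ t₁ t₂, 0 ≤ t₁ → ENNReal.ofReal t₁ < γ → 0 ≤ t₂ → ENNReal.ofReal t₂ < γ →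
      |g t₁ - g t₂| ≤ M * |t₁ - t₂| := by
    intro t₁ t₂ h1 h1' h2 h2'
    rcases le_total (g t₁) (g t₂) with h | h
    · exact hlip1 t₁ t₂ h1 h1' h2 h2' h
    · rw [abs_sub_comm, abs_sub_comm t₁]
      exact hlip1 t₂ t₁ h2 h2' h1 h1' h
  refine ⟨g, fun t ht h => ⟨(hgS t ht h).1, (hgS t ht h).2, hgI t ht h⟩,
    fun s hs h => hinv s ⟨hs, h⟩, hlip, ?_⟩
  intro t ht htγ
  have hγd : ∀ s, s ≤ t → ENNReal.ofReal s < γ := fun s hs =>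
    (ENNReal.ofReal_le_ofReal hs).trans_lt htγ
  have hgle : ∀ s, 0 ≤ s → s ≤ t → ∀ b ∈ S, (g s ≤ b ↔ ENNReal.ofReal s ≤ I b) := by
    intro s hs hst b hb
    rw [← hgI s hs (hγd s hst)]
    exact (hmono.le_iff_le (hgS s hs (hγd s hst)) hb).symm
  have hgtS := hgS t ht htγ
  have hgcont : ContinuousOn g (Set.Ioc 0 t) := by
    have : LipschitzOnWith (Real.toNNReal M) g (Set.Ioc 0 t) := by
      refine LipschitzOnWith.of_dist_le_mul fun x hx y hy => ?_
      rw [Real.coe_toNNReal _ hM0]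
      exact hlip x y hx.1.le (hγd x hx.2) hy.1.le (hγd y hy.2)
    exact this.continuousOn
  have hgm : AEMeasurable g (volume.restrict (Set.Ioc 0 t)) :=
    hgcont.aemeasurable measurableSet_Ioc
  have hfin : ∫⁻ s in Set.Ioc 0 (g t), F s ≠ ∞ := by
    have := hIfin _ hgtS
    rwa [hI] at this
  have hν : Measure.map g (volume.restrict (Set.Ioc 0 t))
      = (volume.restrict (Set.Ioc 0 (g t))).withDensity F := by
    have : IsFiniteMeasure (Measure.map g (volume.restrict (Set.Ioc 0 t))) := by
      infer_instance
    refine Measure.ext_of_Iic _ _ fun a => ?_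
    rw [Measure.map_apply_of_aemeasurable hgm measurableSet_Iic,
      withDensity_apply _ measurableSet_Iic, Measure.restrict_restrict measurableSet_Iic,
      Measure.restrict_apply' measurableSet_Ioc]
    rcases lt_or_ge a 0 with ha | ha
    · have e1 : g ⁻¹' Set.Iic a ∩ Set.Ioc 0 t = ∅ := by
        ext s
        simp only [Set.mem_inter_iff, Set.mem_preimage, Set.mem_Iic, Set.mem_empty_iff_false,
          iff_false, not_and]
        intro h1 h2
        have := (hgS s h2.1.le (hγd s h2.2)).1
        linarith
      have e2 : Set.Iic a ∩ Set.Ioc 0 (g t) = ∅ := by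
        ext s
        simp only [Set.mem_inter_iff, Set.mem_Iic, Set.mem_Ioc, Set.mem_empty_iff_false,
          iff_false, not_and]
        intro h1 h2
        linarith
      rw [e1, e2]; simp
    · have hb0 : 0 ≤ min a (g t) := le_min ha hgtS.1
      have hbS : min a (g t) ∈ S := hSdown _ hgtS _ hb0 (min_le_right _ _)
      have hIt : I (min a (g t)) ≤ ENNReal.ofReal t := by
        rw [← hgI t ht htγ]
        exact hmono.monotoneOn hbS hgtS (min_le_right _ _)
      have e2 : Set.Iic a ∩ Set.Ioc 0 (g t) = Set.Ioc 0 (min a (g t)) := by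
        ext s
        simp only [Set.mem_inter_iff, Set.mem_Iic, Set.mem_Ioc, le_min_iff]
        tauto
      have e1 : g ⁻¹' Set.Iic a ∩ Set.Ioc 0 t = Set.Ioc 0 (I (min a (g t))).toReal := by
        ext s
        simp only [Set.mem_inter_iff, Set.mem_preimage, Set.mem_Iic, Set.mem_Ioc]
        have key : ∀ s, 0 < s → s ≤ t → (g s ≤ a ↔ s ≤ (I (min a (g t))).toReal) := by
          intro s h0 h1
          have hst : g s ≤ g t := by
            rw [hgle s h0.le h1 _ hgtS, hgI t ht htγ]
            exact ENNReal.ofReal_le_ofReal h1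
          rw [← ENNReal.ofReal_le_iff_le_toReal (hIfin _ hbS), ← hgle s h0.le h1 _ hbS, le_min_iff]
          tauto
        constructor
        · rintro ⟨h1, h2, h3⟩
          exact ⟨h2, (key s h2 h3).1 h1⟩
        · rintro ⟨h1, h2⟩
          have h3 : s ≤ t := h2.trans (ENNReal.toReal_le_of_le_ofReal ht hIt)
          exact ⟨(key s h1 h3).2 h2, h1, h3⟩
      rw [e1, e2, ← hI, Real.volume_Ioc, sub_zero, ENNReal.ofReal_toReal (hIfin _ hbS)]
  have hfm : Measurable fun x => ENNReal.ofReal (f x) := hf_meas.ennreal_ofReal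
  have hl : ∫⁻ s in Set.Ioc 0 t, ENNReal.ofReal (f (g s)) = ENNReal.ofReal (g t) := by
    rw [← lintegral_map' (f := fun x => ENNReal.ofReal (f x)) hfm.aemeasurable hgm, hν,
      lintegral_withDensity_eq_lintegral_mul _ hFm hfm]
    have : ∫⁻ s in Set.Ioc 0 (g t), (F * fun x => ENNReal.ofReal (f x)) s
        = ∫⁻ s in Set.Ioc 0 (g t), 1 := by
      refine lintegral_congr_ae ?_
      filter_upwards [ae_lt_top hFm hfin] with s hs
      refine ENNReal.inv_mul_cancel ?_ ENNReal.ofReal_ne_top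
      intro h0
      simp [hF, h0] at hs
    rw [this]; simp
  rw [intervalIntegral.integral_of_le ht, integral_eq_lintegral_of_nonneg_ae
    (Filter.Eventually.of_forall fun s => hf_nonneg _)
    (hf_meas.comp_aemeasurable hgm).aestronglyMeasurable, hl, ENNReal.toReal_ofReal hgtS.1]
end

section
/- Let f : [0,∞) → [0,∞) be bounded and Borel measurable, and let z : [0,∞) → [0,∞) satisfy z(t) = ∫₀ᵗ f(z(s)) ds for all t ≥ 0. Then for every t ≥ 0 with z(t) > 0 one has ∫₀^{z(t)} 1/f(u) du ≤ t, where the integral is the Lebesgue integral with values in [0,∞] and 1/0 := ∞. -/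
open MeasureTheory ENNReal

/-- if `z` solves the IVP `z(t) = ∫₀ᵗ f(z(s)) ds` with `f` bounded,
nonnegative and Borel measurable, then `∫₀^{z(t)} 1/f(u) du ≤ t` for every
`t ≥ 0` with `z(t) > 0` (Lebesgue integral with values in `[0,∞]`, `1/0 := ∞`). -/
theorem stmt_6 (f : ℝ → ℝ) (hf_nonneg : ∀ t, 0 ≤ f t)
    (hf_bdd : ∃ M : ℝ, ∀ t, f t ≤ M) (hf_meas : Measurable f)
    (z : ℝ → ℝ) (hz_nonneg : ∀ t, 0 ≤ z t)
    (hz : ∀ t, 0 ≤ t → z t = ∫ s in (0:ℝ)..t, f (z s)) :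
    ∀ t, 0 ≤ t → 0 < z t →
      (∫⁻ u in Set.Ioc (0:ℝ) (z t), (ENNReal.ofReal (f u))⁻¹) ≤ ENNReal.ofReal t := by
  intro t ht hzt
  obtain ⟨M, hM⟩ := hf_bdd
  have hint : IntervalIntegrable (fun s => f (z s)) volume 0 t := by
    by_contra h
    have := hz t ht
    rw [intervalIntegral.integral_undef h] at this
    linarith
  have hint' : ∀ s ∈ Set.Icc 0 t, IntervalIntegrable (fun s => f (z s)) volume 0 s := by
    intro s hs
    apply hint.mono_set
    rw [Set.uIcc_of_le hs.1, Set.uIcc_of_le ht]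
    exact Set.Icc_subset_Icc_right hs.2
  have hcont : ContinuousOn z (Set.Icc 0 t) := by
    have h1 : ContinuousOn (fun x => ∫ s in (0:ℝ)..x, f (z s)) (Set.Icc 0 t) := by
      have := intervalIntegral.continuousOn_primitive_interval
        (μ := volume) (f := fun s => f (z s)) (a := 0) (b := t)
        ((intervalIntegrable_iff_integrableOn_Icc_of_le ht).1 hint |>.mono_set
          (by rw [Set.uIcc_of_le ht]))
      rwa [Set.uIcc_of_le ht] at this
    exact h1.congr (fun x hx => hz x hx.1)
  have hmono : ∀ a ∈ Set.Icc 0 t, ∀ b ∈ Set.Icc 0 t, a ≤ b → z a ≤ z b := by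
    intro a ha b hb hab
    rw [hz a ha.1, hz b hb.1]
    exact intervalIntegral.integral_mono_interval le_rfl ha.1 hab
      (Filter.Eventually.of_forall fun _ => hf_nonneg _) (hint' b hb)
  have hz0 : z 0 = 0 := by rw [hz 0 le_rfl]; simp
  have hlint : ∀ c ∈ Set.Icc 0 t,
      ∫⁻ s in Set.Ioc 0 c, ENNReal.ofReal (f (z s)) = ENNReal.ofReal (z c) := by
    intro c hc
    rw [hz c hc.1, intervalIntegral.integral_of_le hc.1,
      ofReal_integral_eq_lintegral_ofReal]
    · exact (intervalIntegrable_iff_integrableOn_Ioc_of_le hc.1).1 (hint' c hc)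
    · exact Filter.Eventually.of_forall fun _ => hf_nonneg _
  obtain ⟨Z, hZ⟩ : ∃ Z : ℝ → ℝ, Z = fun s => z (max 0 (min s t)) := ⟨_, rfl⟩
  have hZc : Continuous Z := by
    rw [hZ]
    exact hcont.comp_continuous (by fun_prop)
      (fun x => ⟨le_max_left _ _, max_le ht (min_le_right _ _)⟩)
  have hZz : ∀ s ∈ Set.Icc 0 t, Z s = z s := by
    intro s hs
    rw [hZ]; simp [hs.1, hs.2]
  have hg : Measurable (fun s => ENNReal.ofReal (f (Z s))) :=
    (hf_meas.comp hZc.measurable).ennreal_ofReal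
  have hlZ : ∀ c ∈ Set.Icc 0 t,
      ∫⁻ s in Set.Ioc 0 c, ENNReal.ofReal (f (Z s)) = ENNReal.ofReal (z c) := by
    intro c hc
    rw [← hlint c hc]
    apply setLIntegral_congr_fun measurableSet_Ioc
    intro s hs
    simp only
    rw [hZz s ⟨hs.1.le, hs.2.trans hc.2⟩]
  obtain ⟨ν, hν⟩ : ∃ ν : Measure ℝ, ν = (volume.restrict (Set.Ioc 0 t)).withDensity
    (fun s => ENNReal.ofReal (f (Z s))) := ⟨_, rfl⟩
  have hfin : IsFiniteMeasure ν := by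
    rw [hν]
    apply isFiniteMeasure_withDensity
    rw [hlZ t ⟨ht, le_rfl⟩]
    exact ENNReal.ofReal_ne_top
  have key : volume.restrict (Set.Ioc 0 (z t)) = ν.map Z := by
    apply Measure.ext_of_Iic
    intro a
    rw [Measure.map_apply hZc.measurable measurableSet_Iic, hν,
      withDensity_apply _ (hZc.measurable measurableSet_Iic),
      Measure.restrict_restrict (hZc.measurable measurableSet_Iic),
      Measure.restrict_apply measurableSet_Iic]
    rcases lt_or_ge a 0 with ha | ha
    · have e1 : Set.Iic a ∩ Set.Ioc 0 (z t) = ∅ := by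
        ext x
        simp only [Set.mem_inter_iff, Set.mem_Iic, Set.mem_Ioc, Set.mem_empty_iff_false, iff_false]
        rintro ⟨h1, h2, h3⟩
        linarith
      have e2 : Z ⁻¹' Set.Iic a = ∅ := by
        ext x
        simp only [Set.mem_preimage, Set.mem_Iic, Set.mem_empty_iff_false, iff_false, not_le]
        rw [hZ]
        exact ha.trans_le (hz_nonneg _)
      rw [e1, e2]; simp
    · have hK : IsCompact (Set.Icc 0 t ∩ Z ⁻¹' Set.Iic a) :=
        isCompact_Icc.inter_right (isClosed_Iic.preimage hZc)
      obtain ⟨c, ⟨hc, hca⟩, hcm⟩ := hK.exists_isGreatest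
        ⟨0, ⟨le_rfl, ht⟩, by
          show Z 0 ≤ a
          rw [hZz 0 ⟨le_rfl, ht⟩, hz0]; exact ha⟩
      have hca' : z c ≤ a := by rw [← hZz c hc]; exact hca
      have hzc : z c = min a (z t) := by
        apply le_antisymm (le_min hca' (hmono c hc t ⟨ht, le_rfl⟩ hc.2))
        obtain ⟨d, hd, hda⟩ := intermediate_value_Icc ht hcont
          (show min a (z t) ∈ Set.Icc (z 0) (z t) from
            ⟨by rw [hz0]; exact le_min ha hzt.le, min_le_right _ _⟩)
        have : d ≤ c := hcm ⟨hd, by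
          show Z d ≤ a
          rw [hZz d hd, hda]; exact min_le_left _ _⟩
        rw [← hda]
        exact hmono d hd c hc this
      have e1 : Set.Iic a ∩ Set.Ioc 0 (z t) = Set.Ioc 0 (min a (z t)) := by
        ext x
        simp only [Set.mem_inter_iff, Set.mem_Iic, Set.mem_Ioc, le_min_iff]
        tauto
      have e2 : Z ⁻¹' Set.Iic a ∩ Set.Ioc 0 t = Set.Ioc 0 c := by
        ext x
        simp only [Set.mem_inter_iff, Set.mem_preimage, Set.mem_Iic, Set.mem_Ioc]
        constructor
        · rintro ⟨h1, h2, h3⟩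
          exact ⟨h2, hcm ⟨⟨h2.le, h3⟩, h1⟩⟩
        · rintro ⟨h1, h2⟩
          have hx : x ∈ Set.Icc 0 t := ⟨h1.le, h2.trans hc.2⟩
          refine ⟨?_, h1, hx.2⟩
          rw [hZz x hx]
          exact (hmono x hx c hc h2).trans hca'
      rw [e1, e2, hlZ c hc, hzc, Real.volume_Ioc, sub_zero]
  have hinv : Measurable (fun u => (ENNReal.ofReal (f u))⁻¹) := hf_meas.ennreal_ofReal.inv
  rw [key, lintegral_map hinv hZc.measurable, hν,
    lintegral_withDensity_eq_lintegral_mul _ hg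
      (show Measurable (fun s => (ENNReal.ofReal (f (Z s)))⁻¹) from hg.inv)]
  calc _ ≤ ∫⁻ s in Set.Ioc 0 t, 1 := by
        apply lintegral_mono
        intro s
        exact ENNReal.mul_inv_le_one _
    _ = ENNReal.ofReal t := by simp
end

section
/- Let X : [0,∞) → ℝ^d be right-continuous and let g : ℝ^d → [0,∞) be bounded, Borel measurable and regular at zero. Then the time change equation (TCE) (X, g) has a solution: there exists Z : [0,∞) → ℝ^d with Z(t) = X(∫₀ᵗ g(Z(s)) ds) for all t ≥ 0. -/
open MeasureTheory

open Set Filter Topology in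
theorem aux_rc_meas {E : Type*} [MetricSpace E] [MeasurableSpace E] [BorelSpace E]
    (Y : ℝ → E) (h : ∀ t, ContinuousWithinAt Y (Ici t) t) : Measurable Y := by
  have hm : ∀ n : ℕ, Measurable (fun s : ℝ => Y (((⌊s * (n + 1)⌋ : ℤ) + 1 : ℝ) / (n + 1))) := by
    intro n
    have h1 : Measurable (fun k : ℤ => Y (((k : ℝ) + 1) / (n + 1))) := measurable_from_top
    have h2 : Measurable (fun s : ℝ => ⌊s * ((n : ℝ) + 1)⌋) :=
      Int.measurable_floor.comp (measurable_id.mul_const _)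
    exact h1.comp h2
  refine measurable_of_tendsto_metrizable hm ?_
  rw [tendsto_pi_nhds]
  intro s
  have hb : ∀ n : ℕ, s ≤ (((⌊s * (n + 1)⌋ : ℤ) + 1 : ℝ) / (n + 1)) ∧
      (((⌊s * (n + 1)⌋ : ℤ) + 1 : ℝ) / (n + 1)) ≤ s + 1 / ((n : ℝ) + 1) := by
    intro n
    have hn : (0 : ℝ) < n + 1 := by positivity
    constructor
    · rw [le_div_iff₀ hn]
      exact (Int.lt_floor_add_one _).le
    · rw [div_le_iff₀ hn, add_mul, one_div, inv_mul_cancel₀ hn.ne']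
      linarith [Int.floor_le (s * ((n : ℝ) + 1))]
  refine (h s).tendsto.comp (tendsto_nhdsWithin_iff.2 ⟨?_, Eventually.of_forall fun n => (hb n).1⟩)
  refine tendsto_of_tendsto_of_tendsto_of_le_of_le tendsto_const_nhds ?_
    (fun n => (hb n).1) (fun n => (hb n).2)
  simpa using (tendsto_const_nhds (x := s)).add (tendsto_one_div_add_atTop_nhds_zero_nat (𝕜 := ℝ))

open Set Filter Topology ENNReal in
theorem aux_main (φ : ℝ → ℝ) (hm : Measurable φ) (h0 : ∀ s, 0 ≤ φ s) (M : ℝ) (hM : 0 < M)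
    (hb : ∀ s, φ s ≤ M)
    (hr : ∀ a, 0 ≤ a → 0 < φ a → ∃ ε > (0:ℝ), ∃ η > (0:ℝ), ∀ u, a ≤ u → u < a + η → ε < φ u) :
    ∃ A : ℝ → ℝ, (∀ t, 0 ≤ A t) ∧ ∀ t, 0 ≤ t → A t = ∫ s in (0:ℝ)..t, φ (A s) := by
  have hFm : Measurable (fun s => (ENNReal.ofReal (φ s))⁻¹) := hm.ennreal_ofReal.inv
  obtain ⟨μ, hμ⟩ : ∃ μ : Measure ℝ, μ = (volume.restrict (Ici (0:ℝ))).withDensity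
    (fun s => (ENNReal.ofReal (φ s))⁻¹) := ⟨_, rfl⟩
  have hac : ∀ S : Set ℝ, volume S = 0 → μ S = 0 := by
    intro S hS
    rw [hμ]
    exact withDensity_absolutelyContinuous _ _ (Measure.absolutelyContinuous_of_le
      Measure.restrict_le_self hS)
  have hμI : ∀ S : Set ℝ, MeasurableSet S → S ⊆ Ici 0 →
      μ S = ∫⁻ s in S, (ENNReal.ofReal (φ s))⁻¹ := by
    intro S hS hS0
    rw [hμ, withDensity_apply _ hS, Measure.restrict_restrict hS, inter_eq_left.2 hS0]
  have hlow : ∀ S : Set ℝ, MeasurableSet S → S ⊆ Ici 0 →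
      (ENNReal.ofReal M)⁻¹ * volume S ≤ μ S := by
    intro S hS hS0
    rw [hμI S hS hS0, ← setLIntegral_const]
    exact lintegral_mono fun s => ENNReal.inv_le_inv.2 (ENNReal.ofReal_le_ofReal (hb s))
  have hH0 : μ (Iic 0) = 0 := by
    rw [hμ, withDensity_apply _ measurableSet_Iic, Measure.restrict_restrict measurableSet_Iic]
    have : (Iic (0:ℝ) ∩ Ici 0) = {0} := by
      ext x; simp [le_antisymm_iff]
    rw [this]; simp
  have hMi : (ENNReal.ofReal M)⁻¹ ≠ 0 := ENNReal.inv_ne_zero.2 ENNReal.ofReal_ne_top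
  have hmono : ∀ u v, u ≤ v → μ (Iic u) ≤ μ (Iic v) := fun u v h => measure_mono (Iic_subset_Iic.2 h)
  -- strict monotonicity
  have hadd : ∀ u v, u ≤ v → μ (Iic v) = μ (Iic u) + μ (Ioc u v) := by
    intro u v h
    rw [← Iic_union_Ioc_eq_Iic h, measure_union (Iic_disjoint_Ioc le_rfl) measurableSet_Ioc]
  have hstrict : ∀ u v, 0 ≤ u → u < v → μ (Iic v) ≠ ∞ → μ (Iic u) < μ (Iic v) := by
    intro u v hu h hf
    rw [hadd u v h.le] at hf ⊢
    refine ENNReal.lt_add_right (fun h => hf (by simp [h])) ?_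
    have := hlow (Ioc u v) measurableSet_Ioc (fun x hx => hu.trans hx.1.le)
    refine fun h' => ?_
    rw [h', nonpos_iff_eq_zero, mul_eq_zero] at this
    rcases this with h1 | h1
    · exact hMi h1
    · rw [Real.volume_Ioc, ENNReal.ofReal_eq_zero] at h1; linarith
  -- left continuity
  have hleft : ∀ a c, (∀ u < a, μ (Iic u) ≤ c) → μ (Iic a) ≤ c := by
    intro a c h
    obtain ⟨x, hx, hxa, hxt⟩ := exists_seq_strictMono_tendsto a
    have h1 : μ (Iic a) ≤ μ (Iio a) := by
      rw [← Iio_union_right]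
      refine (measure_union_le _ _).trans ?_
      rw [hac {a} (by simp)]; simp
    refine h1.trans ?_
    rw [← iUnion_Iic_eq_Iio_of_lt_of_tendsto hxa hxt, Monotone.measure_iUnion]
    · exact iSup_le fun n => h _ (hxa n)
    · exact fun i j hij => Iic_subset_Iic.2 (hx.monotone hij)
  -- right continuity
  have hright : ∀ a v c, a < v → μ (Iic v) ≠ ∞ → (∀ u, a < u → c ≤ μ (Iic u)) →
      c ≤ μ (Iic a) := by
    intro a v c hav hv h
    have ht := tendsto_measure_biInter_gt (μ := μ) (s := fun u : ℝ => Iic u) (a := a)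
      (fun r _ => measurableSet_Iic.nullMeasurableSet)
      (fun i j _ hij => Iic_subset_Iic.2 hij) ⟨v, hav, hv⟩
    have he : (⋂ r, ⋂ (_ : r > a), Iic r) = Iic a := by
      ext x
      simp only [mem_iInter, mem_Iic]
      exact ⟨fun h => le_of_forall_gt_imp_ge_of_dense h, fun h r hr => h.trans hr.le⟩
    rw [he] at ht
    exact ge_of_tendsto ht (eventually_nhdsWithin_of_forall fun u hu => h u hu)
  set S : ℝ → Set ℝ := fun t => {u | 0 ≤ u ∧ ENNReal.ofReal t ≤ μ (Iic u)} with hS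
  have hSbdd : ∀ t, BddBelow (S t) := fun t => ⟨0, fun u hu => hu.1⟩
  have hSne : ∀ t, (S t).Nonempty := by
    intro t
    refine ⟨M * max t 0, by positivity, ?_⟩
    have h1 := hlow (Icc 0 (M * max t 0)) measurableSet_Icc (fun x hx => hx.1)
    have h2 : μ (Icc 0 (M * max t 0)) ≤ μ (Iic (M * max t 0)) := measure_mono Icc_subset_Iic_self
    refine le_trans ?_ (h1.trans h2)
    rw [Real.volume_Icc, sub_zero, ENNReal.ofReal_mul hM.le, ← mul_assoc,
      ENNReal.inv_mul_cancel (by simpa using hM) ENNReal.ofReal_ne_top, one_mul]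
    exact ENNReal.ofReal_le_ofReal (le_max_left _ _)
  set A : ℝ → ℝ := fun t => sInf (S t) with hA
  have hA0 : ∀ t, 0 ≤ A t := fun t => le_csInf (hSne t) fun u hu => hu.1
  have hAle : ∀ t u, 0 ≤ u → ENNReal.ofReal t ≤ μ (Iic u) → A t ≤ u :=
    fun t u hu h => csInf_le (hSbdd t) ⟨hu, h⟩
  have hAlt : ∀ t u, A t < u → ENNReal.ofReal t ≤ μ (Iic u) := by
    intro t u h
    obtain ⟨v, hv, hvu⟩ := exists_lt_of_csInf_lt (hSne t) h
    exact hv.2.trans (hmono _ _ hvu.le)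
  have hAmono : Monotone A := by
    intro s t hst
    exact csInf_le_csInf (hSbdd s) (hSne t)
      fun u hu => ⟨hu.1, (ENNReal.ofReal_le_ofReal hst).trans hu.2⟩
  have hHA : ∀ t, μ (Iic (A t)) ≤ ENNReal.ofReal t := by
    intro t
    refine hleft _ _ fun u hu => ?_
    by_cases hu0 : 0 ≤ u
    · by_contra hc
      exact absurd (hAle t u hu0 (not_le.1 hc).le) (not_le.2 hu)
    · exact (hmono u 0 (not_le.1 hu0).le).trans (by simp [hH0])
  -- case 1
  have hcase : ∀ t, 0 ≤ t → μ (Iic (A t)) = ENNReal.ofReal t →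
      A t = ∫ s in (0:ℝ)..t, φ (A s) := by
    intro t ht hHt
    have hfin : μ (Iic (A t)) ≠ ∞ := by rw [hHt]; exact ENNReal.ofReal_ne_top
    have hmap : (volume.restrict (Ioc 0 t)).map A = μ.restrict (Iic (A t)) := by
      haveI : IsFiniteMeasure ((volume.restrict (Ioc 0 t)).map A) := by infer_instance
      refine Measure.ext_of_Iic _ _ fun u => ?_
      rw [Measure.map_apply hAmono.measurable measurableSet_Iic,
        Measure.restrict_apply (hAmono.measurable measurableSet_Iic),
        Measure.restrict_apply measurableSet_Iic, Iic_inter_Iic]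
      rcases le_or_gt (A t) u with hu | hu
      · rw [min_eq_right hu, hHt]
        have : A ⁻¹' Iic u ∩ Ioc 0 t = Ioc 0 t :=
          inter_eq_right.2 fun s hs => (hAmono hs.2).trans hu
        rw [this]; simp
      · rw [min_eq_left hu.le]
        rcases lt_or_ge u 0 with hu0 | hu0
        · have h1 : A ⁻¹' Iic u = ∅ := by
            ext s; simp only [mem_preimage, mem_Iic, mem_empty_iff_false, iff_false, not_le]
            exact hu0.trans_le (hA0 s)
          have h2 : μ (Iic u) = 0 := le_antisymm ((hmono u 0 hu0.le).trans hH0.le) bot_le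
          rw [h1, h2]; simp
        · have hle : μ (Iic u) ≤ ENNReal.ofReal t := (hmono _ _ hu.le).trans hHt.le
          have hne : μ (Iic u) ≠ ∞ := ne_top_of_le_ne_top ENNReal.ofReal_ne_top hle
          have : A ⁻¹' Iic u ∩ Ioc 0 t = Ioc 0 (μ (Iic u)).toReal := by
            ext s
            simp only [mem_inter_iff, mem_preimage, mem_Iic, mem_Ioc]
            constructor
            · rintro ⟨h1, h2, h3⟩
              refine ⟨h2, ?_⟩
              rw [← ENNReal.ofReal_le_iff_le_toReal hne]
              exact hright u (A t) _ hu hfin fun v hv => hAlt s v (h1.trans_lt hv)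
            · rintro ⟨h1, h2⟩
              rw [← ENNReal.ofReal_le_iff_le_toReal hne] at h2
              exact ⟨hAle s u hu0 h2, h1, (ENNReal.ofReal_le_ofReal_iff ht).1 (h2.trans hle)⟩
          rw [this, Real.volume_Ioc, sub_zero, ENNReal.ofReal_toReal hne]
    rw [intervalIntegral.integral_of_le ht,
      integral_eq_lintegral_of_nonneg_ae (Eventually.of_forall fun s => h0 _)
        (hm.comp hAmono.measurable).aestronglyMeasurable]
    have h1 : ∫⁻ s in Ioc 0 t, ENNReal.ofReal (φ (A s)) =
        ∫⁻ u in Iic (A t), ENNReal.ofReal (φ u) ∂μ := by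
      rw [← hmap, lintegral_map hm.ennreal_ofReal hAmono.measurable]
    rw [h1, hμ, restrict_withDensity measurableSet_Iic,
      lintegral_withDensity_eq_lintegral_mul _ hFm hm.ennreal_ofReal,
      Measure.restrict_restrict measurableSet_Iic]
    have hset : Iic (A t) ∩ Ici 0 = Icc 0 (A t) := by rw [inter_comm, Ici_inter_Iic]
    rw [hset]
    have hae : ∀ᵐ u ∂(volume.restrict (Icc 0 (A t))), (ENNReal.ofReal (φ u))⁻¹ < ∞ := by
      refine ae_lt_top hFm ?_
      rw [← hμI _ measurableSet_Icc (fun x hx => hx.1)]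
      exact ne_top_of_le_ne_top hfin (measure_mono Icc_subset_Iic_self)
    have h2 : ∫⁻ u in Icc 0 (A t), ((fun s => (ENNReal.ofReal (φ s))⁻¹) *
        fun s => ENNReal.ofReal (φ s)) u = ∫⁻ u in Icc 0 (A t), 1 := by
      refine lintegral_congr_ae ?_
      filter_upwards [hae] with u hu
      rw [Pi.mul_apply]
      exact ENNReal.inv_mul_cancel (ENNReal.inv_ne_top.1 hu.ne) ENNReal.ofReal_ne_top
    rw [h2]
    simp [hA0 t]
  refine ⟨A, hA0, fun t ht => ?_⟩
  rcases (hHA t).eq_or_lt with hE | hL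
  · exact hcase t ht hE
  · have hfin : μ (Iic (A t)) ≠ ∞ := hL.ne_top
    have hinf : ∀ u, A t < u → μ (Iic u) = ∞ := by
      intro u hu
      by_contra hc
      exact absurd (hright (A t) u (ENNReal.ofReal t) hu hc fun v hv => hAlt t v hv) (not_le.2 hL)
    have hz : φ (A t) = 0 := by
      by_contra hc
      obtain ⟨ε, hε, η, hη, H⟩ := hr (A t) (hA0 t) (lt_of_le_of_ne (h0 _) (Ne.symm hc))
      have h1 := hinf (A t + η / 2) (by linarith)
      rw [hadd (A t) _ (by linarith), ENNReal.add_eq_top] at h1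
      rcases h1 with h1 | h1
      · exact hfin h1
      · rw [hμI _ measurableSet_Ioc (fun x hx => (hA0 t).trans hx.1.le)] at h1
        have h2 : ∫⁻ s in Ioc (A t) (A t + η / 2), (ENNReal.ofReal (φ s))⁻¹ ≤
            ∫⁻ s in Ioc (A t) (A t + η / 2), (ENNReal.ofReal ε)⁻¹ := by
          refine setLIntegral_mono measurable_const fun s hs => ?_
          exact ENNReal.inv_le_inv.2 (ENNReal.ofReal_le_ofReal
            (H s hs.1.le (by linarith [hs.2])).le)
        rw [h1, setLIntegral_const, top_le_iff] at h2
        refine ENNReal.mul_ne_top ?_ ?_ h2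
        · exact ENNReal.inv_ne_top.2 (by simpa using hε)
        · simp
    set t' := (μ (Iic (A t))).toReal with ht'
    have ht'0 : 0 ≤ t' := ENNReal.toReal_nonneg
    have hof : ENNReal.ofReal t' = μ (Iic (A t)) := ENNReal.ofReal_toReal hfin
    have htt : t' < t := (ENNReal.ofReal_lt_ofReal_iff_of_nonneg ht'0).1 (hof ▸ hL)
    have hAt' : A t' = A t := by
      refine le_antisymm (hAmono htt.le) ?_
      by_contra hc
      have hc := not_le.1 hc
      obtain ⟨v, hv1, hv2⟩ := exists_between hc
      have := hAlt t' v hv1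
      rw [hof] at this
      exact absurd this (not_le.2 (hstrict v (A t) ((hA0 _).trans hv1.le) hv2 hfin))
    have hint : ∀ a b, IntervalIntegrable (fun s => φ (A s)) volume a b := by
      intro a b
      refine (intervalIntegrable_const (c := M)).mono_fun
        (hm.comp hAmono.measurable).aestronglyMeasurable (Eventually.of_forall fun s => ?_)
      simp only [Real.norm_eq_abs]
      rw [abs_of_nonneg (h0 _), abs_of_pos hM]
      exact hb _
    rw [← intervalIntegral.integral_add_adjacent_intervals (hint 0 t') (hint t' t)]
    have hzero : ∫ s in t'..t, φ (A s) = 0 := by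
      rw [intervalIntegral.integral_congr (g := fun _ => (0:ℝ))]
      · simp
      · intro s hs
        rw [uIcc_of_le htt.le] at hs
        have : A s = A t := le_antisymm (hAmono hs.2) (hAt' ▸ hAmono hs.1)
        simp only [this, hz]
    rw [hzero, add_zero, ← hcase t' ht'0 (by rw [hAt', hof]), hAt']

/-- existence of a solution of the time change equation `(X, g)`
for a right-continuous path `X` and a bounded, Borel measurable function `g`
which is regular at zero. -/
theorem stmt_11 (d : ℕ) (X : ℝ → EuclideanSpace ℝ (Fin d))
    (hX_rc : ∀ t, 0 ≤ t → ContinuousWithinAt X (Set.Ici t) t)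
    (g : EuclideanSpace ℝ (Fin d) → ℝ) (hg_nonneg : ∀ x, 0 ≤ g x)
    (hg_bdd : ∃ M : ℝ, ∀ x, g x ≤ M) (hg_meas : Measurable g)
    (hg_reg : ∀ x, 0 < g x →
      ∃ ε > (0:ℝ), ∃ δ > (0:ℝ), ∀ y, ‖y - x‖ < δ → ε < g y) :
    ∃ Z : ℝ → EuclideanSpace ℝ (Fin d),
      ∀ t, 0 ≤ t → Z t = X (∫ s in (0:ℝ)..t, g (Z s)) := by
  obtain ⟨M, hM⟩ := hg_bdd
  have hY : ∀ t, ContinuousWithinAt (fun s => X (max s 0)) (Set.Ici t) t := by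
    intro t
    have h1 : ContinuousWithinAt (fun s : ℝ => max s 0) (Set.Ici t) t := by fun_prop
    exact (hX_rc (max t 0) (le_max_right _ _)).comp (f := fun s : ℝ => max s 0) h1
      (fun s hs => Set.mem_Ici.2 (max_le_max_right 0 (Set.mem_Ici.1 hs)))
  obtain ⟨A, hA0, hA⟩ := aux_main (fun s => g (X (max s 0)))
    (hg_meas.comp (aux_rc_meas _ hY)) (fun s => hg_nonneg _) (max M 1) (by positivity)
    (fun s => (hM _).trans (le_max_left _ _)) (by
      intro a ha hpos
      obtain ⟨ε, hε, δ, hδ, H⟩ := hg_reg _ hpos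
      obtain ⟨η, hη, H2⟩ := Metric.continuousWithinAt_iff.1 (hY a) δ hδ
      refine ⟨ε, hε, η, hη, fun u hu hu2 => H _ ?_⟩
      rw [← dist_eq_norm]
      refine H2 hu ?_
      rw [Real.dist_eq, abs_of_nonneg (by linarith)]
      linarith)
  refine ⟨fun t => X (A t), fun t ht => ?_⟩
  show X (A t) = _
  congr 1
  rw [hA t ht]
  simp only [max_eq_left (hA0 _)]
end

section
/- Let X : [0,∞) → ℝ^d be right-continuous and let g : ℝ^d → [0,∞) be bounded, Borel measurable and regular at zero. Then the time change equation (TCE) (X, g) has a unique solution (i.e. any two functions Z₁, Z₂ : [0,∞) → ℝ^d with Zᵢ(t) = X(∫₀ᵗ g(Zᵢ(s)) ds) for all t ≥ 0 are equal) if and only if the initial value problem (IVP) (g∘X, 0) has a unique solution (i.e. any two functions y₁, y₂ : [0,∞) → [0,∞) with yᵢ(t) = ∫₀ᵗ g(X(yᵢ(s))) ds for all t ≥ 0 are equal). -/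
open MeasureTheory

/-- for a right-continuous path `X` and a bounded, Borel
measurable `g` which is regular at zero, the time change equation `(X, g)` has
a unique solution if and only if the IVP `(g ∘ X, 0)` has a unique solution. -/
theorem stmt_12 (d : ℕ) (X : ℝ → EuclideanSpace ℝ (Fin d))
    (hX_rc : ∀ t, 0 ≤ t → ContinuousWithinAt X (Set.Ici t) t)
    (g : EuclideanSpace ℝ (Fin d) → ℝ) (hg_nonneg : ∀ x, 0 ≤ g x)
    (hg_bdd : ∃ M : ℝ, ∀ x, g x ≤ M) (hg_meas : Measurable g)
    (hg_reg : ∀ x, 0 < g x →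
      ∃ ε > (0:ℝ), ∃ δ > (0:ℝ), ∀ y, ‖y - x‖ < δ → ε < g y) :
    (∀ Z₁ Z₂ : ℝ → EuclideanSpace ℝ (Fin d),
        (∀ t, 0 ≤ t → Z₁ t = X (∫ s in (0:ℝ)..t, g (Z₁ s))) →
        (∀ t, 0 ≤ t → Z₂ t = X (∫ s in (0:ℝ)..t, g (Z₂ s))) →
        ∀ t, 0 ≤ t → Z₁ t = Z₂ t) ↔
    (∀ y₁ y₂ : ℝ → ℝ, (∀ t, 0 ≤ y₁ t) → (∀ t, 0 ≤ y₂ t) →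
        (∀ t, 0 ≤ t → y₁ t = ∫ s in (0:ℝ)..t, g (X (y₁ s))) →
        (∀ t, 0 ≤ t → y₂ t = ∫ s in (0:ℝ)..t, g (X (y₂ s))) →
        ∀ t, 0 ≤ t → y₁ t = y₂ t) := by
  have hcongr : ∀ (u v : ℝ → ℝ) (t : ℝ), 0 ≤ t → (∀ s, 0 ≤ s → u s = v s) →
      ∫ s in (0:ℝ)..t, u s = ∫ s in (0:ℝ)..t, v s := by
    intro u v t ht h
    apply intervalIntegral.integral_congr
    intro s hs
    rw [Set.uIcc_of_le ht] at hs
    exact h s hs.1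
  constructor
  · intro H y₁ y₂ _ _ h₁ h₂ t ht
    have key := H (fun s => X (y₁ s)) (fun s => X (y₂ s))
      (fun t ht => congrArg X (h₁ t ht)) (fun t ht => congrArg X (h₂ t ht))
    rw [h₁ t ht, h₂ t ht]
    exact hcongr _ _ t ht (fun s hs => congrArg g (key s hs))
  · intro H Z₁ Z₂ h₁ h₂ t ht
    have nn : ∀ (Z : ℝ → EuclideanSpace ℝ (Fin d)) (t : ℝ),
        0 ≤ ∫ s in (0:ℝ)..(max t 0), g (Z s) := fun Z t =>
      intervalIntegral.integral_nonneg (le_max_right _ _) (fun _ _ => hg_nonneg _)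
    have sol : ∀ (Z : ℝ → EuclideanSpace ℝ (Fin d)),
        (∀ t, 0 ≤ t → Z t = X (∫ s in (0:ℝ)..t, g (Z s))) → ∀ t, 0 ≤ t →
        ∫ s in (0:ℝ)..(max t 0), g (Z s) =
          ∫ r in (0:ℝ)..t, g (X (∫ s in (0:ℝ)..(max r 0), g (Z s))) := by
      intro Z hZ t ht
      rw [max_eq_left ht]
      refine hcongr _ _ t ht (fun r hr => ?_)
      rw [max_eq_left hr, ← hZ r hr]
    have key := H (fun t => ∫ s in (0:ℝ)..(max t 0), g (Z₁ s))
      (fun t => ∫ s in (0:ℝ)..(max t 0), g (Z₂ s)) (nn Z₁) (nn Z₂) (sol Z₁ h₁) (sol Z₂ h₂) t ht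
    simp only [max_eq_left ht] at key
    rw [h₁ t ht, h₂ t ht, key]
end

section
/- Let (Ω, 𝒜, P) be a probability space and X : Ω × [0,∞) → ℝ^d be jointly measurable with right-continuous paths t ↦ X(ω,t) for every ω. Let g : ℝ^d → [0,∞) be bounded, Borel measurable and regular at zero, and define τ₀(ω) := inf{t ≥ 0 : g(X(ω,t)) = 0} ∈ [0,∞]. Assume that for P-almost every ω with τ₀(ω) < ∞ one has ∫_{τ₀(ω)}^{τ₀(ω)+ε} 1/g(X(ω,s)) ds = ∞ for every ε > 0. Then there exists a jointly measurable Z : Ω × [0,∞) → ℝ^d such that for P-almost every ω, Z(ω,t) = X(ω, ∫₀ᵗ g(Z(ω,s)) ds) for all t ≥ 0; moreover any two such solutions Z₁, Z₂ are indistinguishable, i.e. for P-almost every ω, Z₁(ω,t) = Z₂(ω,t) for all t ≥ 0. -/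
open MeasureTheory ENNReal

lemma tce_push (φ : ℝ → ℝ) (hφm : Measurable φ) (hφ0 : ∀ x, 0 ≤ φ x) (h : ℝ) (hh : 0 ≤ h)
    (hint : Integrable φ) (F : ℝ → ℝ≥0∞) (hF : Measurable F) :
    ∫⁻ u in Set.Ioc 0 h, F (∫ s in (0:ℝ)..u, φ s) * ENNReal.ofReal (φ u)
      = ∫⁻ r in Set.Ioc 0 (∫ s in (0:ℝ)..h, φ s), F r := by
  set Φ : ℝ → ℝ := fun u => ∫ s in (0:ℝ)..u, φ s with hΦ
  have hii : ∀ a b, IntervalIntegrable φ volume a b := fun a b => hint.intervalIntegrable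
  have hcont : Continuous Φ := intervalIntegral.continuous_primitive hii 0
  have hmono : Monotone Φ := by
    intro a b hab
    have : Φ b - Φ a = ∫ s in a..b, φ s := by
      simp only [hΦ]
      rw [intervalIntegral.integral_interval_sub_left (hii _ _) (hii _ _)]
    have h2 : 0 ≤ ∫ s in a..b, φ s := intervalIntegral.integral_nonneg hab (fun x _ => hφ0 x)
    linarith
  have h0 : Φ 0 = 0 := by simp [hΦ]
  set μ : Measure ℝ := (volume.restrict (Set.Ioc 0 h)).withDensity (fun u => ENNReal.ofReal (φ u)) with hμ
  have hμI : ∀ m, 0 ≤ m → m ≤ h → μ (Set.Iic m) = ENNReal.ofReal (Φ m) := by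
    intro m hm hmh
    rw [hμ, withDensity_apply _ measurableSet_Iic, Measure.restrict_restrict measurableSet_Iic]
    have : Set.Iic m ∩ Set.Ioc 0 h = Set.Ioc 0 m := by
      ext x; simp only [Set.mem_inter_iff, Set.mem_Iic, Set.mem_Ioc]
      constructor
      · rintro ⟨a, b, c⟩; exact ⟨b, a⟩
      · rintro ⟨a, b⟩; exact ⟨b, a, b.trans hmh⟩
    rw [this, ← ofReal_integral_eq_lintegral_ofReal hint.integrableOn (Filter.Eventually.of_forall hφ0)]
    simp only [hΦ]
    rw [intervalIntegral.integral_of_le hm]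
  have hμc : μ (Set.Iic h)ᶜ = 0 := by
    rw [hμ, withDensity_apply _ measurableSet_Iic.compl, Measure.restrict_restrict measurableSet_Iic.compl]
    have : (Set.Iic h)ᶜ ∩ Set.Ioc 0 h = ∅ := by
      ext x; simp only [Set.mem_inter_iff, Set.mem_compl_iff, Set.mem_Iic, Set.mem_Ioc]; simp; intro a b; linarith
    rw [this]; simp
  have hμ0 : μ (Set.Iic 0) = 0 := by rw [hμI 0 le_rfl hh, h0]; simp
  have hfin : IsFiniteMeasure μ := by
    constructor
    rw [← Set.union_compl_self (Set.Iic h)]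
    refine (measure_union_le _ _).trans_lt ?_
    rw [hμc, hμI h hh le_rfl]; simp
  have hmap : μ.map Φ = volume.restrict (Set.Ioc 0 (Φ h)) := by
    have : IsFiniteMeasure (μ.map Φ) := inferInstance
    refine Measure.ext_of_Iic _ _ (fun c => ?_)
    rw [Measure.map_apply hcont.measurable measurableSet_Iic, Measure.restrict_apply measurableSet_Iic]
    rcases lt_or_ge c 0 with hc | hc
    · have e1 : Set.Iic c ∩ Set.Ioc 0 (Φ h) = ∅ := by
        ext x; simp; intros; linarith
      rw [e1, measure_empty]
      refine measure_mono_null ?_ hμ0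
      intro x hx
      simp only [Set.mem_preimage, Set.mem_Iic] at hx ⊢
      by_contra hx0
      have := hmono (not_le.1 hx0).le
      linarith
    rcases le_or_gt (Φ h) c with hc2 | hc2
    · have e1 : Set.Iic c ∩ Set.Ioc 0 (Φ h) = Set.Ioc 0 (Φ h) := by
        ext x; simp; intros; linarith
      rw [e1, Real.volume_Ioc, sub_zero, ← hμI h hh le_rfl]
      apply le_antisymm
      · calc μ (Φ ⁻¹' Set.Iic c) ≤ μ Set.univ := measure_mono (Set.subset_univ _)
          _ ≤ μ (Set.Iic h) + μ (Set.Iic h)ᶜ := by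
            rw [← Set.union_compl_self (Set.Iic h)]; exact measure_union_le _ _
          _ = _ := by rw [hμc, add_zero]
      · apply measure_mono
        intro x hx
        exact (hmono hx).trans hc2
    · have e1 : Set.Iic c ∩ Set.Ioc 0 (Φ h) = Set.Ioc 0 c := by
        ext x; simp; constructor
        · rintro ⟨a, b, _⟩; exact ⟨b, a⟩
        · rintro ⟨a, b⟩; exact ⟨b, a, by linarith⟩
      rw [e1, Real.volume_Ioc, sub_zero]
      have hcomp : IsCompact (Set.Icc 0 h ∩ Φ ⁻¹' {c}) :=
        isCompact_Icc.inter_right (isClosed_singleton.preimage hcont)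
      have hne : (Set.Icc 0 h ∩ Φ ⁻¹' {c}).Nonempty := by
        obtain ⟨x, hx, hx2⟩ := intermediate_value_Icc hh hcont.continuousOn
          (show c ∈ Set.Icc (Φ 0) (Φ h) from ⟨by rw [h0]; exact hc, hc2.le⟩)
        exact ⟨x, hx, hx2⟩
      obtain ⟨m, ⟨⟨hm0, hmh⟩, hmc⟩, hmax⟩ := hcomp.exists_isGreatest hne
      have hmc : Φ m = c := hmc
      have e2 : Φ ⁻¹' Set.Iic c = Set.Iic m := by
        ext x
        simp only [Set.mem_preimage, Set.mem_Iic]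
        constructor
        · intro hx
          by_contra hxm
          have hxm := not_le.1 hxm
          have hxh : x ≤ h := by
            by_contra hxh
            have := hmono (not_le.1 hxh).le
            linarith
          have := hmax (a := x) ⟨⟨by linarith, hxh⟩, le_antisymm hx (by rw [← hmc]; exact hmono hxm.le)⟩
          linarith
        · intro hx; rw [← hmc]; exact hmono hx
      rw [e2, hμI m hm0 hmh, hmc]
  rw [← hmap, lintegral_map hF hcont.measurable, hμ, lintegral_withDensity_eq_lintegral_mul]
  · refine lintegral_congr (fun u => ?_)
    simp only [Pi.mul_apply, mul_comm, hΦ]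
  · exact hφm.ennreal_ofReal
  · exact hF.comp hcont.measurable

/-- additive functional -/
noncomputable def tceA (f : ℝ → ℝ) (s : ℝ) : ℝ≥0∞ :=
  ∫⁻ u in Set.Ioc 0 s, (ENNReal.ofReal (f u))⁻¹

/-- its inverse -/
noncomputable def tceH (f : ℝ → ℝ) (t : ℝ) : ℝ :=
  sInf {s | 0 ≤ s ∧ ENNReal.ofReal t ≤ tceA f s}

lemma tceA_mono (f : ℝ → ℝ) : Monotone (tceA f) := fun a b hab =>
  lintegral_mono_set (Set.Ioc_subset_Ioc_right hab)

lemma tceA_add (f : ℝ → ℝ) (a b : ℝ) (ha : 0 ≤ a) (hab : a ≤ b) :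
    tceA f b = tceA f a + ∫⁻ u in Set.Ioc a b, (ENNReal.ofReal (f u))⁻¹ := by
  unfold tceA
  rw [← Set.Ioc_union_Ioc_eq_Ioc ha hab, lintegral_union measurableSet_Ioc]
  exact Set.Ioc_disjoint_Ioc_of_le le_rfl

lemma tceA_incr (f : ℝ → ℝ) (M : ℝ) (hfM : ∀ u, f u ≤ M) (a b : ℝ) :
    (ENNReal.ofReal M)⁻¹ * ENNReal.ofReal (b - a) ≤
      ∫⁻ u in Set.Ioc a b, (ENNReal.ofReal (f u))⁻¹ := by
  calc _ = ∫⁻ u in Set.Ioc a b, (ENNReal.ofReal M)⁻¹ := by simp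
    _ ≤ _ := lintegral_mono (fun u => ENNReal.inv_le_inv.2 (ENNReal.ofReal_le_ofReal (hfM u)))

lemma tceA_lt (f : ℝ → ℝ) (M : ℝ) (hfM : ∀ u, f u ≤ M) (a b : ℝ) (ha : 0 ≤ a)
    (hab : a < b) (hA : tceA f a ≠ ∞) : tceA f a < tceA f b := by
  rw [tceA_add f a b ha hab.le]
  refine ENNReal.lt_add_right hA ?_
  have := tceA_incr f M hfM a b
  intro h
  rw [h] at this
  simp at this
  linarith

lemma tceH_nonempty (f : ℝ → ℝ) (M : ℝ) (hM : 0 < M) (hfM : ∀ u, f u ≤ M) (t : ℝ) :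
    {s | 0 ≤ s ∧ ENNReal.ofReal t ≤ tceA f s}.Nonempty := by
  refine ⟨M * max t 0, by positivity, ?_⟩
  refine le_trans ?_ (tceA_incr f M hfM 0 _)
  rw [sub_zero, ENNReal.ofReal_mul hM.le, ← mul_assoc, ENNReal.inv_mul_cancel (by simpa using hM) (by simp),
    one_mul]
  exact ENNReal.ofReal_le_ofReal (le_max_left _ _)

lemma tceH_bdd (f : ℝ → ℝ) (t : ℝ) : BddBelow {s | 0 ≤ s ∧ ENNReal.ofReal t ≤ tceA f s} :=
  ⟨0, fun _ h => h.1⟩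

lemma tceH_nonneg (f : ℝ → ℝ) (t : ℝ) : 0 ≤ tceH f t := Real.sInf_nonneg (fun _ h => h.1)

lemma tceH_eq (f : ℝ → ℝ) (M : ℝ) (hM : 0 < M) (hfM : ∀ u, f u ≤ M) (t T : ℝ) (hT : 0 ≤ T)
    (h1 : ∀ s, 0 ≤ s → s < T → tceA f s < ENNReal.ofReal t)
    (h2 : ∀ s, T < s → ENNReal.ofReal t ≤ tceA f s) : tceH f t = T := by
  apply le_antisymm
  · refine le_of_forall_gt_imp_ge_of_dense (fun s hs => ?_)
    exact csInf_le (tceH_bdd f t) ⟨by linarith, h2 s hs⟩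
  · refine le_csInf (tceH_nonempty f M hM hfM t) ?_
    rintro s ⟨hs, hs2⟩
    by_contra h
    exact absurd (h1 s hs (not_le.1 h)) (not_lt.2 hs2)

lemma tceH_lt_iff (f : ℝ → ℝ) (M : ℝ) (hM : 0 < M) (hfM : ∀ u, f u ≤ M) (t r : ℝ) :
    tceH f t < r ↔ ∃ q : ℚ, 0 ≤ (q:ℝ) ∧ (q:ℝ) < r ∧ ENNReal.ofReal t ≤ tceA f q := by
  unfold tceH
  rw [csInf_lt_iff (tceH_bdd f t) (tceH_nonempty f M hM hfM t)]
  constructor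
  · rintro ⟨s, ⟨hs, hs2⟩, hs3⟩
    obtain ⟨q, hq1, hq2⟩ := exists_rat_btwn hs3
    exact ⟨q, by linarith, hq2, hs2.trans (tceA_mono f hq1.le)⟩
  · rintro ⟨q, h1, h2, h3⟩
    exact ⟨q, ⟨h1, h3⟩, h2⟩

lemma tceH_mono (f : ℝ → ℝ) (M : ℝ) (hM : 0 < M) (hfM : ∀ u, f u ≤ M) : Monotone (tceH f) := by
  intro a b hab
  refine csInf_le_csInf (tceH_bdd f a) (tceH_nonempty f M hM hfM b) ?_
  rintro s ⟨h1, h2⟩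
  exact ⟨h1, (ENNReal.ofReal_le_ofReal hab).trans h2⟩

lemma tceA_left (f : ℝ → ℝ) (h : ℝ) (c : ℝ≥0∞) (hs : ∀ s, 0 ≤ s → s < h → tceA f s ≤ c) :
    tceA f h ≤ c := by
  rcases le_or_gt h 0 with h0 | h0
  · unfold tceA; rw [Set.Ioc_eq_empty (by linarith)]; simp
  have e : ∫⁻ u in Set.Ioc 0 h, (ENNReal.ofReal (f u))⁻¹
      = ∫⁻ u in ⋃ n : ℕ, Set.Ioc 0 (h - h / (n + 1)), (ENNReal.ofReal (f u))⁻¹ := by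
    rw [← restrict_Ioo_eq_restrict_Ioc]
    congr 2
    ext x
    simp only [Set.mem_Ioo, Set.mem_iUnion, Set.mem_Ioc]
    constructor
    · rintro ⟨h1, h2⟩
      obtain ⟨n, hn⟩ := exists_nat_gt (h / (h - x))
      refine ⟨n, h1, ?_⟩
      have hp : 0 < h - x := by linarith
      rw [div_lt_iff₀ hp] at hn
      have : h / (n + 1) ≤ h - x := by
        rw [div_le_iff₀ (by positivity)]; nlinarith
      linarith
    · rintro ⟨n, h1, h2⟩
      have : 0 < h / ((n:ℝ) + 1) := by positivity
      exact ⟨h1, by linarith⟩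
  unfold tceA
  rw [e, setLIntegral_iUnion_of_directed]
  · refine iSup_le (fun n => hs _ ?_ ?_)
    · have : h / ((n:ℝ) + 1) ≤ h := div_le_self h0.le (by linarith [(Nat.cast_nonneg n : (0:ℝ) ≤ n)])
      linarith
    · have : 0 < h / ((n:ℝ) + 1) := by positivity
      linarith
  · refine Monotone.directed_le ?_
    intro a b hab
    refine Set.Ioc_subset_Ioc_right ?_
    have : (a:ℝ) ≤ b := by exact_mod_cast hab
    gcongr

lemma tceA_right (f : ℝ → ℝ) (h : ℝ) (hh : 0 ≤ h) (ε δ : ℝ) (hε : 0 < ε) (hδ : 0 < δ)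
    (hf : ∀ s, h ≤ s → s < h + δ → ε < f s) (c : ℝ≥0∞) (hc : c ≠ ∞)
    (hs : ∀ s, h < s → c ≤ tceA f s) : c ≤ tceA f h := by
  rcases eq_or_ne (tceA f h) ∞ with hi | hi
  · rw [hi]; exact le_top
  have key : ∀ η : ℝ, 0 < η → η < δ → c ≤ tceA f h + ENNReal.ofReal (ε⁻¹ * η) := by
    intro η h1 h2
    refine (hs (h + η) (by linarith)).trans ?_
    rw [tceA_add f h (h+η) hh (by linarith)]
    gcongr
    calc _ ≤ ∫⁻ u in Set.Ioc h (h + η), ENNReal.ofReal (ε⁻¹) := by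
          refine setLIntegral_mono measurable_const (fun u hu => ?_)
          rw [ENNReal.ofReal_inv_of_pos hε]
          exact ENNReal.inv_le_inv.2 (ENNReal.ofReal_le_ofReal (hf u hu.1.le (by linarith [hu.2])).le)
      _ = _ := by
        rw [ENNReal.ofReal_mul (by positivity)]; simp
  refine ENNReal.le_of_forall_pos_le_add (fun e he _ => ?_)
  have he' : (0:ℝ) < e := he
  set η := min (δ / 2) (ε * e) with hη
  have hη0 : 0 < η := by positivity
  refine (key η hη0 ((min_le_left _ _).trans_lt (by linarith))).trans ?_
  gcongr
  rw [← ENNReal.ofReal_coe_nnreal]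
  apply ENNReal.ofReal_le_ofReal
  calc ε⁻¹ * η ≤ ε⁻¹ * (ε * e) := by gcongr; exact min_le_right _ _
    _ = e := by field_simp

lemma tce_unique (f ψ : ℝ → ℝ) (hf : Measurable f) (hf0 : ∀ u, 0 ≤ f u) (M : ℝ) (hM : 0 < M)
    (hfM : ∀ u, f u ≤ M) (hψ : Measurable ψ) (hψ0 : ∀ u, 0 ≤ ψ u) (hψM : ∀ u, ψ u ≤ M)
    (hdiv : ∀ τ : ℝ, IsGLB {t : ℝ | 0 ≤ t ∧ f t = 0} τ →
      ∀ ε > (0:ℝ), (∫⁻ s in Set.Ioc τ (τ + ε), (ENNReal.ofReal (f s))⁻¹) = ∞)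
    (heq : ∀ t, 0 ≤ t → ψ t = f (∫ s in (0:ℝ)..t, ψ s)) (t : ℝ) (ht : 0 ≤ t) :
    ∫ s in (0:ℝ)..t, ψ s = tceH f t := by
  have hii : ∀ a b, IntervalIntegrable ψ volume a b := fun a b => by
    refine (intervalIntegrable_const (c := M)).mono_fun hψ.aestronglyMeasurable ?_
    refine Filter.Eventually.of_forall (fun x => ?_)
    show ‖ψ x‖ ≤ ‖M‖
    rw [Real.norm_of_nonneg (hψ0 x), Real.norm_of_nonneg hM.le]; exact hψM x
  set T : ℝ → ℝ := fun u => ∫ s in (0:ℝ)..u, ψ s with hTdef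
  have hTm : Monotone T := by
    intro a b hab
    have : T b - T a = ∫ s in a..b, ψ s := by
      simp only [hTdef]
      rw [intervalIntegral.integral_interval_sub_left (hii _ _) (hii _ _)]
    have h2 : 0 ≤ ∫ s in a..b, ψ s := intervalIntegral.integral_nonneg hab (fun x _ => hψ0 x)
    linarith
  have heq' : ∀ t, 0 ≤ t → ψ t = f (T t) := heq
  have hT0 : T 0 = 0 := by simp [hTdef]
  set φ : ℝ → ℝ := (Set.Ioc 0 t).indicator ψ with hφ
  have hφint : Integrable φ := by
    rw [hφ, integrable_indicator_iff measurableSet_Ioc]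
    exact (intervalIntegrable_iff_integrableOn_Ioc_of_le ht).1 (hii 0 t)
  have hφT : ∀ u, 0 ≤ u → u ≤ t → ∫ s in (0:ℝ)..u, φ s = T u := by
    intro u hu hut
    refine intervalIntegral.integral_congr_ae (Filter.Eventually.of_forall (fun x hx => ?_))
    rw [Set.uIoc_of_le hu] at hx
    exact Set.indicator_of_mem (show x ∈ Set.Ioc 0 t from ⟨hx.1, hx.2.trans hut⟩) _
  have push := tce_push φ (hψ.indicator measurableSet_Ioc)
    (fun x => Set.indicator_nonneg (fun x _ => hψ0 x) x) t ht hφint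
    (fun r => (ENNReal.ofReal (f r))⁻¹) hf.ennreal_ofReal.inv
  rw [hφT t ht le_rfl] at push
  have push2 : ∫⁻ u in Set.Ioc 0 t, (ENNReal.ofReal (ψ u))⁻¹ * ENNReal.ofReal (ψ u)
      = tceA f (T t) := by
    rw [tceA, ← push]
    refine setLIntegral_congr_fun measurableSet_Ioc (fun u hu => ?_)
    rw [hφT u hu.1.le hu.2, ← heq' u hu.1.le, hφ, Set.indicator_of_mem hu]
  have hle : tceA f (T t) ≤ ENNReal.ofReal t := by
    rw [← push2]
    calc _ ≤ ∫⁻ u in Set.Ioc 0 t, 1 := lintegral_mono (fun u => ENNReal.inv_mul_le_one _)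
      _ = _ := by simp
  symm
  have hTt : 0 ≤ T t := by rw [← hT0]; exact hTm ht
  refine tceH_eq f M hM hfM t (T t) hTt ?_ ?_
  · intro s hs hsT
    refine lt_of_lt_of_le (tceA_lt f M hfM s (T t) hs hsT ?_) hle
    exact ne_top_of_le_ne_top ENNReal.ofReal_ne_top ((tceA_mono f hsT.le).trans hle)
  · intro s hs
    by_cases hz : ∃ u ∈ Set.Ioc 0 t, ψ u = 0
    · obtain ⟨u, hu, hu0⟩ := hz
      have hmem : T u ∈ {t : ℝ | 0 ≤ t ∧ f t = 0} := by
        refine ⟨by rw [← hT0]; exact hTm hu.1.le, ?_⟩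
        rw [← heq' u hu.1.le]; exact hu0
      have hg := isGLB_csInf (s := {t : ℝ | 0 ≤ t ∧ f t = 0}) ⟨_, hmem⟩ ⟨0, fun _ h => h.1⟩
      set τ := sInf {t : ℝ | 0 ≤ t ∧ f t = 0}
      have hτ0 : 0 ≤ τ := hg.2 (fun _ h => h.1)
      have hτ : τ ≤ T u := hg.1 hmem
      have hτs : τ < s := lt_of_le_of_lt (hτ.trans (hTm hu.2)) hs
      have := hdiv τ hg (s - τ) (by linarith)
      rw [add_sub_cancel] at this
      have h2 : tceA f s = ∞ := by
        rw [tceA_add f τ s hτ0 hτs.le, this]; simp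
      rw [h2]; exact le_top
    · push Not at hz
      refine le_trans ?_ (tceA_mono f hs.le)
      rw [← push2]
      refine le_of_eq ?_
      symm
      calc _ = ∫⁻ u in Set.Ioc 0 t, 1 := by
            refine setLIntegral_congr_fun measurableSet_Ioc (fun u hu => ?_)
            refine ENNReal.inv_mul_cancel ?_ ENNReal.ofReal_ne_top
            simpa using lt_of_le_of_ne (hψ0 u) (Ne.symm (hz u hu))
        _ = _ := by simp

lemma tce_exists (f : ℝ → ℝ) (hf : Measurable f) (hf0 : ∀ u, 0 ≤ f u) (M : ℝ) (hM : 0 < M)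
    (hfM : ∀ u, f u ≤ M)
    (hreg : ∀ t, 0 ≤ t → 0 < f t → ∃ ε > (0:ℝ), ∃ δ > (0:ℝ), ∀ s, t ≤ s → s < t + δ → ε < f s)
    (t : ℝ) (ht : 0 ≤ t) :
    ∫ s in (0:ℝ)..t, f (tceH f s) = tceH f t := by
  set h := tceH f t with hh
  have hh0 : 0 ≤ h := tceH_nonneg f t
  have hHm : Measurable (tceH f) := (tceH_mono f M hM hfM).measurable
  have hlt : ∀ s, 0 ≤ s → s < h → tceA f s < ENNReal.ofReal t := by
    intro s hs hsh
    by_contra hc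
    exact absurd (csInf_le (tceH_bdd f t) ⟨hs, not_lt.1 hc⟩) (not_le.2 hsh)
  have hgt : ∀ s, h < s → ENNReal.ofReal t ≤ tceA f s := by
    intro s hs
    obtain ⟨s', ⟨_, h2⟩, h3⟩ := (csInf_lt_iff (tceH_bdd f t) (tceH_nonempty f M hM hfM t)).1 hs
    exact h2.trans (tceA_mono f h3.le)
  have hAle : tceA f h ≤ ENNReal.ofReal t := tceA_left f h _ (fun s h1 h2 => (hlt s h1 h2).le)
  have hAfin : tceA f h ≠ ∞ := ne_top_of_le_ne_top ENNReal.ofReal_ne_top hAle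
  set t' := (tceA f h).toReal with ht'
  have ht'0 : 0 ≤ t' := ENNReal.toReal_nonneg
  have ht't : t' ≤ t := ENNReal.toReal_le_of_le_ofReal ht hAle
  have hAt' : tceA f h = ENNReal.ofReal t' := (ENNReal.ofReal_toReal hAfin).symm
  -- integrate in lintegral form
  have hinv : ∀ u, 0 ≤ u → u ≤ h → tceH f (tceA f u).toReal = u := by
    intro u hu huh
    have hfin : tceA f u ≠ ∞ := ne_top_of_le_ne_top hAfin (tceA_mono f huh)
    refine tceH_eq f M hM hfM _ u hu ?_ ?_
    · intro s hs hsu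
      rw [ENNReal.ofReal_toReal hfin]
      exact tceA_lt f M hfM s u hs hsu (ne_top_of_le_ne_top hfin (tceA_mono f hsu.le))
    · intro s hs
      rw [ENNReal.ofReal_toReal hfin]
      exact tceA_mono f hs.le
  set φ : ℝ → ℝ := (Set.Ioc 0 h).indicator (fun u => (f u)⁻¹) with hφ
  have hφm : Measurable φ := hf.inv.indicator measurableSet_Ioc
  have hφ0 : ∀ x, 0 ≤ φ x := fun x => Set.indicator_nonneg (fun x _ => inv_nonneg.2 (hf0 x)) x
  have hpos : ∀ᵐ u ∂(volume.restrict (Set.Ioc 0 h)), 0 < f u := by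
    have := ae_lt_top (μ := volume.restrict (Set.Ioc 0 h)) (hf.ennreal_ofReal.inv) hAfin
    filter_upwards [this] with u hu
    simpa using hu
  have hofφ : ∀ᵐ u ∂(volume.restrict (Set.Ioc 0 h)),
      ENNReal.ofReal (φ u) = (ENNReal.ofReal (f u))⁻¹ := by
    filter_upwards [hpos, ae_restrict_mem measurableSet_Ioc] with u hu hu2
    rw [hφ, Set.indicator_of_mem hu2, ENNReal.ofReal_inv_of_pos hu]
  have hφlin : ∀ u, u ≤ h → ∫⁻ s in Set.Ioc 0 u, ENNReal.ofReal (φ s) = tceA f u := by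
    intro u huh
    exact lintegral_congr_ae (ae_restrict_of_ae_restrict_of_subset (Set.Ioc_subset_Ioc_right huh) hofφ)
  have hφint : Integrable φ := by
    have : IntegrableOn φ (Set.Ioc 0 h) := by
      refine ⟨hφm.aestronglyMeasurable, ?_⟩
      rw [hasFiniteIntegral_iff_ofReal (Filter.Eventually.of_forall hφ0), hφlin h le_rfl]
      exact hAfin.lt_top
    have h2 := (integrable_indicator_iff measurableSet_Ioc).2 this
    rwa [hφ, Set.indicator_indicator, Set.inter_self] at h2
  have hΦ : ∀ u, 0 ≤ u → u ≤ h → ∫ s in (0:ℝ)..u, φ s = (tceA f u).toReal := by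
    intro u hu huh
    rw [intervalIntegral.integral_of_le hu, integral_eq_lintegral_of_nonneg_ae
      (Filter.Eventually.of_forall hφ0) hφm.aestronglyMeasurable, hφlin u huh]
  have push := tce_push φ hφm hφ0 h hh0 hφint (fun r => ENNReal.ofReal (f (tceH f r)))
    (hf.comp hHm).ennreal_ofReal
  rw [hΦ h hh0 le_rfl] at push
  have push2 : ∫⁻ r in Set.Ioc 0 t', ENNReal.ofReal (f (tceH f r)) = ENNReal.ofReal h := by
    rw [ht', ← push]
    calc _ = ∫⁻ u in Set.Ioc 0 h, 1 := by
          refine lintegral_congr_ae ?_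
          filter_upwards [hpos, hofφ, ae_restrict_mem measurableSet_Ioc] with u h1 h2 h3
          rw [h2, hΦ u h3.1.le h3.2, hinv u h3.1.le h3.2]
          exact ENNReal.mul_inv_cancel (by simpa using h1) ENNReal.ofReal_ne_top
      _ = _ := by simp
  have hii : ∀ a b, IntervalIntegrable (fun s => f (tceH f s)) volume a b := fun a b => by
    refine (intervalIntegrable_const (c := M)).mono_fun (hf.comp hHm).aestronglyMeasurable ?_
    refine Filter.Eventually.of_forall (fun x => ?_)
    show ‖f (tceH f x)‖ ≤ ‖M‖
    rw [Real.norm_of_nonneg (hf0 _), Real.norm_of_nonneg hM.le]; exact hfM _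
  have I1 : ∫ s in (0:ℝ)..t', f (tceH f s) = h := by
    rw [intervalIntegral.integral_of_le ht'0, integral_eq_lintegral_of_nonneg_ae
      (Filter.Eventually.of_forall (fun x => hf0 _)) (hf.comp hHm).aestronglyMeasurable, push2,
      ENNReal.toReal_ofReal hh0]
  have I2 : ∫ s in t'..t, f (tceH f s) = 0 := by
    rcases eq_or_lt_of_le ht't with he | hl
    · rw [he]; simp
    have hfh : f h = 0 := by
      by_contra hne
      obtain ⟨ε, hε, δ, hδ, hr⟩ := hreg h hh0 (lt_of_le_of_ne (hf0 h) (Ne.symm hne))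
      have := tceA_right f h hh0 ε δ hε hδ hr _ ENNReal.ofReal_ne_top hgt
      rw [hAt', ENNReal.ofReal_le_ofReal_iff ht'0] at this
      linarith
    have : ∫ s in t'..t, f (tceH f s) = ∫ s in t'..t, (0:ℝ) := by
      refine intervalIntegral.integral_congr_ae (Filter.Eventually.of_forall (fun r hr => ?_))
      rw [Set.uIoc_of_le ht't] at hr
      have : tceH f r = h := by
        refine tceH_eq f M hM hfM r h hh0 ?_ ?_
        · intro s hs hsh
          refine lt_of_le_of_lt (tceA_mono f hsh.le) ?_
          rw [hAt']
          exact (ENNReal.ofReal_lt_ofReal_iff (by linarith [hr.1])).2 hr.1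
        · intro s hs
          exact (ENNReal.ofReal_le_ofReal hr.2).trans (hgt s hs)
      rw [this, hfh]
    rw [this]; simp
  rw [← intervalIntegral.integral_add_adjacent_intervals (hii 0 t') (hii t' t), I1, I2, add_zero]


/-- existence and uniqueness (up to indistinguishability) of a
jointly measurable solution of the time change equation `(X, g)` for a jointly
measurable process `X` with right-continuous paths and a bounded, Borel
measurable `g` regular at zero, under the divergence assumption
`∫_{τ₀}^{τ₀+ε} 1/g(X(ω,s)) ds = ∞` (for all `ε > 0`) for a.e. `ω` with
`τ₀(ω) = inf{t ≥ 0 : g(X(ω,t)) = 0} < ∞` (finiteness of `τ₀(ω)` being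
expressed via a real greatest lower bound `τ`). -/
theorem stmt_13 {Ω : Type*} [MeasurableSpace Ω] (P : Measure Ω)
    [IsProbabilityMeasure P] (d : ℕ) (X : Ω → ℝ → EuclideanSpace ℝ (Fin d))
    (hX_meas : Measurable fun p : Ω × ℝ => X p.1 p.2)
    (hX_rc : ∀ ω, ∀ t, 0 ≤ t → ContinuousWithinAt (X ω) (Set.Ici t) t)
    (g : EuclideanSpace ℝ (Fin d) → ℝ) (hg_nonneg : ∀ x, 0 ≤ g x)
    (hg_bdd : ∃ M : ℝ, ∀ x, g x ≤ M) (hg_meas : Measurable g)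
    (hg_reg : ∀ x, 0 < g x →
      ∃ ε > (0:ℝ), ∃ δ > (0:ℝ), ∀ y, ‖y - x‖ < δ → ε < g y)
    (hdiv : ∀ᵐ ω ∂P, ∀ τ : ℝ, IsGLB {t : ℝ | 0 ≤ t ∧ g (X ω t) = 0} τ →
      ∀ ε > (0:ℝ),
        (∫⁻ s in Set.Ioc τ (τ + ε), (ENNReal.ofReal (g (X ω s)))⁻¹) = ∞) :
    ∃ Z : Ω → ℝ → EuclideanSpace ℝ (Fin d),
      Measurable (fun p : Ω × ℝ => Z p.1 p.2) ∧
      (∀ᵐ ω ∂P, ∀ t, 0 ≤ t → Z ω t = X ω (∫ s in (0:ℝ)..t, g (Z ω s))) ∧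
      (∀ Z₁ Z₂ : Ω → ℝ → EuclideanSpace ℝ (Fin d),
        Measurable (fun p : Ω × ℝ => Z₁ p.1 p.2) →
        Measurable (fun p : Ω × ℝ => Z₂ p.1 p.2) →
        (∀ᵐ ω ∂P, ∀ t, 0 ≤ t → Z₁ ω t = X ω (∫ s in (0:ℝ)..t, g (Z₁ ω s))) →
        (∀ᵐ ω ∂P, ∀ t, 0 ≤ t → Z₂ ω t = X ω (∫ s in (0:ℝ)..t, g (Z₂ ω s))) →
        ∀ᵐ ω ∂P, ∀ t, 0 ≤ t → Z₁ ω t = Z₂ ω t) := by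
  obtain ⟨M₀, hM₀⟩ := hg_bdd
  set M := max M₀ 1 with hMdef
  have hM : 0 < M := lt_of_lt_of_le one_pos (le_max_right _ _)
  have hgM : ∀ x, g x ≤ M := fun x => (hM₀ x).trans (le_max_left _ _)
  have hXω : ∀ ω, Measurable (X ω) := fun ω => hX_meas.comp measurable_prodMk_left
  have hfω : ∀ ω, Measurable (fun s => g (X ω s)) := fun ω => hg_meas.comp (hXω ω)
  have hAm : ∀ q : ℝ, Measurable (fun ω => tceA (fun s => g (X ω s)) q) := by
    intro q
    unfold tceA
    exact Measurable.lintegral_prod_right' (f := fun p : Ω × ℝ => (ENNReal.ofReal (g (X p.1 p.2)))⁻¹)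
      (hg_meas.comp hX_meas).ennreal_ofReal.inv
  have hHm : Measurable (fun p : Ω × ℝ => tceH (fun s => g (X p.1 s)) p.2) := by
    refine measurable_of_Iio (fun r => ?_)
    have : (fun p : Ω × ℝ => tceH (fun s => g (X p.1 s)) p.2) ⁻¹' Set.Iio r
        = ⋃ q : ℚ, {p : Ω × ℝ | 0 ≤ (q:ℝ) ∧ (q:ℝ) < r ∧
          ENNReal.ofReal p.2 ≤ tceA (fun s => g (X p.1 s)) q} := by
      ext p
      simp only [Set.mem_preimage, Set.mem_Iio, Set.mem_iUnion, Set.mem_ofPred_eq]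
      exact tceH_lt_iff _ M hM (fun u => hgM _) p.2 r
    rw [this]
    refine MeasurableSet.iUnion (fun q => ?_)
    refine (MeasurableSet.const _).inter ((MeasurableSet.const _).inter ?_)
    exact measurableSet_le measurable_snd.ennreal_ofReal ((hAm q).comp measurable_fst)
  refine ⟨fun ω t => X ω (tceH (fun s => g (X ω s)) t), ?_, ?_, ?_⟩
  · exact hX_meas.comp (measurable_fst.prodMk hHm)
  · refine Filter.Eventually.of_forall (fun ω t ht => ?_)
    have := tce_exists (fun s => g (X ω s)) (hfω ω) (fun u => hg_nonneg _) M hM (fun u => hgM _) ?_ t ht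
    · simp only at this ⊢
      rw [this]
    · intro t ht hpos
      obtain ⟨ε, hε, δ, hδ, h⟩ := hg_reg _ hpos
      obtain ⟨η, hη, h2⟩ := Metric.continuousWithinAt_iff.1 (hX_rc ω t ht) δ hδ
      refine ⟨ε, hε, η, hη, fun s hs1 hs2 => h _ ?_⟩
      rw [← dist_eq_norm]
      refine h2 hs1 ?_
      rw [Real.dist_eq, abs_of_nonneg (by linarith)]; linarith
  · intro Z₁ Z₂ hZ₁ hZ₂ h₁ h₂
    filter_upwards [hdiv, h₁, h₂] with ω hd e₁ e₂ t ht
    have key : ∀ Z : Ω → ℝ → EuclideanSpace ℝ (Fin d),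
        Measurable (fun p : Ω × ℝ => Z p.1 p.2) →
        (∀ t, 0 ≤ t → Z ω t = X ω (∫ s in (0:ℝ)..t, g (Z ω s))) →
        ∫ s in (0:ℝ)..t, g (Z ω s) = tceH (fun s => g (X ω s)) t := by
      intro Z hZ e
      exact tce_unique (fun s => g (X ω s)) (fun s => g (Z ω s)) (hfω ω) (fun u => hg_nonneg _) M hM
        (fun u => hgM _) (hg_meas.comp (hZ.comp measurable_prodMk_left)) (fun u => hg_nonneg _)
        (fun u => hgM _) hd (fun t ht => by rw [← e t ht]) t ht
    rw [e₁ t ht, e₂ t ht, key Z₁ hZ₁ e₁, key Z₂ hZ₂ e₂]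
end
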